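/- Let ψ be a smooth global finite-energy 1-equivariant wave map with ψ(t,0⁺) = 0 and ψ(t,∞) = kπ for all t, where k is a nonzero integer. Then there exist a sequence t_n → ∞, scales λ_n > 0 with λ_n/t_n → 0, a number λ₀ > 0, and a sign κ ∈ {+1,−1} such that the rescaled maps ψ_n(t,r) := ψ(t_n + λ_n t, λ_n r) converge to (κ·Q(·/λ₀), 0) in L²_t([0,1); H¹×L²)_loc: for all 0 < r₁ < r₂ < ∞, ∫₀¹ ∫_{r₁}^{r₂} [ (∂_rψ_n(t,r) − κ·∂_r(Q(r/λ₀)))² + (ψ_n(t,r) − κ·Q(r/λ₀))² + (λ_n ∂_tψ(t_n+λ_n t, λ_n r))² ] r dr dt → 0 as n → ∞. -/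

import Mathlib

open MeasureTheory Real Filter Set

noncomputable section

/-- The ground state harmonic map `Q(r) = 2 arctan r`. -/
def Q (r : ℝ) : ℝ := 2 * Real.arctan r

/-- Time derivative `∂ₜψ(t,r)`. -/
def pT (ψ : ℝ → ℝ → ℝ) (t r : ℝ) : ℝ := deriv (fun s => ψ s r) t

/-- Radial derivative `∂ᵣψ(t,r)`. -/
def pR (ψ : ℝ → ℝ → ℝ) (t r : ℝ) : ℝ := deriv (fun ρ => ψ t ρ) r

/-- Energy density `((∂ₜψ)² + (∂ᵣψ)² + sin²ψ/r²) · r`. -/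
def eDen (ψ : ℝ → ℝ → ℝ) (t r : ℝ) : ℝ :=
  ((pT ψ t r) ^ 2 + (pR ψ t r) ^ 2 + (Real.sin (ψ t r)) ^ 2 / r ^ 2) * r

/-- Localized energy `E_{r₁}^{r₂}(ψ⃗(t))`. -/
def locE (ψ : ℝ → ℝ → ℝ) (t r₁ r₂ : ℝ) : ℝ := ∫ r in Set.Ioc r₁ r₂, eDen ψ t r

/-- Total energy `E(ψ⃗(t))`. -/
def totE (ψ : ℝ → ℝ → ℝ) (t : ℝ) : ℝ := ∫ r in Set.Ioi (0:ℝ), eDen ψ t r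

/-- `ψ` is a smooth global 1-equivariant wave map on `[0,∞) × (0,∞)`. -/
def IsWaveMap (ψ : ℝ → ℝ → ℝ) : Prop :=
  ContDiffOn ℝ (⊤ : ℕ∞) (fun p : ℝ × ℝ => ψ p.1 p.2) (Set.Ici (0:ℝ) ×ˢ Set.Ioi (0:ℝ)) ∧
  ∀ t r : ℝ, 0 ≤ t → 0 < r →
    deriv (fun s => pT ψ s r) t - deriv (fun ρ => pR ψ t ρ) r
      - (1 / r) * pR ψ t r + Real.sin (2 * ψ t r) / (2 * r ^ 2) = 0

/-- Finite energy: the energy density is integrable at each time `t ≥ 0`. -/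
def FiniteEnergy (ψ : ℝ → ℝ → ℝ) : Prop :=
  ∀ t : ℝ, 0 ≤ t → MeasureTheory.IntegrableOn (eDen ψ t) (Set.Ioi 0) volume

/-- The energy is conserved. -/
def EnergyConserved (ψ : ℝ → ℝ → ℝ) : Prop :=
  ∀ t : ℝ, 0 ≤ t → totE ψ t = totE ψ 0

/-- Squared `H × L²` norm density `(ψ₁² + (∂ᵣψ₀)² + ψ₀²/r²) · r`. -/
def hl2Den (f g : ℝ → ℝ) (r : ℝ) : ℝ :=
  ((g r) ^ 2 + (deriv f r) ^ 2 + (f r) ^ 2 / r ^ 2) * r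

/-- Squared `H × L²` norm of the pair `(f, g)` over the set of radii `S`. -/
def hl2Sq (f g : ℝ → ℝ) (S : Set ℝ) : ℝ := ∫ r in S, hl2Den f g r

/-- Squared `H` norm of `f` over the set of radii `S`. -/
def hSq (f : ℝ → ℝ) (S : Set ℝ) : ℝ :=
  ∫ r in S, ((deriv f r) ^ 2 + (f r) ^ 2 / r ^ 2) * r

/-- Squared (radial) `L²` norm. -/
def l2Sq (g : ℝ → ℝ) : ℝ := ∫ r in Set.Ioi (0:ℝ), (g r) ^ 2 * r

/-- Wave map energy of a pair of data `(f, g)`. -/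
def pairE (f g : ℝ → ℝ) : ℝ :=
  ∫ r in Set.Ioi (0:ℝ), ((g r) ^ 2 + (deriv f r) ^ 2 + (Real.sin (f r)) ^ 2 / r ^ 2) * r

/-- `φ` is a smooth solution of the linearized equation
`φ_tt − φ_rr − (1/r) φ_r + φ/r² = 0` on `ℝ × (0,∞)`. -/
def IsLinearWave (φ : ℝ → ℝ → ℝ) : Prop :=
  ContDiffOn ℝ (⊤ : ℕ∞) (fun p : ℝ × ℝ => φ p.1 p.2) (Set.univ ×ˢ Set.Ioi (0:ℝ)) ∧
  ∀ t r : ℝ, 0 < r →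
    deriv (fun s => pT φ s r) t - deriv (fun ρ => pR φ t ρ) r
      - (1 / r) * pR φ t r + φ t r / r ^ 2 = 0

/-- A linear wave has finite energy: its `H × L²` density is integrable at each time. -/
def LinFiniteEnergy (φ : ℝ → ℝ → ℝ) : Prop :=
  ∀ t : ℝ, MeasureTheory.IntegrableOn (hl2Den (φ t) (pT φ t)) (Set.Ioi 0) volume

/-- Degree one boundary conditions: `ψ(t,0⁺) = 0`, `ψ(t,∞) = π`. -/
def DegreeOneBC (ψ : ℝ → ℝ → ℝ) : Prop :=
  ∀ t : ℝ, 0 ≤ t →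
    Filter.Tendsto (ψ t) (nhdsWithin 0 (Set.Ioi 0)) (nhds 0) ∧
    Filter.Tendsto (ψ t) Filter.atTop (nhds Real.pi)

/-- Degree zero boundary conditions: `φ(t,0⁺) = 0`, `φ(t,∞) = 0`. -/
def DegreeZeroBC (φ : ℝ → ℝ → ℝ) : Prop :=
  ∀ t : ℝ, 0 ≤ t →
    Filter.Tendsto (φ t) (nhdsWithin 0 (Set.Ioi 0)) (nhds 0) ∧
    Filter.Tendsto (φ t) Filter.atTop (nhds 0)

/-- Differential inequalities along null lines for the null components `p`, `n` of the energy
density, and a potential `M` whose null derivatives they are, on the region `1 ≤ u < v`. -/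
structure NullSystem (M p n Λ : ℝ → ℝ → ℝ) (B : ℝ) : Prop where
  dMv : ∀ u v, 1 ≤ u → u < v → HasDerivAt (fun x => M u x) (p u v) v
  dMu : ∀ u v, 1 ≤ u → u < v → HasDerivAt (fun x => M x v) (-n u v) u
  dpu : ∀ u v, 1 ≤ u → u < v → HasDerivAt (fun x => p x v) (Λ u v) u
  dnv : ∀ u v, 1 ≤ u → u < v → HasDerivAt (fun x => n u x) (-Λ u v) v
  p_nonneg : ∀ u v, 1 ≤ u → u < v → 0 ≤ p u v
  n_nonneg : ∀ u v, 1 ≤ u → u < v → 0 ≤ n u v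
  bound : ∀ u v, 1 ≤ u → u < v → (Λ u v * (v - u)) ^ 2 ≤ 9 * (p u v * n u v)
  bdd : ∀ u v, 1 ≤ u → u < v → |M u v| ≤ B

theorem monotoneOn_of_hasDerivAt {f f' : ℝ → ℝ} {D : Set ℝ} (hD : Convex ℝ D)
    (hf : ∀ x ∈ D, HasDerivAt f (f' x) x) (h : ∀ x ∈ D, 0 ≤ f' x) : MonotoneOn f D := by
  apply monotoneOn_of_deriv_nonneg hD (fun x hx => (hf x hx).continuousAt.continuousWithinAt)
  · exact fun x hx => (hf x (interior_subset hx)).differentiableAt.differentiableWithinAt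
  · intro x hx
    rw [(hf x (interior_subset hx)).deriv]
    exact h x (interior_subset hx)

theorem antitoneOn_of_hasDerivAt {f f' : ℝ → ℝ} {D : Set ℝ} (hD : Convex ℝ D)
    (hf : ∀ x ∈ D, HasDerivAt f (f' x) x) (h : ∀ x ∈ D, f' x ≤ 0) : AntitoneOn f D := by
  apply antitoneOn_of_deriv_nonpos hD (fun x hx => (hf x hx).continuousAt.continuousWithinAt)
  · exact fun x hx => (hf x (interior_subset hx)).differentiableAt.differentiableWithinAt
  · intro x hx
    rw [(hf x (interior_subset hx)).deriv]
    exact h x (interior_subset hx)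

/-- Weighted arithmetic-geometric mean bound. -/
theorem abs_le_weighted_add {L r p n x y : ℝ} (hr : 0 < r) (hp : 0 ≤ p) (hn : 0 ≤ n)
    (hx : 0 ≤ x) (hy : 0 ≤ y) (h : (L * r) ^ 2 ≤ 9 * (p * n)) (hxy : 9 ≤ 4 * (x * y * r ^ 2)) :
    |L| ≤ x * p + y * n := by
  have h0 : 0 ≤ x * p + y * n := by positivity
  apply abs_le_of_sq_le_sq _ h0
  have hr2 : 0 < r ^ 2 := by positivity
  have h1 : L ^ 2 * r ^ 2 ≤ (x * p + y * n) ^ 2 * r ^ 2 := by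
    have : 9 * (p * n) ≤ 4 * (x * y * r ^ 2) * (p * n) :=
      mul_le_mul_of_nonneg_right hxy (mul_nonneg hp hn)
    have h3 : 0 ≤ (x * p - y * n) ^ 2 * r ^ 2 := by positivity
    nlinarith
  exact le_of_mul_le_mul_right h1 hr2

namespace NullSystem

variable {M p n Λ : ℝ → ℝ → ℝ} {B : ℝ}

theorem mono_v (S : NullSystem M p n Λ B) {u v v' : ℝ} (hu : 1 ≤ u) (hv : u < v) (hvv : v ≤ v') :
    M u v ≤ M u v' := by
  have : MonotoneOn (fun x => M u x) (Ici v) :=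
    monotoneOn_of_hasDerivAt (convex_Ici v) (fun x hx => S.dMv u x hu (hv.trans_le hx))
      (fun x hx => S.p_nonneg u x hu (hv.trans_le hx))
  exact this self_mem_Ici hvv hvv

theorem n_le (S : NullSystem M p n Λ B) {c C u v v' : ℝ} (hc : 0 < c)
    (hC : C = 9 / (4 * c ^ 2)) (hu : 1 ≤ u) (hv : u < v) (hcv : u ≤ (1 - c) * v) (hvv : v ≤ v') :
    n u v ≤ exp 1 * n u v' + exp 1 * C / v * (M u v' - M u v) := by
  have hv0 : 0 < v := by linarith
  have hC0 : 0 < C := by rw [hC]; positivity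
  have hmono : MonotoneOn (fun x => n u x * exp (-v / x) + C / v * M u x) (Ici v) := by
    apply monotoneOn_of_hasDerivAt (f' := fun x => (-Λ u x * exp (-v / x)
        + n u x * (exp (-v / x) * (v / x ^ 2))) + C / v * p u x) (convex_Ici v)
    · intro x hx
      have hx' : v ≤ x := hx
      have hx0 : x ≠ 0 := by linarith
      have h1 : HasDerivAt (fun x : ℝ => -v / x) (v / x ^ 2) x := by
        have := (hasDerivAt_const x (-v)).div (hasDerivAt_id x) hx0
        refine this.congr_deriv ?_
        simp
      exact ((S.dnv u x hu (hv.trans_le hx)).mul h1.exp).add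
        ((S.dMv u x hu (hv.trans_le hx)).const_mul (C / v))
    · intro x hx
      have hx' : v ≤ x := hx
      have hx0 : 0 < x := by linarith
      have hp := S.p_nonneg u x hu (hv.trans_le hx)
      have hn := S.n_nonneg u x hu (hv.trans_le hx)
      have hr : c * x ≤ x - u := by nlinarith
      have hL : |Λ u x| ≤ C / v * p u x + v / x ^ 2 * n u x := by
        apply abs_le_weighted_add (r := x - u) (by linarith) hp hn (by positivity) (by positivity)
          (S.bound u x hu (hv.trans_le hx))
        have h1 : (c * x) ^ 2 ≤ (x - u) ^ 2 := by gcongr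
        have h2 : C / v * (v / x ^ 2) * (c * x) ^ 2 = 9 / 4 := by
          rw [hC]; field_simp
        have h3 : C / v * (v / x ^ 2) * (c * x) ^ 2 ≤ C / v * (v / x ^ 2) * (x - u) ^ 2 := by
          gcongr
        linarith
      have he0 := exp_pos (-v / x)
      have he1 : exp (-v / x) ≤ 1 := by
        rw [exp_le_one_iff]; exact div_nonpos_of_nonpos_of_nonneg (by linarith) hx0.le
      have h4 := (abs_le.1 hL).2
      have h5 : exp (-v / x) * Λ u x ≤ exp (-v / x) * (C / v * p u x + v / x ^ 2 * n u x) :=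
        mul_le_mul_of_nonneg_left h4 he0.le
      have h6 : exp (-v / x) * (C / v * p u x) ≤ C / v * p u x :=
        mul_le_of_le_one_left (by positivity) he1
      linarith
  have h := hmono self_mem_Ici hvv hvv
  simp only at h
  have hv1 : -v / v = -1 := by field_simp
  rw [hv1] at h
  have hn := S.n_nonneg u v' hu (hv.trans_le hvv)
  have he1 : exp (-v / v') ≤ 1 := by
    rw [exp_le_one_iff]; exact div_nonpos_of_nonpos_of_nonneg (by linarith) (by linarith)
  have h7 : n u v * exp (-1) ≤ n u v' + C / v * (M u v' - M u v) := by
    have : n u v' * exp (-v / v') ≤ n u v' := mul_le_of_le_one_right hn he1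
    linarith
  calc n u v = exp 1 * (n u v * exp (-1)) := by
        rw [mul_comm, mul_assoc, ← exp_add]; simp
    _ ≤ exp 1 * (n u v' + C / v * (M u v' - M u v)) :=
        mul_le_mul_of_nonneg_left h7 (exp_pos 1).le
    _ = _ := by ring

theorem p_le (S : NullSystem M p n Λ B) {c C A u v : ℝ} (hc : 0 < c)
    (hC : C = 9 / (4 * c ^ 2)) (hA : 1 ≤ A) (hAu : A ≤ u) (hv : u < v) (hcv : u ≤ (1 - c) * v) :
    p u v ≤ exp 1 * p A v + exp 1 * C * u / v ^ 2 * (M A v - M u v) := by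
  have hu0 : 0 < u := by linarith
  have hv0 : 0 < v := by linarith
  have hC0 : 0 < C := by rw [hC]; positivity
  have hanti : AntitoneOn (fun x => p x v * exp (-x / u) + C * u / v ^ 2 * M x v) (Icc A u) := by
    apply antitoneOn_of_hasDerivAt (f' := fun x => (Λ x v * exp (-x / u)
        + p x v * (exp (-x / u) * (-1 / u))) + C * u / v ^ 2 * (-n x v)) (convex_Icc A u)
    · intro x hx
      have h1 : HasDerivAt (fun x : ℝ => -x / u) (-1 / u) x := (hasDerivAt_neg x).div_const u
      exact ((S.dpu x v (hA.trans hx.1) (hx.2.trans_lt hv)).mul h1.exp).add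
        ((S.dMu x v (hA.trans hx.1) (hx.2.trans_lt hv)).const_mul _)
    · intro x hx
      have hx1 := hA.trans hx.1
      have hxv := hx.2.trans_lt hv
      have hp := S.p_nonneg x v hx1 hxv
      have hn := S.n_nonneg x v hx1 hxv
      have hr : c * v ≤ v - x := by nlinarith [hx.2]
      have hL : |Λ x v| ≤ 1 / u * p x v + C * u / v ^ 2 * n x v := by
        apply abs_le_weighted_add (r := v - x) (by linarith) hp hn (by positivity) (by positivity)
          (S.bound x v hx1 hxv)
        have h1 : (c * v) ^ 2 ≤ (v - x) ^ 2 := by gcongr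
        have h2 : 1 / u * (C * u / v ^ 2) * (c * v) ^ 2 = 9 / 4 := by
          rw [hC]; field_simp
        have h3 : 1 / u * (C * u / v ^ 2) * (c * v) ^ 2
            ≤ 1 / u * (C * u / v ^ 2) * (v - x) ^ 2 := by
          gcongr
        linarith
      have he0 := exp_pos (-x / u)
      have he1 : exp (-x / u) ≤ 1 := by
        rw [exp_le_one_iff]; exact div_nonpos_of_nonpos_of_nonneg (by linarith) hu0.le
      have h5 : exp (-x / u) * Λ x v ≤ exp (-x / u) * (1 / u * p x v + C * u / v ^ 2 * n x v) :=
        mul_le_mul_of_nonneg_left (abs_le.1 hL).2 he0.le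
      have h6 : exp (-x / u) * (C * u / v ^ 2 * n x v) ≤ C * u / v ^ 2 * n x v :=
        mul_le_of_le_one_left (by positivity) he1
      have h7 : p x v * (exp (-x / u) * (-1 / u)) = - (exp (-x / u) * (1 / u * p x v)) := by ring
      rw [h7]
      linarith
  have h := hanti (left_mem_Icc.2 hAu) (right_mem_Icc.2 hAu) hAu
  simp only at h
  have hu1 : -u / u = -1 := by field_simp
  rw [hu1] at h
  have hp := S.p_nonneg A v hA (hAu.trans_lt hv)
  have he1 : exp (-A / u) ≤ 1 := by
    rw [exp_le_one_iff]; exact div_nonpos_of_nonpos_of_nonneg (by linarith) (by linarith)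
  have h7 : p u v * exp (-1) ≤ p A v + C * u / v ^ 2 * (M A v - M u v) := by
    have : p A v * exp (-A / u) ≤ p A v := mul_le_of_le_one_right hp he1
    linarith
  calc p u v = exp 1 * (p u v * exp (-1)) := by
        rw [mul_comm, mul_assoc, ← exp_add]; simp
    _ ≤ exp 1 * (p A v + C * u / v ^ 2 * (M A v - M u v)) :=
        mul_le_mul_of_nonneg_left h7 (exp_pos 1).le
    _ = _ := by ring

/-- Limit of the potential along an outgoing null line. -/
theorem exists_limit_v (S : NullSystem M p n Λ B) {u : ℝ} (hu : 1 ≤ u) :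
    ∃ l, (∀ v, u < v → M u v ≤ l) ∧ ∀ ε > 0, ∃ V, u < V ∧ ∀ v ≥ V, l - ε ≤ M u v := by
  have hne : (M u '' Ioi u).Nonempty := ⟨_, u + 1, by simp, rfl⟩
  have hb : BddAbove (M u '' Ioi u) := by
    refine ⟨B, ?_⟩
    rintro _ ⟨v, hv, rfl⟩
    exact (abs_le.1 (S.bdd u v hu hv)).2
  refine ⟨sSup (M u '' Ioi u), fun v hv => le_csSup hb ⟨v, hv, rfl⟩, fun ε hε => ?_⟩
  obtain ⟨_, ⟨V, hV, rfl⟩, h⟩ := exists_lt_of_lt_csSup hne (sub_lt_self _ hε)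
  exact ⟨V, hV, fun v hv => h.le.trans (S.mono_v hu hV hv)⟩

theorem energy_le_of_tail (S : NullSystem M p n Λ B) {c C K A V X β : ℝ} (hc : 0 < c)
    (hC : C = 9 / (4 * c ^ 2)) (hK : 0 < K) (hA : 1 ≤ A) (hV : 0 < V)
    (htail : ∀ u, A ≤ u → ∀ᶠ v in atTop, M A v - M u v ≤ β)
    (hX : ∀ w u w', V ≤ w → A ≤ u → u ≤ (1 - c) * w → w ≤ w' →
      M u w' - M u w ≤ X * exp (K * u / w))
    {u v : ℝ} (hv : V ≤ v) (hAu : A ≤ u) (huv : u ≤ (1 - c) * v) :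
    M A v - M u v ≤ exp 1 * β + exp 1 * C * X / K * exp (K * u / v) := by
  have hv0 : 0 < v := hV.trans_le hv
  have huv' : u < v := by nlinarith
  obtain ⟨v', hv'1, hv'2⟩ := ((htail u hAu).and (eventually_ge_atTop v)).exists
  have hC0 : 0 < C := by rw [hC]; positivity
  have hanti : AntitoneOn (fun x => exp 1 * M x v' - M x v - exp 1 * C * X / K * exp (K * x / v))
      (Icc A u) := by
    apply antitoneOn_of_hasDerivAt (f' := fun x => exp 1 * (-n x v') - (-n x v)
      - exp 1 * C * X / K * (exp (K * x / v) * (K / v))) (convex_Icc A u)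
    · intro x hx
      have hx1 := hA.trans hx.1
      have hxv := hx.2.trans_lt huv'
      have h1 : HasDerivAt (fun x : ℝ => K * x / v) (K / v) x := by
        simpa using ((hasDerivAt_id x).const_mul K).div_const v
      exact (((S.dMu x v' hx1 (hxv.trans_le hv'2)).const_mul _).sub (S.dMu x v hx1 hxv)).sub
        (h1.exp.const_mul _)
    · intro x hx
      have hx1 := hA.trans hx.1
      have hxv := hx.2.trans_lt huv'
      have h1 := S.n_le hc hC hx1 hxv (hx.2.trans huv) hv'2
      have h2 := hX v x v' hv hx.1 (hx.2.trans huv) hv'2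
      have h3 : exp 1 * C / v * (M x v' - M x v) ≤ exp 1 * C / v * (X * exp (K * x / v)) := by
        gcongr
      have h4 : exp 1 * C * X / K * (exp (K * x / v) * (K / v))
        = exp 1 * C / v * (X * exp (K * x / v)) := by field_simp
      rw [h4]
      linarith
  have h := hanti (left_mem_Icc.2 hAu) (right_mem_Icc.2 hAu) hAu
  simp only at h
  have hX0 : 0 ≤ X := by
    have h1 := hX v u v' hv hAu huv hv'2
    have h2 := S.mono_v (hA.trans hAu) huv' hv'2
    by_contra hneg
    have := mul_neg_of_neg_of_pos (not_le.1 hneg) (exp_pos (K * u / v))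
    linarith
  have h5 : 0 ≤ exp 1 * C * X / K * exp (K * A / v) := by positivity
  have h6 : exp 1 * (M A v' - M u v') ≤ exp 1 * β := by gcongr
  linarith

/-- One step of the absorption argument: a bound `X` on the weighted outgoing flux improves. -/
theorem flux_improve (S : NullSystem M p n Λ B) {c C K A V X β α : ℝ} (hc : 0 < c) (hc1 : c < 1)
    (hC : C = 9 / (4 * c ^ 2)) (hK : K = 2 * (exp 1 * C)) (hA : 1 ≤ A) (hV : 0 < V)
    (hβ : 0 ≤ β) (htail : ∀ u, A ≤ u → ∀ᶠ v in atTop, M A v - M u v ≤ β)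
    (hα : ∀ v v', V ≤ v → v ≤ v' → M A v' - M A v ≤ α) (hα0 : 0 ≤ α)
    (hX : ∀ w u w', V ≤ w → A ≤ u → u ≤ (1 - c) * w → w ≤ w' →
      M u w' - M u w ≤ X * exp (K * u / w))
    {w u w' : ℝ} (hw : V ≤ w) (hAu : A ≤ u) (huw : u ≤ (1 - c) * w) (hww : w ≤ w') :
    M u w' - M u w ≤ (exp 1 * α + exp 1 ^ 2 * C * β + X / 4) * exp (K * u / w) := by
  have hw0 : 0 < w := hV.trans_le hw
  have hu0 : 0 < u := by linarith
  have huw' : u < w := by nlinarith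
  have hC0 : 0 < C := by rw [hC]; positivity
  have hK0 : 0 < K := by rw [hK]; positivity
  have hmono : MonotoneOn (fun x => exp 1 * M A x - M u x - exp 1 ^ 2 * C * β * u * (-1 / x)
      * (-1) - X / 4 * exp (K * u / x)) (Icc w w') := by
    apply monotoneOn_of_hasDerivAt (f' := fun x => exp 1 * p A x - p u x
      - exp 1 ^ 2 * C * β * u * (1 / x ^ 2) * (-1) - X / 4 * (exp (K * u / x) * (-(K * u) / x ^ 2)))
      (convex_Icc w w')
    · intro x hx
      have hux := huw'.trans_le hx.1
      have hx0 : x ≠ 0 := by linarith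
      have h1 : HasDerivAt (fun x : ℝ => K * u / x) (-(K * u) / x ^ 2) x := by
        have := (hasDerivAt_const x (K * u)).div (hasDerivAt_id x) hx0
        refine this.congr_deriv ?_
        simp
      have h2 : HasDerivAt (fun x : ℝ => -1 / x) (1 / x ^ 2) x := by
        have := (hasDerivAt_const x (-1 : ℝ)).div (hasDerivAt_id x) hx0
        refine this.congr_deriv ?_
        simp
      exact ((((S.dMv A x hA (hAu.trans_lt hux)).const_mul _).sub
        (S.dMv u x (hA.trans hAu) hux)).sub ((h2.const_mul _).mul_const (-1))).sub
        (h1.exp.const_mul _)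
    · intro x hx
      have hux := huw'.trans_le hx.1
      have hx0 : 0 < x := by linarith
      have hux2 : u ≤ (1 - c) * x := by nlinarith [hx.1]
      have h1 := S.p_le hc hC hA hAu hux hux2
      have h2 := S.energy_le_of_tail hc hC hK0 hA hV htail hX (hw.trans hx.1) hAu hux2
      have h3 : exp 1 * C * u / x ^ 2 * (M A x - M u x) ≤
        exp 1 * C * u / x ^ 2 * (exp 1 * β + exp 1 * C * X / K * exp (K * u / x)) := by gcongr
      have h4 : exp 1 * C * u / x ^ 2 * (exp 1 * C * X / K * exp (K * u / x))
          = X / 4 * (exp (K * u / x) * ((K * u) / x ^ 2)) := by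
        have : exp 1 * C = K / 2 := by rw [hK]; ring
        rw [this]; field_simp; ring
      have h5 : X / 4 * (exp (K * u / x) * (-(K * u) / x ^ 2))
        = - (X / 4 * (exp (K * u / x) * ((K * u) / x ^ 2))) := by ring
      have h6 : exp 1 ^ 2 * C * β * u * (1 / x ^ 2) * (-1)
        = - (exp 1 * C * u / x ^ 2 * (exp 1 * β)) := by ring
      rw [h5, h6]
      rw [mul_add, h4] at h3
      linarith
  have h := hmono (left_mem_Icc.2 hww) (right_mem_Icc.2 hww) hww
  simp only at h
  have hX0 : 0 ≤ X := by
    have h1 := hX w u w' hw hAu huw hww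
    have h2 := S.mono_v (hA.trans hAu) huw' hww
    by_contra hneg
    have := mul_neg_of_neg_of_pos (not_le.1 hneg) (exp_pos (K * u / w))
    linarith
  have hw'0 : 0 < w' := hw0.trans_le hww
  have h7 : exp 1 * (M A w' - M A w) ≤ exp 1 * α := by gcongr; exact hα w w' hw hww
  have h8 : 0 ≤ X / 4 * exp (K * u / w') := by positivity
  have h9 : exp 1 ^ 2 * C * β * u * (-1 / w) * (-1) ≤ exp 1 ^ 2 * C * β := by
    have : u / w ≤ 1 := (div_le_one hw0).2 huw'.le
    calc exp 1 ^ 2 * C * β * u * (-1 / w) * (-1) = exp 1 ^ 2 * C * β * (u / w) := by ring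
      _ ≤ exp 1 ^ 2 * C * β * 1 := by gcongr
      _ = _ := mul_one _
  have h10 : 0 ≤ exp 1 ^ 2 * C * β * u * (-1 / w') * (-1) := by
    have : exp 1 ^ 2 * C * β * u * (-1 / w') * (-1) = exp 1 ^ 2 * C * β * u * (1 / w') := by ring
    rw [this]; positivity
  have h11 : 1 ≤ exp (K * u / w) := one_le_exp (by positivity)
  have h12 : exp 1 * α + exp 1 ^ 2 * C * β
      ≤ (exp 1 * α + exp 1 ^ 2 * C * β) * exp (K * u / w) :=
    le_mul_of_one_le_right (by positivity) h11
  linarith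

theorem flux_le (S : NullSystem M p n Λ B) {c C K A V β α : ℝ} (hc : 0 < c) (hc1 : c < 1)
    (hC : C = 9 / (4 * c ^ 2)) (hK : K = 2 * (exp 1 * C)) (hA : 1 ≤ A) (hV : 0 < V)
    (hβ : 0 ≤ β) (htail : ∀ u, A ≤ u → ∀ᶠ v in atTop, M A v - M u v ≤ β)
    (hα : ∀ v v', V ≤ v → v ≤ v' → M A v' - M A v ≤ α) (hα0 : 0 ≤ α)
    {w u w' : ℝ} (hw : V ≤ w) (hAu : A ≤ u) (huw : u ≤ (1 - c) * w) (hww : w ≤ w') :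
    M u w' - M u w ≤ 2 * (exp 1 * α + exp 1 ^ 2 * C * β) * exp (K * u / w) := by
  have hC0 : 0 < C := by rw [hC]; positivity
  have hK0 : 0 < K := by rw [hK]; positivity
  have key : ∀ j : ℕ, ∀ w u w', V ≤ w → A ≤ u → u ≤ (1 - c) * w → w ≤ w' →
      M u w' - M u w ≤ (2 * (exp 1 * α + exp 1 ^ 2 * C * β) + 2 * |B| * (1 / 4) ^ j)
        * exp (K * u / w) := by
    intro j
    induction j with
    | zero =>
      intro w u w' hw hAu huw hww
      have hw0 : 0 < w := hV.trans_le hw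
      have hu1 : 1 ≤ u := hA.trans hAu
      have huw' : u < w := by nlinarith
      have h1 := abs_le.1 (S.bdd u w hu1 huw')
      have h2 := abs_le.1 (S.bdd u w' hu1 (huw'.trans_le hww))
      have h3 := le_abs_self B
      have h11 : 1 ≤ exp (K * u / w) := one_le_exp (by positivity)
      have h4 : 2 * |B| ≤ 2 * (exp 1 * α + exp 1 ^ 2 * C * β) + 2 * |B| * (1 / 4) ^ 0 := by
        have : 0 ≤ 2 * (exp 1 * α + exp 1 ^ 2 * C * β) := by positivity
        simp only [pow_zero, mul_one]; linarith
      calc M u w' - M u w ≤ 2 * |B| := by linarith [h1.1, h2.2]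
        _ ≤ _ := h4
        _ ≤ _ := le_mul_of_one_le_right (by positivity) h11
    | succ j ih =>
      intro w u w' hw hAu huw hww
      refine (S.flux_improve hc hc1 hC hK hA hV hβ htail hα hα0 ih hw hAu huw hww).trans ?_
      refine mul_le_mul_of_nonneg_right ?_ (exp_pos _).le
      have : 0 ≤ (exp 1 * α + exp 1 ^ 2 * C * β) := by positivity
      have h2 : 0 ≤ 2 * |B| * (1 / 4) ^ j := by positivity
      rw [pow_succ (1 / 4 : ℝ) j]
      linarith
  have hlim : Tendsto (fun j : ℕ => (2 * (exp 1 * α + exp 1 ^ 2 * C * β) + 2 * |B| * (1 / 4) ^ j)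
        * exp (K * u / w)) atTop
      (nhds ((2 * (exp 1 * α + exp 1 ^ 2 * C * β) + 2 * |B| * 0) * exp (K * u / w))) :=
    ((tendsto_pow_atTop_nhds_zero_of_lt_one (by norm_num) (by norm_num)).const_mul _
      |>.const_add _).mul_const _
  rw [mul_zero, add_zero] at hlim
  exact ge_of_tendsto' hlim (fun j => key j w u w' hw hAu huw hww)

/-- No energy remains in the self-similar region `A ≤ u ≤ (1 - c) v`, nor flows out of it through
the outer cone `u = A`, at late times. -/
theorem selfSimilar_decay (S : NullSystem M p n Λ B) {c δ : ℝ} (hc : 0 < c) (hc1 : c < 1)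
    (hδ : 0 < δ) :
    ∃ A V, 1 ≤ A ∧ 0 < V ∧ ∀ v, V ≤ v → (∀ u, A ≤ u → u ≤ (1 - c) * v → M A v - M u v ≤ δ) ∧
      ∀ v', v ≤ v' → M A v' - M A v ≤ δ := by
  obtain ⟨C, hC⟩ : ∃ C, C = 9 / (4 * c ^ 2) := ⟨_, rfl⟩
  obtain ⟨K, hK⟩ : ∃ K, K = 2 * (exp 1 * C) := ⟨_, rfl⟩
  have hC0 : 0 < C := by rw [hC]; positivity
  have hK0 : 0 < K := by rw [hK]; positivity
  choose! l hl1 hl2 using fun u (hu : 1 ≤ u) => S.exists_limit_v hu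
  have hlB : ∀ u, 1 ≤ u → -B ≤ l u := fun u hu =>
    (abs_le.1 (S.bdd u (u + 1) hu (by linarith))).1.trans (hl1 u hu _ (by linarith))
  have hbb : BddBelow (l '' Ici 1) := by
    refine ⟨-B, ?_⟩
    rintro _ ⟨u, hu, rfl⟩
    exact hlB u hu
  have hne : (l '' Ici 1).Nonempty := ⟨_, 1, self_mem_Ici, rfl⟩
  obtain ⟨β, hβ, hβ1⟩ : ∃ β > 0, exp 1 * β + exp 1 ^ 2 * C * β * exp K ≤ δ / 2 := by
    refine ⟨δ / 2 / (exp 1 + exp 1 ^ 2 * C * exp K), by positivity, le_of_eq ?_⟩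
    field_simp
  obtain ⟨α, hα, hα1, hα2⟩ : ∃ α > 0, exp 1 * α * exp K ≤ δ / 2 ∧ α ≤ δ := by
    refine ⟨min (δ / 2 / (exp 1 * exp K)) δ, lt_min (by positivity) hδ, ?_, min_le_right _ _⟩
    calc exp 1 * min (δ / 2 / (exp 1 * exp K)) δ * exp K
        ≤ exp 1 * (δ / 2 / (exp 1 * exp K)) * exp K := by gcongr; exact min_le_left _ _
      _ = δ / 2 := by field_simp
  obtain ⟨_, ⟨A, hA, rfl⟩, hlA⟩ := exists_lt_of_csInf_lt hne
    (lt_add_of_pos_right (sInf (l '' Ici 1)) (half_pos hβ))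
  have hA1 : 1 ≤ A := hA
  have htail : ∀ u, A ≤ u → ∀ᶠ v in atTop, M A v - M u v ≤ β := by
    intro u hu
    have hu1 : 1 ≤ u := hA1.trans hu
    obtain ⟨V, hV, hV2⟩ := hl2 u hu1 (β / 2) (by positivity)
    filter_upwards [eventually_ge_atTop V] with v hv
    have h1 := hl1 A hA1 v ((hu.trans_lt hV).trans_le hv)
    have h2 := hV2 v hv
    have h3 := csInf_le hbb ⟨u, hu1, rfl⟩
    linarith
  obtain ⟨V, hV, hV2⟩ := hl2 A hA1 α hα
  have hV0 : 0 < V := by linarith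
  have hα' : ∀ v v', V ≤ v → v ≤ v' → M A v' - M A v ≤ α := by
    intro v v' hv hvv
    have h1 := hl1 A hA1 v' ((hV.trans_le hv).trans_le hvv)
    have h2 := hV2 v hv
    linarith
  refine ⟨A, V, hA1, hV0, fun v hv => ⟨fun u hAu huv => ?_, fun v' hvv =>
    (hα' v v' hv hvv).trans hα2⟩⟩
  have hv0 : 0 < v := hV0.trans_le hv
  have hu0 : 0 < u := by linarith
  have h1 := S.energy_le_of_tail hc hC hK0 hA1 hV0 htail
    (fun w u w' hw hu huw hww =>
      S.flux_le hc hc1 hC hK hA1 hV0 hβ.le htail hα' hα.le hw hu huw hww) hv hAu huv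
  have h2 : exp (K * u / v) ≤ exp K := by
    apply exp_le_exp.2
    rw [div_le_iff₀ hv0]
    have : u ≤ v := by nlinarith
    gcongr
  have h3 : exp 1 * C * (2 * (exp 1 * α + exp 1 ^ 2 * C * β)) / K
      = exp 1 * α + exp 1 ^ 2 * C * β := by rw [hK]; field_simp
  rw [h3] at h1
  have h4 : (exp 1 * α + exp 1 ^ 2 * C * β) * exp (K * u / v)
    ≤ (exp 1 * α + exp 1 ^ 2 * C * β) * exp K := by gcongr
  linarith

end NullSystem

/-- `F` is a smooth function of two real variables on the open set `D`. -/
structure SmoothOn (F : ℝ → ℝ → ℝ) (D : Set (ℝ × ℝ)) : Prop where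
  isOpen : IsOpen D
  contDiffOn : ContDiffOn ℝ (⊤ : ℕ∞) (fun p : ℝ × ℝ => F p.1 p.2) D

namespace SmoothOn

variable {F : ℝ → ℝ → ℝ} {D : Set (ℝ × ℝ)} {t r : ℝ}

theorem continuousOn (h : SmoothOn F D) : ContinuousOn (fun p : ℝ × ℝ => F p.1 p.2) D :=
  h.contDiffOn.continuousOn

theorem hasFDerivAt (h : SmoothOn F D) {p : ℝ × ℝ} (hp : p ∈ D) :
    HasFDerivAt (fun p : ℝ × ℝ => F p.1 p.2) (fderiv ℝ (fun p : ℝ × ℝ => F p.1 p.2) p) p :=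
  ((h.contDiffOn.contDiffAt (h.isOpen.mem_nhds hp)).differentiableAt (by simp)).hasFDerivAt

theorem pT_eq_fderiv (h : SmoothOn F D) (hp : (t, r) ∈ D) :
    HasDerivAt (fun s => F s r) (fderiv ℝ (fun p : ℝ × ℝ => F p.1 p.2) (t, r) (1, 0)) t :=
  HasFDerivAt.comp_hasDerivAt (f := fun s : ℝ => (s, r)) t (h.hasFDerivAt hp)
    ((hasDerivAt_id t).prodMk (hasDerivAt_const t r))

theorem pR_eq_fderiv (h : SmoothOn F D) (hp : (t, r) ∈ D) :
    HasDerivAt (fun s => F t s) (fderiv ℝ (fun p : ℝ × ℝ => F p.1 p.2) (t, r) (0, 1)) r :=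
  HasFDerivAt.comp_hasDerivAt (f := fun s : ℝ => (t, s)) r (h.hasFDerivAt hp)
    ((hasDerivAt_const r t).prodMk (hasDerivAt_id r))

theorem hasDerivAt_pT (h : SmoothOn F D) (hp : (t, r) ∈ D) :
    HasDerivAt (fun s => F s r) (pT F t r) t :=
  (h.pT_eq_fderiv hp).differentiableAt.hasDerivAt

theorem hasDerivAt_pR (h : SmoothOn F D) (hp : (t, r) ∈ D) :
    HasDerivAt (fun s => F t s) (pR F t r) r :=
  (h.pR_eq_fderiv hp).differentiableAt.hasDerivAt

theorem smoothOn_pT (h : SmoothOn F D) : SmoothOn (pT F) D := by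
  refine ⟨h.isOpen, ?_⟩
  have h1 := (h.contDiffOn.fderiv_of_isOpen h.isOpen (m := (⊤ : ℕ∞)) (by simp)).clm_apply
    (contDiffOn_const (c := ((1, 0) : ℝ × ℝ)))
  exact h1.congr fun p hp => (h.pT_eq_fderiv hp).deriv

theorem smoothOn_pR (h : SmoothOn F D) : SmoothOn (pR F) D := by
  refine ⟨h.isOpen, ?_⟩
  have h1 := (h.contDiffOn.fderiv_of_isOpen h.isOpen (m := (⊤ : ℕ∞)) (by simp)).clm_apply
    (contDiffOn_const (c := ((0, 1) : ℝ × ℝ)))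
  exact h1.congr fun p hp => (h.pR_eq_fderiv hp).deriv

/-- Chain rule along a curve. -/
theorem hasDerivAt_comp (h : SmoothOn F D) {a b : ℝ → ℝ} {a' b' x : ℝ} (hp : (a x, b x) ∈ D)
    (ha : HasDerivAt a a' x) (hb : HasDerivAt b b' x) :
    HasDerivAt (fun y => F (a y) (b y)) (pT F (a x) (b x) * a' + pR F (a x) (b x) * b') x := by
  have h1 : HasDerivAt (fun y => F (a y) (b y)) _ x :=
    HasFDerivAt.comp_hasDerivAt (f := fun y => (a y, b y)) x (h.hasFDerivAt hp) (ha.prodMk hb)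
  refine h1.congr_deriv ?_
  have : ((a', b') : ℝ × ℝ) = a' • (1, 0) + b' • (0, 1) := by simp
  rw [this, map_add, map_smul, map_smul, ← (h.pT_eq_fderiv hp).deriv, ← (h.pR_eq_fderiv hp).deriv]
  simp only [pT, pR, smul_eq_mul]
  ring

theorem eventually_left (h : SmoothOn F D) (hp : (t, r) ∈ D) : ∀ᶠ s in nhds t, (s, r) ∈ D :=
  (show Continuous fun s : ℝ => (s, r) by fun_prop).continuousAt.eventually (h.isOpen.mem_nhds hp)

theorem eventually_right (h : SmoothOn F D) (hp : (t, r) ∈ D) : ∀ᶠ s in nhds r, (t, s) ∈ D :=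
  (show Continuous fun s : ℝ => (t, s) by fun_prop).continuousAt.eventually (h.isOpen.mem_nhds hp)

/-- Symmetry of second derivatives. -/
theorem pT_pR (h : SmoothOn F D) (hp : (t, r) ∈ D) : pT (pR F) t r = pR (pT F) t r := by
  have hc := h.contDiffOn.contDiffAt (h.isOpen.mem_nhds hp)
  have hs := hc.isSymmSndFDerivAt (by
    simp only [minSmoothness_of_isRCLikeNormedField]
    exact WithTop.coe_le_coe.2 (le_top (a := (2 : ℕ∞))))
  have hd : HasFDerivAt (fderiv ℝ (fun p : ℝ × ℝ => F p.1 p.2)) _ (t, r) :=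
    ((hc.fderiv_right (m := (⊤ : ℕ∞)) (by simp)).differentiableAt (by simp)).hasFDerivAt
  have h1 : HasDerivAt (fun s => fderiv ℝ (fun p : ℝ × ℝ => F p.1 p.2) (s, r)) _ t :=
    hd.comp_hasDerivAt t ((hasDerivAt_id t).prodMk (hasDerivAt_const t r))
  have h2 : HasDerivAt (fun s => fderiv ℝ (fun p : ℝ × ℝ => F p.1 p.2) (t, s)) _ r :=
    hd.comp_hasDerivAt r ((hasDerivAt_const r t).prodMk (hasDerivAt_id r))
  have h3 := (h1.clm_apply (hasDerivAt_const t ((0, 1) : ℝ × ℝ))).congr_of_eventuallyEq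
    (f₁ := fun s => pR F s r) ((h.eventually_left hp).mono fun s hs => (h.pR_eq_fderiv hs).deriv)
  have h4 := (h2.clm_apply (hasDerivAt_const r ((1, 0) : ℝ × ℝ))).congr_of_eventuallyEq
    (f₁ := fun s => pT F t s) ((h.eventually_right hp).mono fun s hs => (h.pT_eq_fderiv hs).deriv)
  rw [pT, h3.deriv, pR, h4.deriv]
  simpa using hs.eq (1, 0) (0, 1)

end SmoothOn

theorem continuousOn_prod_left {f : ℝ → ℝ → ℝ} {U S : Set ℝ} {x : ℝ}
    (hf : ContinuousOn (fun p : ℝ × ℝ => f p.1 p.2) (U ×ˢ S)) (hx : x ∈ U) :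
    ContinuousOn (fun y => f x y) S :=
  hf.comp (f := fun y : ℝ => (x, y)) (by fun_prop) fun _ hy => ⟨hx, hy⟩

theorem continuousOn_prod_right {f : ℝ → ℝ → ℝ} {U S : Set ℝ} {y : ℝ}
    (hf : ContinuousOn (fun p : ℝ × ℝ => f p.1 p.2) (U ×ˢ S)) (hy : y ∈ S) :
    ContinuousOn (fun x => f x y) U :=
  hf.comp (f := fun x : ℝ => (x, y)) (by fun_prop) fun _ hx => ⟨hx, hy⟩

/-- Differentiation of an integral over a compact interval with respect to a parameter. -/
theorem hasDerivAt_intervalIntegral_of_continuousOn {f f' : ℝ → ℝ → ℝ} {U : Set ℝ} {a b x₀ : ℝ}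
    (hU : IsOpen U) (hx₀ : x₀ ∈ U)
    (hf : ContinuousOn (fun p : ℝ × ℝ => f p.1 p.2) (U ×ˢ uIcc a b))
    (hf' : ContinuousOn (fun p : ℝ × ℝ => f' p.1 p.2) (U ×ˢ uIcc a b))
    (hd : ∀ x ∈ U, ∀ y ∈ uIcc a b, HasDerivAt (fun x => f x y) (f' x y) x) :
    HasDerivAt (fun x => ∫ y in a..b, f x y) (∫ y in a..b, f' x₀ y) x₀ := by
  obtain ⟨ε, hε, hεU⟩ := Metric.nhds_basis_closedBall.mem_iff.1 (hU.mem_nhds hx₀)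
  obtain ⟨C, hC⟩ := ((isCompact_closedBall x₀ ε).prod isCompact_uIcc).exists_bound_of_continuousOn
    (hf'.mono (prod_mono hεU Subset.rfl))
  refine (intervalIntegral.hasDerivAt_integral_of_dominated_loc_of_deriv_le (F := f) (F' := f')
    (s := Metric.closedBall x₀ ε) (bound := fun _ => C) (Metric.closedBall_mem_nhds _ hε)
    ?_ ?_ ?_ ?_ ?_ ?_).2
  · filter_upwards [hU.mem_nhds hx₀] with x hx
    exact ((continuousOn_prod_left hf hx).mono uIoc_subset_uIcc).aestronglyMeasurable
      measurableSet_uIoc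
  · exact (continuousOn_prod_left hf hx₀).intervalIntegrable
  · exact ((continuousOn_prod_left hf' hx₀).mono uIoc_subset_uIcc).aestronglyMeasurable
      measurableSet_uIoc
  · exact Eventually.of_forall fun y hy x hx => hC (x, y) ⟨hx, uIoc_subset_uIcc hy⟩
  · exact intervalIntegrable_const
  · exact Eventually.of_forall fun y hy x hx => hd x (hεU hx) y (uIoc_subset_uIcc hy)

/-- Fubini for continuous functions on rectangles. -/
theorem integral_integral_swap_of_continuousOn {f : ℝ → ℝ → ℝ} {a b c d : ℝ}
    (hf : ContinuousOn (fun p : ℝ × ℝ => f p.1 p.2) (uIcc a b ×ˢ uIcc c d)) :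
    ∫ x in a..b, ∫ y in c..d, f x y = ∫ y in c..d, ∫ x in a..b, f x y := by
  apply MeasureTheory.intervalIntegral_intervalIntegral_swap
  exact (hf.integrableOn_compact (isCompact_uIcc.prod isCompact_uIcc)).mono_set
    (prod_mono uIoc_subset_uIcc uIoc_subset_uIcc)

/-- Continuity of an integral over a compact interval with respect to a parameter. -/
theorem continuousOn_intervalIntegral {f : ℝ → ℝ → ℝ} {U : Set ℝ} {a b : ℝ}
    (hU : IsOpen U) (hf : ContinuousOn (fun p : ℝ × ℝ => f p.1 p.2) (U ×ˢ uIcc a b)) :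
    ContinuousOn (fun x => ∫ y in a..b, f x y) U := by
  intro x₀ hx₀
  apply ContinuousAt.continuousWithinAt
  obtain ⟨ε, hε, hεU⟩ := Metric.nhds_basis_closedBall.mem_iff.1 (hU.mem_nhds hx₀)
  obtain ⟨C, hC⟩ := ((isCompact_closedBall x₀ ε).prod isCompact_uIcc).exists_bound_of_continuousOn
    (hf.mono (prod_mono hεU Subset.rfl))
  refine intervalIntegral.continuousAt_of_dominated_interval (bound := fun _ => C) ?_ ?_ ?_ ?_
  · filter_upwards [hU.mem_nhds hx₀] with x hx
    exact ((continuousOn_prod_left hf hx).mono uIoc_subset_uIcc).aestronglyMeasurable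
      measurableSet_uIoc
  · filter_upwards [Metric.closedBall_mem_nhds x₀ hε] with x hx
    exact Eventually.of_forall fun y hy => hC (x, y) ⟨hx, uIoc_subset_uIcc hy⟩
  · exact intervalIntegrable_const
  · exact Eventually.of_forall fun y hy =>
      (continuousOn_prod_right hf (uIoc_subset_uIcc hy)).continuousAt (hU.mem_nhds hx₀)

/-- Chain rule along a curve for a function with continuous partial derivatives. -/
theorem hasDerivAt_comp_of_partials {f f₁ f₂ : ℝ → ℝ → ℝ} {D : Set (ℝ × ℝ)} (hD : IsOpen D)
    (h₁ : ∀ t r, (t, r) ∈ D → HasDerivAt (fun s => f s r) (f₁ t r) t)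
    (h₂ : ∀ t r, (t, r) ∈ D → HasDerivAt (fun ρ => f t ρ) (f₂ t r) r)
    (c₁ : ContinuousOn (fun p : ℝ × ℝ => f₁ p.1 p.2) D)
    (c₂ : ContinuousOn (fun p : ℝ × ℝ => f₂ p.1 p.2) D) {a b : ℝ → ℝ} {a' b' x : ℝ}
    (hx : (a x, b x) ∈ D) (ha : HasDerivAt a a' x) (hb : HasDerivAt b b' x) :
    HasDerivAt (fun y => f (a y) (b y)) (f₁ (a x) (b x) * a' + f₂ (a x) (b x) * b') x := by
  have hn := hD.mem_nhds hx
  have key := hasStrictFDerivAt_uncurry_coprod (𝕜 := ℝ) (u := (a x, b x)) (f := f)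
    (f₁ := fun t r => ContinuousLinearMap.toSpanSingleton ℝ (f₁ t r))
    (f₂ := fun t r => ContinuousLinearMap.toSpanSingleton ℝ (f₂ t r))
    (by filter_upwards [hn] with p hp using (h₁ p.1 p.2 hp).hasFDerivAt)
    (by filter_upwards [hn] with p hp using (h₂ p.1 p.2 hp).hasFDerivAt)
    ((ContinuousLinearMap.toSpanSingletonCLE (𝕜 := ℝ) (E := ℝ)).continuous.continuousAt.comp
      (c₁.continuousAt hn))
    ((ContinuousLinearMap.toSpanSingletonCLE (𝕜 := ℝ) (E := ℝ)).continuous.continuousAt.comp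
      (c₂.continuousAt hn))
  have h := HasFDerivAt.comp_hasDerivAt (f := fun y => (a y, b y)) x key.hasFDerivAt
    (ha.prodMk hb)
  refine h.congr_deriv ?_
  simp [Function.HasUncurry.uncurry, mul_comm]

/-- The open quadrant `t > 0`, `r > 0`. -/
abbrev quadrant : Set (ℝ × ℝ) := Ioi 0 ×ˢ Ioi 0

/-- Momentum density `2 r ∂ₜψ ∂ᵣψ`. -/
def mDen (ψ : ℝ → ℝ → ℝ) (t r : ℝ) : ℝ := 2 * r * (pT ψ t r * pR ψ t r)

/-- A smooth wave map on the open quadrant with energy at most `E`. -/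
structure WaveMapEnergyLE (ψ : ℝ → ℝ → ℝ) (E : ℝ) : Prop where
  smoothOn : SmoothOn ψ quadrant
  eqn : ∀ t r, 0 < t → 0 < r → pT (pT ψ) t r =
    pR (pR ψ) t r + pR ψ t r / r - sin (2 * ψ t r) / (2 * r ^ 2)
  energy_le : ∀ t a b, 0 < t → 0 < a → a ≤ b → ∫ r in a..b, eDen ψ t r ≤ E

/-- Potential of the conserved energy-momentum pair: `∂ᵣ = eDen`, `∂ₜ = mDen`. -/
def energyPotential (ψ : ℝ → ℝ → ℝ) (t r : ℝ) : ℝ :=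
  (∫ ρ in (1 : ℝ)..r, eDen ψ t ρ) + ∫ s in (1 : ℝ)..t, mDen ψ s 1

theorem eDen_nonneg (ψ : ℝ → ℝ → ℝ) (t : ℝ) {r : ℝ} (hr : 0 ≤ r) : 0 ≤ eDen ψ t r := by
  unfold eDen; positivity

theorem abs_mDen_le_eDen (ψ : ℝ → ℝ → ℝ) (t : ℝ) {r : ℝ} (hr : 0 ≤ r) :
    |mDen ψ t r| ≤ eDen ψ t r := by
  have h : 0 ≤ sin (ψ t r) ^ 2 / r ^ 2 * r := by positivity
  have h1 : 0 ≤ r * (pT ψ t r + pR ψ t r) ^ 2 := by positivity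
  have h2 : 0 ≤ r * (pT ψ t r - pR ψ t r) ^ 2 := by positivity
  unfold mDen eDen
  rw [abs_le]
  constructor <;> nlinarith

namespace WaveMapEnergyLE

variable {ψ : ℝ → ℝ → ℝ} {E : ℝ}

theorem continuousOn_eDen (W : WaveMapEnergyLE ψ E) :
    ContinuousOn (fun p : ℝ × ℝ => eDen ψ p.1 p.2) quadrant := by
  have h := W.smoothOn.continuousOn
  have h1 := W.smoothOn.smoothOn_pT.continuousOn
  have h2 := W.smoothOn.smoothOn_pR.continuousOn
  unfold eDen
  refine ((h1.pow 2).add (h2.pow 2) |>.add ((continuous_sin.comp_continuousOn h).pow 2 |>.div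
    (by fun_prop) ?_)).mul (by fun_prop)
  rintro ⟨t, r⟩ ⟨ht, hr⟩
  have : (0 : ℝ) < r := hr
  positivity

theorem continuousOn_mDen (W : WaveMapEnergyLE ψ E) :
    ContinuousOn (fun p : ℝ × ℝ => mDen ψ p.1 p.2) quadrant := by
  have h1 := W.smoothOn.smoothOn_pT.continuousOn
  have h2 := W.smoothOn.smoothOn_pR.continuousOn
  unfold mDen
  fun_prop

theorem hasDerivAt_eDen_t (W : WaveMapEnergyLE ψ E) {t r : ℝ} (ht : 0 < t) (hr : 0 < r) :
    HasDerivAt (fun s => eDen ψ s r) ((2 * (pT ψ t r * pT (pT ψ) t r + pR ψ t r * pR (pT ψ) t r)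
      + sin (2 * ψ t r) * pT ψ t r / r ^ 2) * r) t := by
  have hp : (t, r) ∈ quadrant := ⟨ht, hr⟩
  have h := W.smoothOn.hasDerivAt_pT hp
  have h1 := W.smoothOn.smoothOn_pT.hasDerivAt_pT hp
  have h2 := W.smoothOn.smoothOn_pR.hasDerivAt_pT hp
  rw [W.smoothOn.pT_pR hp] at h2
  have h3 := (((h1.fun_pow 2).add (h2.fun_pow 2)).add ((h.sin.fun_pow 2).div_const
    (r ^ 2))).mul_const r
  refine h3.congr_deriv ?_
  rw [sin_two_mul]
  push_cast
  ring

theorem hasDerivAt_eDen_r (W : WaveMapEnergyLE ψ E) {t r : ℝ} (ht : 0 < t) (hr : 0 < r) :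
    HasDerivAt (fun ρ => eDen ψ t ρ) ((2 * (pT ψ t r * pR (pT ψ) t r + pR ψ t r * pR (pR ψ) t r)
      + sin (2 * ψ t r) * pR ψ t r / r ^ 2) * r + (pT ψ t r ^ 2 + pR ψ t r ^ 2
        - sin (ψ t r) ^ 2 / r ^ 2)) r := by
  have hp : (t, r) ∈ quadrant := ⟨ht, hr⟩
  have h := W.smoothOn.hasDerivAt_pR hp
  have h1 := W.smoothOn.smoothOn_pT.hasDerivAt_pR hp
  have h2 := W.smoothOn.smoothOn_pR.hasDerivAt_pR hp
  have h3 := (((h1.fun_pow 2).add (h2.fun_pow 2)).add ((h.sin.fun_pow 2).div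
    ((hasDerivAt_id r).fun_pow 2) (by simp; exact hr.ne'))).mul (hasDerivAt_id r)
  refine h3.congr_deriv ?_
  rw [sin_two_mul]
  simp only [id, Pi.add_apply, Pi.div_apply]
  field_simp
  push_cast
  ring

theorem hasDerivAt_mDen_t (W : WaveMapEnergyLE ψ E) {t r : ℝ} (ht : 0 < t) (hr : 0 < r) :
    HasDerivAt (fun s => mDen ψ s r)
      (2 * r * (pT (pT ψ) t r * pR ψ t r + pT ψ t r * pR (pT ψ) t r)) t := by
  have hp : (t, r) ∈ quadrant := ⟨ht, hr⟩
  have h1 := W.smoothOn.smoothOn_pT.hasDerivAt_pT hp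
  have h2 := W.smoothOn.smoothOn_pR.hasDerivAt_pT hp
  rw [W.smoothOn.pT_pR hp] at h2
  exact (h1.mul h2).const_mul (2 * r)

theorem hasDerivAt_mDen_r (W : WaveMapEnergyLE ψ E) {t r : ℝ} (ht : 0 < t) (hr : 0 < r) :
    HasDerivAt (fun ρ => mDen ψ t ρ) ((2 * (pT ψ t r * pT (pT ψ) t r + pR ψ t r * pR (pT ψ) t r)
      + sin (2 * ψ t r) * pT ψ t r / r ^ 2) * r) r := by
  have hp : (t, r) ∈ quadrant := ⟨ht, hr⟩
  have h1 := W.smoothOn.smoothOn_pT.hasDerivAt_pR hp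
  have h2 := W.smoothOn.smoothOn_pR.hasDerivAt_pR hp
  have h3 := ((hasDerivAt_id r).const_mul 2).mul (h1.mul h2)
  refine h3.congr_deriv ?_
  simp only [id, Pi.mul_apply]
  rw [W.eqn t r ht hr]
  field_simp
  ring

theorem hasDerivAt_energyPotential_r (W : WaveMapEnergyLE ψ E) {t r : ℝ} (ht : 0 < t)
    (hr : 0 < r) : HasDerivAt (fun ρ => energyPotential ψ t ρ) (eDen ψ t r) r := by
  have hc : ContinuousOn (fun ρ => eDen ψ t ρ) (Ioi 0) :=
    continuousOn_prod_left W.continuousOn_eDen ht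
  refine HasDerivAt.add_const _ (intervalIntegral.integral_hasDerivAt_right ?_ ?_ ?_)
  · exact (hc.mono ((ordConnected_Ioi).uIcc_subset one_pos hr)).intervalIntegrable
  · exact hc.stronglyMeasurableAtFilter isOpen_Ioi r hr
  · exact hc.continuousAt (Ioi_mem_nhds hr)

theorem hasDerivAt_energyPotential_t (W : WaveMapEnergyLE ψ E) {t r : ℝ} (ht : 0 < t)
    (hr : 0 < r) : HasDerivAt (fun s => energyPotential ψ s r) (mDen ψ t r) t := by
  have hsub : uIcc 1 r ⊆ Ioi 0 := (ordConnected_Ioi).uIcc_subset one_pos hr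
  have h1 := W.smoothOn.continuousOn
  have h2 := W.smoothOn.smoothOn_pT.continuousOn
  have h3 := W.smoothOn.smoothOn_pR.continuousOn
  have h4 := W.smoothOn.smoothOn_pT.smoothOn_pT.continuousOn
  have h5 := W.smoothOn.smoothOn_pT.smoothOn_pR.continuousOn
  have hcont : ContinuousOn (fun p : ℝ × ℝ => (2 * (pT ψ p.1 p.2 * pT (pT ψ) p.1 p.2 +
      pR ψ p.1 p.2 * pR (pT ψ) p.1 p.2) + sin (2 * ψ p.1 p.2) * pT ψ p.1 p.2 / p.2 ^ 2) * p.2)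
      quadrant := by
    have h6 : ContinuousOn (fun p : ℝ × ℝ => sin (2 * ψ p.1 p.2)) quadrant :=
      continuous_sin.comp_continuousOn (h1.const_mul 2)
    have h7 : ContinuousOn (fun p : ℝ × ℝ => sin (2 * ψ p.1 p.2) * pT ψ p.1 p.2 / p.2 ^ 2)
        quadrant := by
      refine (h6.mul h2).div (by fun_prop) ?_
      rintro ⟨t, r⟩ ⟨ht, hr⟩
      have : (0 : ℝ) < r := hr
      positivity
    fun_prop
  have hA := hasDerivAt_intervalIntegral_of_continuousOn (f := eDen ψ) (a := 1) (b := r)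
    isOpen_Ioi (mem_Ioi.2 ht)
    (W.continuousOn_eDen.mono (prod_mono Subset.rfl hsub)) (hcont.mono (prod_mono Subset.rfl hsub))
    (fun x hx y hy => W.hasDerivAt_eDen_t hx (hsub hy))
  have hc : ContinuousOn (fun s => mDen ψ s 1) (Ioi 0) :=
    continuousOn_prod_right W.continuousOn_mDen (by simp)
  have hB : HasDerivAt (fun t => ∫ s in (1 : ℝ)..t, mDen ψ s 1) (mDen ψ t 1) t := by
    refine intervalIntegral.integral_hasDerivAt_right ?_ ?_ ?_
    · exact (hc.mono ((ordConnected_Ioi).uIcc_subset one_pos ht)).intervalIntegrable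
    · exact hc.stronglyMeasurableAtFilter isOpen_Ioi t ht
    · exact hc.continuousAt (Ioi_mem_nhds ht)
  refine (hA.add hB).congr_deriv ?_
  rw [intervalIntegral.integral_eq_sub_of_hasDerivAt (f := fun ρ => mDen ψ t ρ)
    (fun y hy => W.hasDerivAt_mDen_r ht (hsub hy)) (ContinuousOn.intervalIntegrable
      (hcont.comp (f := fun y : ℝ => (t, y)) (by fun_prop) fun y hy => ⟨ht, hsub hy⟩))]
  ring

theorem hasDerivAt_energyPotential_comp (W : WaveMapEnergyLE ψ E) {a b : ℝ → ℝ} {a' b' x : ℝ}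
    (hax : 0 < a x) (hbx : 0 < b x) (ha : HasDerivAt a a' x) (hb : HasDerivAt b b' x) :
    HasDerivAt (fun y => energyPotential ψ (a y) (b y))
      (mDen ψ (a x) (b x) * a' + eDen ψ (a x) (b x) * b') x :=
  hasDerivAt_comp_of_partials (isOpen_Ioi.prod isOpen_Ioi)
    (fun _ _ h => W.hasDerivAt_energyPotential_t h.1 h.2)
    (fun _ _ h => W.hasDerivAt_energyPotential_r h.1 h.2)
    W.continuousOn_mDen W.continuousOn_eDen ⟨hax, hbx⟩ ha hb

theorem integral_eDen (W : WaveMapEnergyLE ψ E) {t a b : ℝ} (ht : 0 < t) (ha : 0 < a)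
    (hb : 0 < b) :
    ∫ r in a..b, eDen ψ t r = energyPotential ψ t b - energyPotential ψ t a := by
  have hsub : uIcc a b ⊆ Ioi 0 := (ordConnected_Ioi).uIcc_subset ha hb
  exact intervalIntegral.integral_eq_sub_of_hasDerivAt
    (fun y hy => W.hasDerivAt_energyPotential_r ht (hsub hy))
    ((continuousOn_prod_left W.continuousOn_eDen (mem_Ioi.2 ht)).mono hsub).intervalIntegrable

theorem energyPotential_mono (W : WaveMapEnergyLE ψ E) {t a b : ℝ} (ht : 0 < t) (ha : 0 < a)
    (hab : a ≤ b) : energyPotential ψ t a ≤ energyPotential ψ t b := by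
  have := W.integral_eDen ht ha (ha.trans_le hab)
  have h2 : 0 ≤ ∫ r in a..b, eDen ψ t r :=
    intervalIntegral.integral_nonneg hab fun r hr => eDen_nonneg ψ t (ha.le.trans hr.1)
  linarith

theorem energyPotential_sub_le (W : WaveMapEnergyLE ψ E) {t a b : ℝ} (ht : 0 < t) (ha : 0 < a)
    (hab : a ≤ b) : energyPotential ψ t b - energyPotential ψ t a ≤ E :=
  (W.integral_eDen ht ha (ha.trans_le hab)).symm.trans_le (W.energy_le t a b ht ha hab)

theorem energyPotential_outgoing (W : WaveMapEnergyLE ψ E) {t r s : ℝ} (ht : 0 < t) (hr : 0 < r)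
    (hs : 0 ≤ s) : energyPotential ψ t r ≤ energyPotential ψ (t + s) (r + s) := by
  have h : MonotoneOn (fun x => energyPotential ψ (t + x) (r + x)) (Ici 0) := by
    refine monotoneOn_of_hasDerivAt (convex_Ici 0) (fun x (hx : 0 ≤ x) =>
      W.hasDerivAt_energyPotential_comp (by positivity) (by positivity)
        ((hasDerivAt_id x).const_add t) ((hasDerivAt_id x).const_add r)) ?_
    intro x (hx : 0 ≤ x)
    have := abs_le.1 (abs_mDen_le_eDen ψ (t + x) (r := r + x) (by positivity))
    linarith [this.1]
  simpa using h (mem_Ici.2 le_rfl) hs hs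

theorem energyPotential_incoming (W : WaveMapEnergyLE ψ E) {t r s : ℝ} (ht : 0 < t) (hr : 0 < r)
    (hs : 0 ≤ s) : energyPotential ψ (t + s) r ≤ energyPotential ψ t (r + s) := by
  have h : AntitoneOn (fun x => energyPotential ψ (t + x) (r + s - x)) (Icc 0 s) := by
    refine antitoneOn_of_hasDerivAt (convex_Icc 0 s) (fun x hx =>
      W.hasDerivAt_energyPotential_comp (by linarith [hx.1]) (by linarith [hx.2])
        ((hasDerivAt_id x).const_add t) ((hasDerivAt_id x).const_sub (r + s))) ?_
    intro x hx
    have := abs_le.1 (abs_mDen_le_eDen ψ (t + x) (r := r + s - x) (by linarith [hx.2]))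
    linarith [this.2]
  simpa using h (left_mem_Icc.2 hs) (right_mem_Icc.2 hs) hs

theorem abs_energyPotential_le (W : WaveMapEnergyLE ψ E) {t r : ℝ} (ht : 1 ≤ t) (hr : 0 < r) :
    |energyPotential ψ t r| ≤ E := by
  have ht0 : 0 < t := by linarith
  have h11 : energyPotential ψ 1 1 = 0 := by simp [energyPotential]
  have hE : 0 ≤ E := by simpa using W.energyPotential_sub_le one_pos one_pos le_rfl
  rw [abs_le]
  constructor
  · have h1 := W.energyPotential_sub_le ht0 hr (b := max 1 r + (t - 1))
      (by linarith [le_max_right 1 r])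
    have h2 := W.energyPotential_outgoing one_pos (r := max 1 r) (s := t - 1) (by positivity)
      (by linarith)
    have h3 := W.energyPotential_mono one_pos one_pos (le_max_left 1 r)
    rw [show 1 + (t - 1) = t by ring] at h2
    linarith
  · have h2 := W.energyPotential_incoming one_pos hr (s := t - 1) (by linarith)
    rw [show 1 + (t - 1) = t by ring] at h2
    rcases le_total 1 (r + (t - 1)) with h | h
    · have := W.energyPotential_sub_le one_pos one_pos h
      linarith
    · have := W.energyPotential_mono one_pos (by linarith) h
      linarith

theorem nullForm_sq_le {a b σ c : ℝ} (hc : c ^ 2 ≤ 1) :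
    (b ^ 2 - a ^ 2 + σ ^ 2 - 4 * c * σ * b) ^ 2
      ≤ 9 * (((a + b) ^ 2 + σ ^ 2) * ((b - a) ^ 2 + σ ^ 2)) := by
  have h1 : (b ^ 2 - a ^ 2 + σ ^ 2) ^ 2 ≤ ((a + b) ^ 2 + σ ^ 2) * ((b - a) ^ 2 + σ ^ 2) := by
    nlinarith [sq_nonneg (a * σ)]
  have h2 : (2 * b * σ) ^ 2 ≤ ((a + b) ^ 2 + σ ^ 2) * ((b - a) ^ 2 + σ ^ 2) := by
    nlinarith [sq_nonneg (b ^ 2 - a ^ 2 - σ ^ 2)]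
  have h3 : c ^ 2 * (2 * b * σ) ^ 2 ≤ (2 * b * σ) ^ 2 :=
    mul_le_of_le_one_left (sq_nonneg _) hc
  nlinarith [sq_nonneg ((b ^ 2 - a ^ 2 + σ ^ 2) + c * (2 * b * σ))]

theorem smoothOn_eDen (W : WaveMapEnergyLE ψ E) : SmoothOn (eDen ψ) quadrant := by
  refine ⟨W.smoothOn.isOpen, ?_⟩
  have h := W.smoothOn.contDiffOn
  have h1 := W.smoothOn.smoothOn_pT.contDiffOn
  have h2 := W.smoothOn.smoothOn_pR.contDiffOn
  unfold eDen
  refine ((h1.pow 2).add (h2.pow 2) |>.add ((contDiff_sin.comp_contDiffOn h).pow 2 |>.div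
    (contDiff_snd.pow 2).contDiffOn ?_)).mul contDiff_snd.contDiffOn
  rintro ⟨t, r⟩ ⟨ht, hr⟩
  have : (0 : ℝ) < r := hr
  positivity

theorem smoothOn_mDen (W : WaveMapEnergyLE ψ E) : SmoothOn (mDen ψ) quadrant := by
  refine ⟨W.smoothOn.isOpen, ?_⟩
  have h1 := W.smoothOn.smoothOn_pT.contDiffOn
  have h2 := W.smoothOn.smoothOn_pR.contDiffOn
  exact (contDiff_const.mul contDiff_snd).contDiffOn.mul (h1.mul h2)

theorem nullSystem (W : WaveMapEnergyLE ψ E) : NullSystem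
    (fun u v => energyPotential ψ (u + v) (v - u))
    (fun u v => eDen ψ (u + v) (v - u) + mDen ψ (u + v) (v - u))
    (fun u v => eDen ψ (u + v) (v - u) - mDen ψ (u + v) (v - u))
    (fun u v => pR ψ (u + v) (v - u) ^ 2 - pT ψ (u + v) (v - u) ^ 2
      + (sin (ψ (u + v) (v - u)) / (v - u)) ^ 2
      - 4 * cos (ψ (u + v) (v - u)) * (sin (ψ (u + v) (v - u)) / (v - u)) * pR ψ (u + v) (v - u))
    E where
  dMv u v hu hv := by
    refine (W.hasDerivAt_energyPotential_comp (show 0 < u + v by linarith)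
      (show 0 < v - u by linarith) ((hasDerivAt_id v).const_add u) ((hasDerivAt_id v).sub_const
        u)).congr_deriv ?_
    simp only [id]; ring
  dMu u v hu hv := by
    refine (W.hasDerivAt_energyPotential_comp (a := fun x => x + v) (b := fun x => v - x)
      (show 0 < u + v by linarith) (show 0 < v - u by linarith) ((hasDerivAt_id u).add_const v)
      ((hasDerivAt_id u).const_sub v)).congr_deriv ?_
    ring
  dpu u v hu hv := by
    have ht : 0 < u + v := by linarith
    have hr : 0 < v - u := by linarith
    have hp : (u + v, v - u) ∈ quadrant := ⟨ht, hr⟩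
    have ha := (hasDerivAt_id u).add_const v
    have hb := (hasDerivAt_id u).const_sub v
    refine ((W.smoothOn_eDen.hasDerivAt_comp hp ha hb).add
      (W.smoothOn_mDen.hasDerivAt_comp hp ha hb)).congr_deriv ?_
    have e1 : pT (eDen ψ) (u + v) (v - u) = _ := (W.hasDerivAt_eDen_t ht hr).deriv
    have e2 : pR (eDen ψ) (u + v) (v - u) = _ := (W.hasDerivAt_eDen_r ht hr).deriv
    have e3 : pT (mDen ψ) (u + v) (v - u) = _ := (W.hasDerivAt_mDen_t ht hr).deriv
    have e4 : pR (mDen ψ) (u + v) (v - u) = _ := (W.hasDerivAt_mDen_r ht hr).deriv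
    simp only [id, e1, e2, e3, e4, W.eqn _ _ ht hr, sin_two_mul]
    field_simp
    ring
  dnv u v hu hv := by
    have ht : 0 < u + v := by linarith
    have hr : 0 < v - u := by linarith
    have hp : (u + v, v - u) ∈ quadrant := ⟨ht, hr⟩
    have ha := (hasDerivAt_id v).const_add u
    have hb := (hasDerivAt_id v).sub_const u
    refine ((W.smoothOn_eDen.hasDerivAt_comp hp ha hb).sub
      (W.smoothOn_mDen.hasDerivAt_comp hp ha hb)).congr_deriv ?_
    have e1 : pT (eDen ψ) (u + v) (v - u) = _ := (W.hasDerivAt_eDen_t ht hr).deriv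
    have e2 : pR (eDen ψ) (u + v) (v - u) = _ := (W.hasDerivAt_eDen_r ht hr).deriv
    have e3 : pT (mDen ψ) (u + v) (v - u) = _ := (W.hasDerivAt_mDen_t ht hr).deriv
    have e4 : pR (mDen ψ) (u + v) (v - u) = _ := (W.hasDerivAt_mDen_r ht hr).deriv
    simp only [id, e1, e2, e3, e4, W.eqn _ _ ht hr, sin_two_mul]
    field_simp
    ring
  p_nonneg u v hu hv := by
    linarith [(abs_le.1 (abs_mDen_le_eDen ψ (u + v) (r := v - u) (by linarith))).1]
  n_nonneg u v hu hv := by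
    linarith [(abs_le.1 (abs_mDen_le_eDen ψ (u + v) (r := v - u) (by linarith))).2]
  bound u v hu hv := by
    have hr : 0 < v - u := by linarith
    have h := nullForm_sq_le (a := pT ψ (u + v) (v - u)) (b := pR ψ (u + v) (v - u))
      (σ := sin (ψ (u + v) (v - u)) / (v - u)) (cos_sq_le_one (ψ (u + v) (v - u)))
    rw [mul_pow]
    refine (mul_le_mul_of_nonneg_right h (sq_nonneg (v - u))).trans (le_of_eq ?_)
    unfold eDen mDen
    field_simp
    ring
  bdd u v hu hv := W.abs_energyPotential_le (by linarith) (by linarith)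

/-- Vanishing of the energy in self-similar regions. -/
theorem energyPotential_selfSimilar (W : WaveMapEnergyLE ψ E) {l δ : ℝ} (hl : 0 < l) (hl1 : l < 1)
    (hδ : 0 < δ) : ∃ A T, 1 ≤ A ∧ 1 ≤ T ∧ ∀ t a b, T ≤ t → l * t ≤ a → a ≤ b → b ≤ t - 2 * A →
      energyPotential ψ t b - energyPotential ψ t a ≤ δ := by
  obtain ⟨A, V, hA, hV, h⟩ := W.nullSystem.selfSimilar_decay (c := 2 * l / (1 + l))
    (by positivity) (by rw [div_lt_one (by positivity)]; linarith) (half_pos hδ)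
  refine ⟨A, 2 * V + 1, hA, by linarith, fun t a b ht ha hab hb => ?_⟩
  have hlt : 0 < l * t := mul_pos hl (by linarith)
  obtain ⟨h1, h2⟩ := h ((t + a) / 2) (by linarith)
  have h1 := h1 ((t - a) / 2) (by linarith) (by
    rw [show 1 - 2 * l / (1 + l) = (1 - l) / (1 + l) by field_simp; ring, div_mul_eq_mul_div,
      le_div_iff₀ (by linarith)]
    linarith)
  have h2 := h2 (t - A) (by linarith)
  have h3 := W.energyPotential_mono (t := t) (by linarith) (by linarith) hb
  rw [show (t - a) / 2 + (t + a) / 2 = t by ring, show (t + a) / 2 - (t - a) / 2 = a by ring] at h1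
  rw [show A + (t - A) = t by ring, show t - A - A = t - 2 * A by ring] at h2
  linarith

/-- Vanishing of the energy far outside the light cone. -/
theorem energyPotential_exterior (W : WaveMapEnergyLE ψ E) {δ : ℝ} (hδ : 0 < δ) :
    ∃ A, 0 ≤ A ∧ ∀ t a b, 1 ≤ t → t + A ≤ a → a ≤ b →
      energyPotential ψ t b - energyPotential ψ t a ≤ δ := by
  obtain ⟨_, ⟨R, hR, rfl⟩, hRs⟩ := exists_lt_of_lt_csSup
    (s := (fun r => energyPotential ψ 1 r) '' Ici 1) ⟨_, mem_image_of_mem _ self_mem_Ici⟩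
    (b := sSup ((fun r => energyPotential ψ 1 r) '' Ici 1) - δ) (by linarith)
  have hR1 : (1 : ℝ) ≤ R := hR
  have hbd : BddAbove ((fun r => energyPotential ψ 1 r) '' Ici 1) := by
    refine ⟨E, ?_⟩
    rintro _ ⟨r, hr, rfl⟩
    have hr1 : (1 : ℝ) ≤ r := hr
    exact (abs_le.1 (W.abs_energyPotential_le le_rfl (by linarith))).2
  refine ⟨R, by linarith, fun t a b ht ha hab => ?_⟩
  have h1 := W.energyPotential_incoming one_pos (r := b) (s := t - 1) (by linarith) (by linarith)
  have h2 := W.energyPotential_outgoing one_pos (r := a - (t - 1)) (s := t - 1) (by linarith)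
    (by linarith)
  rw [show 1 + (t - 1) = t by ring] at h1 h2
  rw [show a - (t - 1) + (t - 1) = a by ring] at h2
  have h3 := W.energyPotential_mono one_pos (by linarith) (show R ≤ a - (t - 1) by linarith)
  have h4 := le_csSup hbd (mem_image_of_mem (fun r => energyPotential ψ 1 r)
    (show b + (t - 1) ∈ Ici (1 : ℝ) from mem_Ici.2 (by linarith)))
  simp only at h4 hRs
  linarith

end WaveMapEnergyLE

/-- A function whose derivative is dominated by that of another one. -/
theorem abs_sub_le_of_abs_deriv_le {f g f' g' : ℝ → ℝ} {a b : ℝ} (hab : a ≤ b)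
    (hf : ∀ x ∈ Icc a b, HasDerivAt f (f' x) x) (hg : ∀ x ∈ Icc a b, HasDerivAt g (g' x) x)
    (h : ∀ x ∈ Icc a b, |f' x| ≤ g' x) : |f b - f a| ≤ g b - g a := by
  have h1 : MonotoneOn (fun x => g x - f x) (Icc a b) :=
    monotoneOn_of_hasDerivAt (convex_Icc a b) (fun x hx => (hg x hx).sub (hf x hx))
      fun x hx => by linarith [(abs_le.1 (h x hx)).2]
  have h2 : MonotoneOn (fun x => g x + f x) (Icc a b) :=
    monotoneOn_of_hasDerivAt (convex_Icc a b) (fun x hx => (hg x hx).add (hf x hx))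
      fun x hx => by linarith [(abs_le.1 (h x hx)).1]
  have h1 := h1 (left_mem_Icc.2 hab) (right_mem_Icc.2 hab) hab
  have h2 := h2 (left_mem_Icc.2 hab) (right_mem_Icc.2 hab) hab
  simp only at h1 h2
  rw [abs_le]
  constructor <;> linarith

namespace WaveMapEnergyLE

variable {ψ : ℝ → ℝ → ℝ} {E : ℝ}

theorem hasDerivAt_cos (W : WaveMapEnergyLE ψ E) {t r : ℝ} (ht : 0 < t) (hr : 0 < r) :
    HasDerivAt (fun ρ => cos (ψ t ρ)) (-sin (ψ t r) * pR ψ t r) r :=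
  (W.smoothOn.hasDerivAt_pR (show (t, r) ∈ quadrant from ⟨ht, hr⟩)).cos

theorem abs_cos_sub_le (W : WaveMapEnergyLE ψ E) {t a b : ℝ} (ht : 0 < t) (ha : 0 < a)
    (hab : a ≤ b) : |cos (ψ t b) - cos (ψ t a)| ≤
      1 / 2 * (energyPotential ψ t b - energyPotential ψ t a) := by
  have := abs_sub_le_of_abs_deriv_le (f := fun ρ => cos (ψ t ρ))
    (g := fun ρ => 1 / 2 * energyPotential ψ t ρ) hab
    (fun x hx => W.hasDerivAt_cos ht (ha.trans_le hx.1))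
    (fun x hx => (W.hasDerivAt_energyPotential_r ht (ha.trans_le hx.1)).const_mul (1 / 2))
    (fun x hx => by
      have hx0 : 0 < x := ha.trans_le hx.1
      have h1 : |sin (ψ t x) * pR ψ t x| = |sin (ψ t x) / x * pR ψ t x| * x := by
        rw [div_mul_eq_mul_div, abs_div, abs_of_pos hx0]; field_simp
      have h2 : |sin (ψ t x) / x * pR ψ t x| ≤
          1 / 2 * ((sin (ψ t x) / x) ^ 2 + pR ψ t x ^ 2) := by
        rw [abs_le]
        constructor <;> nlinarith [sq_nonneg (sin (ψ t x) / x - pR ψ t x),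
          sq_nonneg (sin (ψ t x) / x + pR ψ t x)]
      rw [neg_mul, abs_neg, h1]
      have h3 : 0 ≤ pT ψ t x ^ 2 * x := by positivity
      have h4 := mul_le_mul_of_nonneg_right h2 hx0.le
      unfold eDen
      rw [div_pow] at h4
      linarith)
  simpa [mul_sub] using this

theorem abs_cos_sub_le' (W : WaveMapEnergyLE ψ E) {t a b ω : ℝ} (ht : 0 < t) (ha : 0 < a)
    (hab : a ≤ b) (hω : 0 < ω) : |cos (ψ t b) - cos (ψ t a)| ≤
      ω * (energyPotential ψ t b - energyPotential ψ t a) + (b - a) / (4 * ω * a) := by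
  have := abs_sub_le_of_abs_deriv_le (f := fun ρ => cos (ψ t ρ))
    (g := fun ρ => ω * energyPotential ψ t ρ + ρ / (4 * ω * a)) hab
    (fun x hx => W.hasDerivAt_cos ht (ha.trans_le hx.1))
    (fun x hx => ((W.hasDerivAt_energyPotential_r ht (ha.trans_le hx.1)).const_mul ω).add
      ((hasDerivAt_id x).div_const (4 * ω * a)))
    (fun x hx => by
      have hx0 : 0 < x := ha.trans_le hx.1
      have h1 : |-sin (ψ t x) * pR ψ t x| ≤ |pR ψ t x| := by
        rw [abs_mul, abs_neg]
        exact mul_le_of_le_one_left (abs_nonneg _) (abs_sin_le_one _)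
      have h2 : |pR ψ t x| ≤ ω * (pR ψ t x ^ 2 * x) + 1 / (4 * ω * x) := by
        have h : 0 ≤ (2 * ω * x * |pR ψ t x| - 1) ^ 2 / (4 * ω * x) := by positivity
        have h' : (2 * ω * x * |pR ψ t x| - 1) ^ 2 / (4 * ω * x) =
            ω * (|pR ψ t x| ^ 2 * x) - |pR ψ t x| + 1 / (4 * ω * x) := by
          field_simp; ring
        rw [sq_abs] at h'
        linarith
      have h3 : 1 / (4 * ω * x) ≤ 1 / (4 * ω * a) := by
        gcongr; exact hx.1
      have h4 : pR ψ t x ^ 2 * x ≤ eDen ψ t x := by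
        have h3 : 0 ≤ pT ψ t x ^ 2 * x := by positivity
        have h5 : 0 ≤ sin (ψ t x) ^ 2 / x ^ 2 * x := by positivity
        unfold eDen; linarith
      have h5 := mul_le_mul_of_nonneg_left h4 hω.le
      linarith)
  refine this.trans (le_of_eq ?_)
  ring

/-- At late times, `ψ` stays away from the equator outside self-similar regions. -/
theorem eventually_cos_ne_zero (W : WaveMapEnergyLE ψ E) {k : ℤ}
    (hlim : ∀ t, 0 < t → Tendsto (ψ t) atTop (nhds (k * π))) {l : ℝ} (hl : 0 < l) (hl1 : l < 1) :
    ∃ T, 1 ≤ T ∧ ∀ t r, T ≤ t → l * t ≤ r → cos (ψ t r) ≠ 0 := by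
  obtain ⟨A, T₁, hA, hT₁, h₁⟩ := W.energyPotential_selfSimilar hl hl1 (δ := 1 / 2) (by norm_num)
  obtain ⟨A', hA', h₂⟩ := W.energyPotential_exterior (δ := 1 / 2) (by norm_num)
  have hE : 0 ≤ E := by simpa using W.energyPotential_sub_le one_pos one_pos le_rfl
  obtain ⟨ω, hω⟩ : ∃ ω, ω = 1 / (8 * (E + 1)) := ⟨_, rfl⟩
  have hω0 : 0 < ω := by rw [hω]; positivity
  have hωE : ω * E ≤ 1 / 8 := by
    rw [hω, div_mul_eq_mul_div, div_le_iff₀ (by positivity)]; linarith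
  refine ⟨max (max T₁ (4 * A)) (4 * (2 * A + A') / ω), ?_, fun t r ht hr => ?_⟩
  · exact hT₁.trans ((le_max_left _ _).trans (le_max_left _ _))
  have ht1 : T₁ ≤ t := (le_max_left _ _).trans ((le_max_left _ _).trans ht)
  have ht2 : 4 * A ≤ t := (le_max_right _ _).trans ((le_max_left _ _).trans ht)
  have ht3 : 4 * (2 * A + A') / ω ≤ t := (le_max_right _ _).trans ht
  have ht0 : 0 < t := by linarith
  have hr0 : 0 < r := (mul_pos hl ht0).trans_le hr
  obtain ⟨r₁, hr₁⟩ : ∃ x, x = max r (t - 2 * A) := ⟨_, rfl⟩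
  obtain ⟨r₂, hr₂⟩ : ∃ x, x = max r₁ (t + A') := ⟨_, rfl⟩
  have hrr₁ : r ≤ r₁ := hr₁ ▸ le_max_left _ _
  have hrr₂ : r₁ ≤ r₂ := hr₂ ▸ le_max_left _ _
  have hlow : t - 2 * A ≤ r₁ := hr₁ ▸ le_max_right _ _
  have s1 : |cos (ψ t r₁) - cos (ψ t r)| ≤ 1 / 4 := by
    rcases le_total r (t - 2 * A) with h | h
    · have e : r₁ = t - 2 * A := hr₁.trans (max_eq_right h)
      have := W.abs_cos_sub_le ht0 hr0 hrr₁
      have := h₁ t r r₁ ht1 hr hrr₁ e.le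
      linarith
    · rw [show r₁ = r from hr₁.trans (max_eq_left h)]
      norm_num
  have s2 : |cos (ψ t r₂) - cos (ψ t r₁)| ≤ 1 / 4 := by
    rcases le_total r₁ (t + A') with h | h
    · have e : r₂ = t + A' := hr₂.trans (max_eq_right h)
      have h1 := W.abs_cos_sub_le' ht0 (hr0.trans_le hrr₁) hrr₂ hω0
      have h2 := W.energyPotential_sub_le ht0 (hr0.trans_le hrr₁) hrr₂
      have h3 : (r₂ - r₁) / (4 * ω * r₁) ≤ 1 / 8 := by
        have h4 : 0 < 4 * ω * r₁ := by have := hr0.trans_le hrr₁; positivity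
        rw [div_le_iff₀ h4]
        rw [div_le_iff₀ hω0] at ht3
        have : ω * (t / 2) ≤ ω * r₁ := mul_le_mul_of_nonneg_left (by linarith) hω0.le
        linarith
      have := mul_le_mul_of_nonneg_left h2 hω0.le
      linarith
    · rw [show r₂ = r₁ from hr₂.trans (max_eq_left h)]
      norm_num
  have s3 : 1 - |cos (ψ t r₂)| ≤ 1 / 4 := by
    have hc : Tendsto (fun b => |cos (ψ t b)|) atTop (nhds 1) := by
      have := (((continuous_cos.tendsto _).comp (hlim t ht0)).abs)
      rwa [abs_cos_int_mul_pi] at this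
    refine le_of_tendsto (hc.sub_const _) ?_
    filter_upwards [eventually_ge_atTop r₂] with b hb
    have h1 := W.abs_cos_sub_le ht0 (by linarith) hb
    have h2 := h₂ t r₂ b (by linarith) (hr₂ ▸ le_max_right _ _) hb
    have h3 := abs_sub_abs_le_abs_sub (cos (ψ t b)) (cos (ψ t r₂))
    linarith
  intro h0
  have h3 := abs_sub_abs_le_abs_sub (cos (ψ t r₂)) (cos (ψ t r₁))
  rw [h0, sub_zero] at s1
  linarith

end WaveMapEnergyLE

/-- Kinetic energy in the annulus `a ≤ r ≤ b`. -/
def kin (ψ : ℝ → ℝ → ℝ) (a b t : ℝ) : ℝ := ∫ r in a..b, pT ψ t r ^ 2 * r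

/-- Radial virial flux. -/
def virialFlux (ψ : ℝ → ℝ → ℝ) (t r : ℝ) : ℝ :=
  (r ^ 2 * (pT ψ t r ^ 2 + pR ψ t r ^ 2) - sin (ψ t r) ^ 2) / 2

namespace WaveMapEnergyLE

variable {ψ : ℝ → ℝ → ℝ} {E : ℝ}

theorem quadrant_sub {a b : ℝ} (ha : 0 < a) (hb : 0 < b) :
    (Ioi 0 ×ˢ uIcc a b : Set (ℝ × ℝ)) ⊆ quadrant :=
  prod_mono Subset.rfl ((ordConnected_Ioi).uIcc_subset ha hb)

theorem continuousOn_kinDen (W : WaveMapEnergyLE ψ E) :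
    ContinuousOn (fun p : ℝ × ℝ => pT ψ p.1 p.2 ^ 2 * p.2) quadrant := by
  have h1 := W.smoothOn.smoothOn_pT.continuousOn
  fun_prop

theorem continuousOn_kin (W : WaveMapEnergyLE ψ E) {a b : ℝ} (ha : 0 < a) (hb : 0 < b) :
    ContinuousOn (kin ψ a b) (Ioi 0) :=
  continuousOn_intervalIntegral (f := fun t r => pT ψ t r ^ 2 * r) isOpen_Ioi
    (W.continuousOn_kinDen.mono (quadrant_sub ha hb))

theorem continuousOn_virialFlux (W : WaveMapEnergyLE ψ E) :
    ContinuousOn (fun p : ℝ × ℝ => virialFlux ψ p.1 p.2) quadrant := by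
  have h := continuous_sin.comp_continuousOn W.smoothOn.continuousOn
  have h1 := W.smoothOn.smoothOn_pT.continuousOn
  have h2 := W.smoothOn.smoothOn_pR.continuousOn
  unfold virialFlux
  simp only [Function.comp_def] at h
  fun_prop

theorem hasDerivAt_virialFlux (W : WaveMapEnergyLE ψ E) {t r : ℝ} (ht : 0 < t) (hr : 0 < r) :
    HasDerivAt (fun ρ => virialFlux ψ t ρ) (r ^ 2 * (pT (pT ψ) t r * pR ψ t r +
      pT ψ t r * pR (pT ψ) t r) + pT ψ t r ^ 2 * r) r := by
  have hp : (t, r) ∈ quadrant := ⟨ht, hr⟩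
  have h := W.smoothOn.hasDerivAt_pR hp
  have h1 := W.smoothOn.smoothOn_pT.hasDerivAt_pR hp
  have h2 := W.smoothOn.smoothOn_pR.hasDerivAt_pR hp
  have h3 := ((((hasDerivAt_id r).fun_pow 2).mul ((h1.fun_pow 2).add (h2.fun_pow 2))).sub
    (h.sin.fun_pow 2)).div_const 2
  refine h3.congr_deriv ?_
  simp only [id, Pi.add_apply]
  rw [W.eqn t r ht hr, sin_two_mul]
  field_simp
  push_cast
  ring

theorem hasDerivAt_integral_momentum (W : WaveMapEnergyLE ψ E) {t a b : ℝ} (ht : 0 < t)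
    (ha : 0 < a) (hb : 0 < b) :
    HasDerivAt (fun t => ∫ r in a..b, r ^ 2 * (pT ψ t r * pR ψ t r))
      (virialFlux ψ t b - virialFlux ψ t a - kin ψ a b t) t := by
  have h1 := W.smoothOn.smoothOn_pT.continuousOn
  have h2 := W.smoothOn.smoothOn_pR.continuousOn
  have h4 := W.smoothOn.smoothOn_pT.smoothOn_pT.continuousOn
  have h5 := W.smoothOn.smoothOn_pT.smoothOn_pR.continuousOn
  have hsub : uIcc a b ⊆ Ioi 0 := (ordConnected_Ioi).uIcc_subset ha hb
  have hc : ContinuousOn (fun p : ℝ × ℝ => p.2 ^ 2 * (pT (pT ψ) p.1 p.2 * pR ψ p.1 p.2 +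
      pT ψ p.1 p.2 * pR (pT ψ) p.1 p.2)) (Ioi 0 ×ˢ uIcc a b) :=
    ContinuousOn.mono (by fun_prop) (quadrant_sub ha hb)
  have h := hasDerivAt_intervalIntegral_of_continuousOn (a := a) (b := b)
    (f := fun t r => r ^ 2 * (pT ψ t r * pR ψ t r))
    (f' := fun t r => r ^ 2 * (pT (pT ψ) t r * pR ψ t r + pT ψ t r * pR (pT ψ) t r))
    isOpen_Ioi (mem_Ioi.2 ht) (ContinuousOn.mono (by fun_prop) (quadrant_sub ha hb)) hc
    (fun x hx y hy => by
      have hp : (x, y) ∈ quadrant := ⟨hx, hsub hy⟩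
      have g1 := W.smoothOn.smoothOn_pT.hasDerivAt_pT hp
      have g2 := W.smoothOn.smoothOn_pR.hasDerivAt_pT hp
      rw [W.smoothOn.pT_pR hp] at g2
      exact (g1.mul g2).const_mul _)
  refine h.congr_deriv ?_
  have i1 := (continuousOn_prod_left (f := fun t r => r ^ 2 * (pT (pT ψ) t r * pR ψ t r +
    pT ψ t r * pR (pT ψ) t r)) hc (mem_Ioi.2 ht)).intervalIntegrable (μ := volume)
  have i2 := (continuousOn_prod_left (f := fun t r => pT ψ t r ^ 2 * r)
    (W.continuousOn_kinDen.mono (quadrant_sub ha hb)) (mem_Ioi.2 ht)).intervalIntegrable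
      (μ := volume)
  have i3 := intervalIntegral.integral_eq_sub_of_hasDerivAt (a := a) (b := b)
    (f := fun ρ => virialFlux ψ t ρ) (fun y hy => W.hasDerivAt_virialFlux ht (hsub hy)) (i1.add i2)
  rw [intervalIntegral.integral_add i1 i2] at i3
  unfold kin
  linarith

/-- Localized virial identity. -/
theorem integral_kin (W : WaveMapEnergyLE ψ E) {T₁ T₂ a b : ℝ} (hT₁ : 0 < T₁) (hT₂ : 0 < T₂)
    (ha : 0 < a) (hb : 0 < b) : ∫ t in T₁..T₂, kin ψ a b t =
      ((∫ t in T₁..T₂, virialFlux ψ t b) - ∫ t in T₁..T₂, virialFlux ψ t a)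
      + ((∫ r in a..b, r ^ 2 * (pT ψ T₁ r * pR ψ T₁ r))
        - ∫ r in a..b, r ^ 2 * (pT ψ T₂ r * pR ψ T₂ r)) := by
  have hsub : uIcc T₁ T₂ ⊆ Ioi 0 := (ordConnected_Ioi).uIcc_subset hT₁ hT₂
  have i1 := ((W.continuousOn_kin ha hb).mono hsub).intervalIntegrable (μ := volume)
  have i2 : ∀ c, 0 < c → IntervalIntegrable (fun t => virialFlux ψ t c) volume T₁ T₂ := fun c hc =>
    ((continuousOn_prod_right W.continuousOn_virialFlux (mem_Ioi.2 hc)).mono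
      hsub).intervalIntegrable
  have h := intervalIntegral.integral_eq_sub_of_hasDerivAt
    (fun t ht => W.hasDerivAt_integral_momentum (hsub ht) ha hb) (((i2 b hb).sub (i2 a ha)).sub i1)
  rw [intervalIntegral.integral_sub ((i2 b hb).sub (i2 a ha)) i1,
    intervalIntegral.integral_sub (i2 b hb) (i2 a ha)] at h
  linarith

theorem abs_integral_momentum_le (W : WaveMapEnergyLE ψ E) {t a b : ℝ} (ht : 0 < t)
    (ha : 0 < a) (hab : a ≤ b) : |∫ r in a..b, r ^ 2 * (pT ψ t r * pR ψ t r)| ≤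
      b / 2 * (energyPotential ψ t b - energyPotential ψ t a) := by
  have hsub : uIcc a b ⊆ Ioi 0 := (ordConnected_Ioi).uIcc_subset ha (ha.trans_le hab)
  have hi := ((continuousOn_prod_left W.continuousOn_eDen (mem_Ioi.2 ht)).mono
    hsub).intervalIntegrable (μ := volume)
  have h := intervalIntegral.norm_integral_le_of_norm_le (μ := volume)
    (f := fun r => r ^ 2 * (pT ψ t r * pR ψ t r)) (g := fun r => b / 2 * eDen ψ t r) hab
    (Eventually.of_forall fun r hr => by
      have hr0 : 0 < r := ha.trans hr.1
      have h1 := abs_mDen_le_eDen ψ t hr0.le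
      have e : r ^ 2 * (pT ψ t r * pR ψ t r) = r / 2 * mDen ψ t r := by unfold mDen; ring
      rw [e, norm_eq_abs, abs_mul, abs_of_pos (half_pos hr0)]
      exact mul_le_mul (by linarith [hr.2]) h1 (abs_nonneg _) (by linarith [hr.2]))
    (hi.const_mul _)
  rw [intervalIntegral.integral_const_mul, W.integral_eDen ht ha (ha.trans_le hab)] at h
  exact h

theorem tendsto_integral_sin_sq (W : WaveMapEnergyLE ψ E) {T₁ T₂ : ℝ} (hT₁ : 0 < T₁) (hT₂ : 0 < T₂)
    (h0 : ∀ t, 0 < t → Tendsto (ψ t) (nhdsWithin 0 (Ioi 0)) (nhds 0)) :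
    Tendsto (fun a => ∫ t in T₁..T₂, sin (ψ t a) ^ 2) (nhdsWithin 0 (Ioi 0)) (nhds 0) := by
  have hsub : uIcc T₁ T₂ ⊆ Ioi 0 := (ordConnected_Ioi).uIcc_subset hT₁ hT₂
  have h := intervalIntegral.tendsto_integral_filter_of_dominated_convergence (μ := volume)
    (a := T₁) (b := T₂) (F := fun a t => sin (ψ t a) ^ 2) (f := fun _ => 0)
    (l := nhdsWithin (0 : ℝ) (Ioi 0)) (fun _ => 1) ?_ ?_ intervalIntegrable_const ?_
  · simpa using h
  · filter_upwards [self_mem_nhdsWithin] with a ha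
    refine ContinuousOn.aestronglyMeasurable (ContinuousOn.mono (ContinuousOn.pow
      (continuous_sin.comp_continuousOn (continuousOn_prod_right W.smoothOn.continuousOn ha)) 2)
      (uIoc_subset_uIcc.trans hsub)) measurableSet_uIoc
  · refine Eventually.of_forall fun a => Eventually.of_forall fun t _ => ?_
    rw [norm_eq_abs, abs_of_nonneg (sq_nonneg _)]
    exact sin_sq_le_one _
  · refine Eventually.of_forall fun t ht => ?_
    have := ((continuous_sin.tendsto 0).comp (h0 t (hsub (uIoc_subset_uIcc ht)))).pow 2
    simpa [Function.comp_def] using this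

theorem exists_integral_eDen_le (W : WaveMapEnergyLE ψ E) {T₁ T₂ a b δ : ℝ} (hT₁ : 0 < T₁)
    (hT : T₁ < T₂) (ha : 0 < a) (hab : a < b)
    (h : ∀ t ∈ Icc T₁ T₂, energyPotential ψ t b - energyPotential ψ t a ≤ δ) :
    ∃ R ∈ Icc a b, (b - a) * ∫ t in T₁..T₂, eDen ψ t R ≤ (T₂ - T₁) * δ := by
  by_contra! hc
  have hsub1 : uIcc T₁ T₂ ⊆ Ioi 0 := (ordConnected_Ioi).uIcc_subset hT₁ (hT₁.trans hT)
  have hsub2 : uIcc a b ⊆ Ioi 0 := (ordConnected_Ioi).uIcc_subset ha (ha.trans hab)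
  have hswap := integral_integral_swap_of_continuousOn (f := eDen ψ) (a := T₁) (b := T₂) (c := a)
    (d := b) (W.continuousOn_eDen.mono (prod_mono hsub1 hsub2))
  have hcont : ContinuousOn (fun R => ∫ t in T₁..T₂, eDen ψ t R) (Ioi 0) :=
    continuousOn_intervalIntegral (f := fun R t => eDen ψ t R) isOpen_Ioi
      (W.continuousOn_eDen.comp (f := fun p : ℝ × ℝ => (p.2, p.1)) (by fun_prop)
        fun p hp => ⟨hsub1 hp.2, hp.1⟩)
  have hcont2 : ContinuousOn (fun t => ∫ r in a..b, eDen ψ t r) (Ioi 0) :=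
    continuousOn_intervalIntegral isOpen_Ioi
      (W.continuousOn_eDen.mono (quadrant_sub ha (ha.trans hab)))
  have h1 : ∫ t in T₁..T₂, ∫ r in a..b, eDen ψ t r ≤ ∫ _ in T₁..T₂, δ := by
    refine intervalIntegral.integral_mono_on hT.le (hcont2.mono hsub1).intervalIntegrable
      intervalIntegrable_const fun t ht => ?_
    rw [W.integral_eDen (hT₁.trans_le ht.1) ha (ha.trans hab)]
    exact h t ht
  have h2 : ∫ _ in a..b, (T₂ - T₁) * δ / (b - a) < ∫ r in a..b, ∫ t in T₁..T₂, eDen ψ t r := by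
    refine intervalIntegral.integral_lt_integral_of_continuousOn_of_le_of_exists_lt hab
      continuousOn_const (hcont.mono (uIcc_of_le hab.le ▸ hsub2)) (fun R hR => ?_)
      ⟨a, left_mem_Icc.2 hab.le, ?_⟩
    · rw [div_le_iff₀' (sub_pos.2 hab)]
      exact (hc R (Ioc_subset_Icc_self hR)).le
    · rw [div_lt_iff₀' (sub_pos.2 hab)]
      exact hc a (left_mem_Icc.2 hab.le)
  rw [intervalIntegral.integral_const, smul_eq_mul] at h1 h2
  rw [mul_div_cancel₀ _ (sub_pos.2 hab).ne'] at h2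
  linarith

theorem kin_mono (W : WaveMapEnergyLE ψ E) {t a b a' b' : ℝ} (ht : 0 < t) (ha' : 0 < a')
    (haa : a' ≤ a) (hab : a ≤ b) (hbb : b ≤ b') : kin ψ a b t ≤ kin ψ a' b' t := by
  refine intervalIntegral.integral_mono_interval haa hab hbb ?_ ?_
  · filter_upwards [ae_restrict_mem measurableSet_Ioc] with r hr
    have : 0 < r := ha'.trans hr.1
    positivity
  · exact ((continuousOn_prod_left (f := fun t r => pT ψ t r ^ 2 * r) W.continuousOn_kinDen
      (mem_Ioi.2 ht)).mono ((ordConnected_Ioi).uIcc_subset ha'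
        (by linarith : 0 < b'))).intervalIntegrable

/-- Averaged decay of the kinetic energy inside the light cone. -/
theorem integral_kin_le (W : WaveMapEnergyLE ψ E)
    (h0 : ∀ t, 0 < t → Tendsto (ψ t) (nhdsWithin 0 (Ioi 0)) (nhds 0)) {η : ℝ} (hη : 0 < η) :
    ∃ T₀, 1 ≤ T₀ ∧ ∀ T ε, T₀ ≤ T → 0 < ε → ε ≤ T / 2 →
      ∫ t in T..2 * T, kin ψ ε (T / 2) t ≤ η * T := by
  have hE : 0 ≤ E := by simpa using W.energyPotential_sub_le one_pos one_pos le_rfl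
  obtain ⟨l, hl⟩ : ∃ l, l = min (1 / 8) (η / (8 * (E + 1))) := ⟨_, rfl⟩
  have hl0 : 0 < l := by rw [hl]; positivity
  have hl8 : l ≤ 1 / 8 := hl ▸ min_le_left _ _
  have hlE : l * E ≤ η / 8 := by
    have h1 : l ≤ η / (8 * (E + 1)) := hl ▸ min_le_right _ _
    rw [le_div_iff₀ (by positivity)] at h1
    nlinarith
  obtain ⟨A, T₁, hA, hT₁, hss⟩ := W.energyPotential_selfSimilar hl0 (by linarith)
    (δ := η / 16) (by positivity)
  refine ⟨max T₁ (8 * A), hT₁.trans (le_max_left _ _), fun T ε hT hε hεT => ?_⟩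
  have hTT₁ : T₁ ≤ T := (le_max_left _ _).trans hT
  have hTA : 8 * A ≤ T := (le_max_right _ _).trans hT
  have hT0 : 0 < T := by linarith
  have hle : T ≤ 2 * T := by linarith
  obtain ⟨R, hR, hRe⟩ := W.exists_integral_eDen_le hT0 (T₂ := 2 * T) (a := T / 2) (b := 3 * T / 4)
    (δ := η / 16) (by linarith) (by linarith) (by linarith) (fun t ht => hss t _ _
      (hTT₁.trans ht.1) (by nlinarith [ht.2]) (by linarith) (by linarith [ht.1]))
  have hR0 : 0 < R := by linarith [hR.1]
  have hsub : uIcc T (2 * T) ⊆ Ioi 0 := (ordConnected_Ioi).uIcc_subset hT0 (by simpa using hT0)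
  obtain ⟨a, haε, haT, ha0, has⟩ : ∃ a, a ≤ ε ∧ a ≤ l * T ∧ 0 < a ∧
      ∫ t in T..2 * T, sin (ψ t a) ^ 2 < η * T / 4 := by
    have h1 := (W.tendsto_integral_sin_sq hT0 (hsub right_mem_uIcc) h0).eventually_lt_const
      (show 0 < η * T / 4 by positivity)
    obtain ⟨a, ⟨h2, h3⟩, h4⟩ := ((h1.and self_mem_nhdsWithin).and (mem_nhdsWithin_of_mem_nhds
      (Iic_mem_nhds (show 0 < min ε (l * T) by positivity)))).exists
    exact ⟨a, h4.trans (min_le_left _ _), h4.trans (min_le_right _ _), h3, h2⟩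
  have hmono : ∫ t in T..2 * T, kin ψ ε (T / 2) t ≤ ∫ t in T..2 * T, kin ψ a R t := by
    refine intervalIntegral.integral_mono_on hle
      ((W.continuousOn_kin hε (by positivity)).mono hsub).intervalIntegrable
      ((W.continuousOn_kin ha0 hR0).mono hsub).intervalIntegrable fun t ht => ?_
    exact W.kin_mono (hT0.trans_le ht.1) ha0 haε hεT hR.1
  rw [W.integral_kin hT0 (hsub right_mem_uIcc) ha0 hR0] at hmono
  have hfl : ∀ c, 0 < c → IntervalIntegrable (fun t => virialFlux ψ t c) volume T (2 * T) :=
    fun c hc => ((continuousOn_prod_right W.continuousOn_virialFlux (mem_Ioi.2 hc)).mono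
      hsub).intervalIntegrable
  have hfR : ∫ t in T..2 * T, virialFlux ψ t R ≤ R / 2 * ∫ t in T..2 * T, eDen ψ t R := by
    rw [← intervalIntegral.integral_const_mul]
    refine intervalIntegral.integral_mono_on hle (hfl R hR0)
      ((((continuousOn_prod_right W.continuousOn_eDen (mem_Ioi.2 hR0)).mono
      hsub).intervalIntegrable).const_mul _) fun t ht => ?_
    have e : R / 2 * eDen ψ t R =
        (R ^ 2 * (pT ψ t R ^ 2 + pR ψ t R ^ 2) + sin (ψ t R) ^ 2) / 2 := by
      unfold eDen; field_simp
    rw [e]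
    unfold virialFlux
    linarith [sq_nonneg (sin (ψ t R))]
  have hfa : -∫ t in T..2 * T, virialFlux ψ t a ≤ 1 / 2 * ∫ t in T..2 * T, sin (ψ t a) ^ 2 := by
    rw [← intervalIntegral.integral_const_mul, ← intervalIntegral.integral_neg]
    refine intervalIntegral.integral_mono_on hle (hfl a ha0).neg ?_ fun t ht => ?_
    · refine IntervalIntegrable.const_mul (ContinuousOn.intervalIntegrable (ContinuousOn.mono
        (ContinuousOn.pow (continuous_sin.comp_continuousOn (continuousOn_prod_right
          W.smoothOn.continuousOn (mem_Ioi.2 ha0))) 2) hsub)) _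
    · have : 0 ≤ a ^ 2 * (pT ψ t a ^ 2 + pR ψ t a ^ 2) := by positivity
      unfold virialFlux
      linarith
  have hP : ∀ t ∈ Icc T (2 * T), |∫ r in a..R, r ^ 2 * (pT ψ t r * pR ψ t r)| ≤
      η * T * (1 / 8 + 1 / 32) := by
    intro t ht
    have ht0 : 0 < t := hT0.trans_le ht.1
    have hlt : 0 < l * t := by positivity
    have hlT : l * T ≤ l * t := mul_le_mul_of_nonneg_left ht.1 hl0.le
    have hltR : l * t ≤ R := by nlinarith [ht.2, hR.1]
    have hint : ∀ c d, 0 < c → 0 < d → IntervalIntegrable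
        (fun r => r ^ 2 * (pT ψ t r * pR ψ t r)) volume c d := fun c d hc hd => by
      have hs : uIcc c d ⊆ Ioi 0 := (ordConnected_Ioi).uIcc_subset hc hd
      have h1 := (continuousOn_prod_left W.smoothOn.smoothOn_pT.continuousOn
        (mem_Ioi.2 ht0)).mono hs
      have h2 := (continuousOn_prod_left W.smoothOn.smoothOn_pR.continuousOn
        (mem_Ioi.2 ht0)).mono hs
      exact ContinuousOn.intervalIntegrable (by fun_prop)
    rw [← intervalIntegral.integral_add_adjacent_intervals (hint a (l * t) ha0 hlt)
      (hint (l * t) R hlt hR0)]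
    have h1 := W.abs_integral_momentum_le ht0 ha0 (haT.trans hlT)
    have h2 := W.abs_integral_momentum_le ht0 hlt hltR
    have h3 := W.energyPotential_sub_le ht0 ha0 (haT.trans hlT)
    have h4 := hss t (l * t) R (hTT₁.trans ht.1) le_rfl hltR (by linarith [hR.2, ht.1])
    have h5 : l * t / 2 * (energyPotential ψ t (l * t) - energyPotential ψ t a) ≤ η * T / 8 := by
      calc _ ≤ l * t / 2 * E := mul_le_mul_of_nonneg_left h3 (by positivity)
        _ = (l * E) * (t / 2) := by ring
        _ ≤ (η / 8) * T := mul_le_mul hlE (by linarith [ht.2]) (by positivity) (by positivity)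
        _ = _ := by ring
    have h6 : R / 2 * (energyPotential ψ t R - energyPotential ψ t (l * t)) ≤ η * T / 32 := by
      calc _ ≤ R / 2 * (η / 16) := mul_le_mul_of_nonneg_left h4 (by positivity)
        _ ≤ T / 2 * (η / 16) := by gcongr; linarith [hR.2]
        _ = _ := by ring
    refine (abs_add_le _ _).trans ?_
    linarith
  have hP1 := (abs_le.1 (hP T (left_mem_Icc.2 hle))).2
  have hP2 := (abs_le.1 (hP (2 * T) (right_mem_Icc.2 hle))).1
  have hRe' : ∫ t in T..2 * T, eDen ψ t R ≤ η / 4 := by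
    rw [show 3 * T / 4 - T / 2 = T / 4 by ring, show 2 * T - T = T by ring] at hRe
    have : T / 4 * (∫ t in T..2 * T, eDen ψ t R) ≤ T / 4 * (η / 4) := by linarith
    exact le_of_mul_le_mul_left this (by positivity)
  have hRe2 : R / 2 * ∫ t in T..2 * T, eDen ψ t R ≤ 3 * T / 8 * (η / 4) :=
    mul_le_mul (by linarith [hR.2]) hRe' (intervalIntegral.integral_nonneg hle fun t _ =>
      eDen_nonneg ψ t hR0.le) (by positivity)
  have hηT : 0 < η * T := by positivity
  linarith

theorem hasDerivAt_integral_kin (W : WaveMapEnergyLE ψ E) {a b T t : ℝ} (ha : 0 < a) (hb : 0 < b)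
    (hT : 0 < T) (ht : 0 < t) : HasDerivAt (fun x => ∫ s in T..x, kin ψ a b s) (kin ψ a b t) t := by
  have hc := W.continuousOn_kin ha hb
  refine intervalIntegral.integral_hasDerivAt_right ?_ ?_ ?_
  · exact (hc.mono ((ordConnected_Ioi).uIcc_subset hT ht)).intervalIntegrable
  · exact hc.stronglyMeasurableAtFilter isOpen_Ioi t ht
  · exact hc.continuousAt (Ioi_mem_nhds ht)

theorem intervalIntegrable_kin (W : WaveMapEnergyLE ψ E) {a b T₁ T₂ : ℝ} (ha : 0 < a) (hb : 0 < b)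
    (hT₁ : 0 < T₁) (hT₂ : 0 < T₂) : IntervalIntegrable (kin ψ a b) volume T₁ T₂ :=
  ((W.continuousOn_kin ha hb).mono ((ordConnected_Ioi).uIcc_subset hT₁ hT₂)).intervalIntegrable

theorem integral_kin_mono (W : WaveMapEnergyLE ψ E) {T₁ T₂ a b a' b' : ℝ} (hT₁ : 0 < T₁)
    (hT : T₁ ≤ T₂) (ha' : 0 < a') (haa : a' ≤ a) (hab : a ≤ b) (hbb : b ≤ b') :
    ∫ t in T₁..T₂, kin ψ a b t ≤ ∫ t in T₁..T₂, kin ψ a' b' t :=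
  intervalIntegral.integral_mono_on hT
    (W.intervalIntegrable_kin (by linarith) (by linarith) hT₁ (by linarith))
    (W.intervalIntegrable_kin ha' (by linarith) hT₁ (by linarith))
    fun _ ht => W.kin_mono (hT₁.trans_le ht.1) ha' haa hab hbb

/-- Selection of a time from which the kinetic energy density stays small on average, for a
fixed inner radius. -/
theorem exists_good_time_aux (W : WaveMapEnergyLE ψ E) {η T ε : ℝ} (hη : 0 < η) (hT : 0 < T)
    (hε : 0 < ε) (h : ∫ t in T..2 * T, kin ψ ε (T / 2) t ≤ η / 2 * T) (hεT : ε ≤ T / 2) :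
    ∃ t ∈ Icc T (3 * T / 2), ∀ h, 0 ≤ h → h ≤ T / 2 →
      ∫ s in t..t + h, kin ψ ε (T / 2) s ≤ η * h := by
  have hd : ∀ x, 0 < x → HasDerivAt (fun x => ∫ s in T..x, kin ψ ε (T / 2) s)
    (kin ψ ε (T / 2) x) x := fun x hx => W.hasDerivAt_integral_kin hε (by positivity) hT hx
  have hk0 : ∀ t, 0 ≤ kin ψ ε (T / 2) t := fun t => intervalIntegral.integral_nonneg hεT
    fun r hr => by have : 0 ≤ r := hε.le.trans hr.1; positivity
  obtain ⟨t, ht, hmax⟩ := (isCompact_Icc (a := T) (b := 2 * T)).exists_isMaxOn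
    (nonempty_Icc.2 (by linarith)) (f := fun x => (∫ s in T..x, kin ψ ε (T / 2) s) - η * x)
    (fun x hx => ((hd x (hT.trans_le hx.1)).continuousAt.sub (by fun_prop)).continuousWithinAt)
  have ht0 : 0 < t := hT.trans_le ht.1
  have hG : ∫ s in T..t, kin ψ ε (T / 2) s ≤ η / 2 * T := by
    have h1 := intervalIntegral.integral_add_adjacent_intervals
      (W.intervalIntegrable_kin hε (half_pos hT) hT ht0)
      (W.intervalIntegrable_kin hε (half_pos hT) ht0 (show 0 < 2 * T by linarith))
    have h2 : 0 ≤ ∫ s in t..2 * T, kin ψ ε (T / 2) s :=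
      intervalIntegral.integral_nonneg ht.2 fun s _ => hk0 s
    linarith
  have ht2 : t ≤ 3 * T / 2 := by
    have h1 := hmax (left_mem_Icc.2 (by linarith : T ≤ 2 * T))
    simp only [mem_ofPred_eq, intervalIntegral.integral_same] at h1
    nlinarith
  refine ⟨t, ⟨ht.1, ht2⟩, fun h hh0 hh => ?_⟩
  have h1 := hmax (show t + h ∈ Icc T (2 * T) from ⟨by linarith [ht.1], by linarith⟩)
  have h2 := intervalIntegral.integral_add_adjacent_intervals
    (W.intervalIntegrable_kin hε (half_pos hT) hT ht0)
    (W.intervalIntegrable_kin hε (half_pos hT) ht0 (show 0 < t + h by linarith))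
  simp only [mem_ofPred_eq] at h1
  linarith

/-- Selection of a time from which the kinetic energy density stays small on average. -/
theorem exists_good_time (W : WaveMapEnergyLE ψ E)
    (h0 : ∀ t, 0 < t → Tendsto (ψ t) (nhdsWithin 0 (Ioi 0)) (nhds 0)) {η : ℝ} (hη : 0 < η) :
    ∃ T₀, 1 ≤ T₀ ∧ ∀ T, T₀ ≤ T → ∃ t ∈ Icc T (3 * T / 2), ∀ h ε, 0 ≤ h → h ≤ T / 2 → 0 < ε →
      ε ≤ T / 2 → ∫ s in t..t + h, kin ψ ε (T / 2) s ≤ η * h := by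
  obtain ⟨T₀, hT₀, hvir⟩ := W.integral_kin_le h0 (half_pos hη)
  refine ⟨T₀, hT₀, fun T hT => ?_⟩
  have hT0 : 0 < T := by linarith
  have hε : ∀ n : ℕ, 0 < T / 2 * (1 / ((n : ℝ) + 1)) := fun n => by positivity
  have hεT : ∀ n : ℕ, T / 2 * (1 / ((n : ℝ) + 1)) ≤ T / 2 := fun n => by
    refine mul_le_of_le_one_right (by positivity) ?_
    rw [div_le_one (by positivity)]
    have : (0 : ℝ) ≤ n := n.cast_nonneg
    linarith
  choose t ht1 ht2 using fun n : ℕ =>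
    W.exists_good_time_aux hη hT0 (hε n) (hvir T _ hT (hε n) (hεT n)) (hεT n)
  obtain ⟨t', ht', φ, hφ, hlim⟩ := isCompact_Icc.tendsto_subseq ht1
  refine ⟨t', ht', fun h ε hh0 hh hε0 hεT' => ?_⟩
  have ht'0 : 0 < t' := hT0.trans_le ht'.1
  have hT2 : 0 < T / 2 := half_pos hT0
  have hF : ∀ x, 0 < x → ContinuousAt (fun x => ∫ s in T..x, kin ψ ε (T / 2) s) x :=
    fun x hx => (W.hasDerivAt_integral_kin hε0 hT2 hT0 hx).continuousAt
  have hsplit : ∀ x, 0 < x → ∫ s in x..x + h, kin ψ ε (T / 2) s =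
      (∫ s in T..x + h, kin ψ ε (T / 2) s) - ∫ s in T..x, kin ψ ε (T / 2) s := fun x hx => by
    have := intervalIntegral.integral_add_adjacent_intervals
      (W.intervalIntegrable_kin hε0 hT2 hT0 hx)
      (W.intervalIntegrable_kin hε0 hT2 hx (show 0 < x + h by linarith))
    linarith
  have hlim1 := ((hF (t' + h) (by linarith)).tendsto.comp (hlim.add_const h)).sub
    ((hF t' ht'0).tendsto.comp hlim)
  rw [hsplit t' ht'0]
  refine le_of_tendsto hlim1 ?_
  have hsmall : Tendsto (fun n : ℕ => T / 2 * (1 / ((φ n : ℝ) + 1))) atTop (nhds 0) := by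
    have := (tendsto_one_div_add_atTop_nhds_zero_nat (𝕜 := ℝ)).const_mul (T / 2)
    rw [mul_zero] at this
    exact this.comp hφ.tendsto_atTop
  filter_upwards [hsmall.eventually_le_const hε0] with n hn
  have htn0 : 0 < t (φ n) := hT0.trans_le (ht1 (φ n)).1
  have h1 := ht2 (φ n) h hh0 hh
  have h2 := W.integral_kin_mono htn0 (show t (φ n) ≤ t (φ n) + h by linarith) (hε (φ n)) hn hεT'
    le_rfl
  rw [hsplit _ htn0] at h2
  exact h2.trans h1

/-- The first radius at which a map of positive degree meets the equator. -/
theorem exists_first_radius {f : ℝ → ℝ} {c m : ℝ} (hf : ContinuousOn f (Ioi 0))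
    (h0 : Tendsto f (nhdsWithin 0 (Ioi 0)) (nhds 0)) (hinf : Tendsto f atTop (nhds m))
    (hc : 0 < c) (hcm : c < m) :
    ∃ l, 0 < l ∧ f l = c ∧ ∀ r, 0 < r → r < l → f r < c := by
  obtain ⟨ε, hε, hεs⟩ := mem_nhdsGT_iff_exists_Ioo_subset.1 (h0.eventually_lt_const hc)
  have hε0 : (0 : ℝ) < ε := hε
  obtain ⟨R, hR, hR0⟩ := ((hinf.eventually_const_lt hcm).and (eventually_ge_atTop ε)).exists
  obtain ⟨S, hS⟩ : ∃ S, S = Ici ε ∩ f ⁻¹' Ici c := ⟨_, rfl⟩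
  have hcl : IsClosed S := hS ▸ (hf.mono fun x hx => hε0.trans_le hx).preimage_isClosed_of_isClosed
    isClosed_Ici isClosed_Ici
  have hne : S.Nonempty := ⟨R, by rw [hS]; exact ⟨hR0, hR.le⟩⟩
  have hbd : BddBelow S := ⟨ε, fun x hx => by rw [hS] at hx; exact hx.1⟩
  have hmem := hcl.csInf_mem hne hbd
  obtain ⟨l, hl⟩ : ∃ l, l = sInf S := ⟨_, rfl⟩
  rw [← hl, hS] at hmem
  have hl0 : 0 < l := hε0.trans_le hmem.1
  have hlt : ∀ r, 0 < r → r < l → f r < c := fun r hr0 hr => by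
    by_contra! hfr
    rcases lt_or_ge r ε with h | h
    · exact absurd (hεs ⟨hr0, h⟩) (not_lt.2 hfr)
    · exact absurd (csInf_le hbd (show r ∈ S by rw [hS]; exact ⟨h, hfr⟩)) (not_le.2 (hl ▸ hr))
  refine ⟨l, hl0, le_antisymm ?_ hmem.2, hlt⟩
  have hcont : Tendsto f (nhdsWithin l (Iio l)) (nhds (f l)) :=
    (hf.continuousAt (Ioi_mem_nhds hl0)).tendsto.mono_left nhdsWithin_le_nhds
  refine le_of_tendsto hcont ?_
  filter_upwards [self_mem_nhdsWithin, mem_nhdsWithin_of_mem_nhds (Ioi_mem_nhds hl0)] with r h1 h2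
  exact (hlt r h2 h1).le

/-- Selection of a concentration time and a concentration scale. -/
theorem exists_concentration (W : WaveMapEnergyLE ψ E) {k : ℤ} (hk : 1 ≤ k)
    (h0 : ∀ t, 0 < t → Tendsto (ψ t) (nhdsWithin 0 (Ioi 0)) (nhds 0))
    (hlim : ∀ t, 0 < t → Tendsto (ψ t) atTop (nhds (k * π))) {η : ℝ} (hη : 0 < η) (T₀ : ℝ) :
    ∃ t l, T₀ ≤ t ∧ 1 ≤ t ∧ 0 < l ∧ l ≤ η * t ∧ ψ t l = π / 2 ∧
      (∀ r, 0 < r → r < l → ψ t r < π / 2) ∧ ∀ h ε, 0 ≤ h → h ≤ t / 3 → 0 < ε → ε ≤ t / 3 →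
        ∫ s in t..t + h, kin ψ ε (t / 3) s ≤ η * h := by
  obtain ⟨T₁, hT₁, h1⟩ := W.exists_good_time h0 hη
  obtain ⟨T₂, hT₂, h2⟩ := W.eventually_cos_ne_zero hlim (l := min η (1 / 2)) (by positivity)
    ((min_le_right _ _).trans_lt (by norm_num))
  obtain ⟨t, ht, h3⟩ := h1 (max T₁ (max T₂ T₀)) (le_max_left _ _)
  obtain ⟨T, hT⟩ : ∃ T, T = max T₁ (max T₂ T₀) := ⟨_, rfl⟩
  rw [← hT] at ht h3
  have hTT₁ : T₁ ≤ T := hT ▸ le_max_left _ _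
  have hTT₂ : T₂ ≤ T := hT ▸ (le_max_left _ _).trans (le_max_right _ _)
  have hTT₀ : T₀ ≤ T := hT ▸ (le_max_right _ _).trans (le_max_right _ _)
  have ht0 : 0 < t := by linarith [ht.1]
  have hk' : (1 : ℝ) ≤ k := by exact_mod_cast hk
  obtain ⟨l, hl0, hl1, hl2⟩ := exists_first_radius
    (continuousOn_prod_left W.smoothOn.continuousOn (mem_Ioi.2 ht0)) (h0 t ht0) (hlim t ht0)
    (c := π / 2) (by positivity) (by nlinarith [pi_pos])
  refine ⟨t, l, hTT₀.trans ht.1, by linarith [ht.1], hl0, ?_, hl1, hl2, ?_⟩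
  · by_contra! hlt
    refine h2 t l (hTT₂.trans ht.1) ?_ (by rw [hl1, cos_pi_div_two])
    exact (mul_le_mul_of_nonneg_right (min_le_left _ _) ht0.le).trans hlt.le
  · intro h ε hh0 hh hε hεt
    have ht3 : t / 3 ≤ T / 2 := by linarith [ht.2]
    exact (W.integral_kin_mono ht0 (by linarith) hε le_rfl hεt ht3).trans
      (h3 h ε hh0 (hh.trans ht3) hε (hεt.trans ht3))

end WaveMapEnergyLE

/-- A normalized polynomial cutoff on `[0, 3]`, vanishing to second order at the endpoints. -/
def cutoff (t : ℝ) : ℝ := 10 / 81 * (t ^ 2 * (3 - t) ^ 2)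

/-- First derivative of `cutoff`. -/
def cutoffDeriv (t : ℝ) : ℝ := 10 / 81 * (4 * t ^ 3 - 18 * t ^ 2 + 18 * t)

/-- Second derivative of `cutoff`. -/
def cutoffDeriv2 (t : ℝ) : ℝ := 10 / 81 * (12 * t ^ 2 - 36 * t + 18)

/-- Weighted time average over `[0, 3]`. -/
def avg (F : ℝ → ℝ) : ℝ := ∫ t in (0 : ℝ)..3, cutoff t * F t

theorem hasDerivAt_cutoff (t : ℝ) : HasDerivAt cutoff (cutoffDeriv t) t := by
  have h := (((hasDerivAt_id t).fun_pow 2).mul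
    (((hasDerivAt_const t 3).sub (hasDerivAt_id t)).fun_pow 2)).const_mul (10 / 81)
  refine h.congr_deriv ?_
  simp [cutoffDeriv]
  ring

theorem hasDerivAt_cutoffDeriv (t : ℝ) : HasDerivAt cutoffDeriv (cutoffDeriv2 t) t := by
  have h := (((((hasDerivAt_id t).fun_pow 3).const_mul 4).sub
    (((hasDerivAt_id t).fun_pow 2).const_mul 18)).add
      ((hasDerivAt_id t).const_mul 18)).const_mul (10 / 81)
  refine h.congr_deriv ?_
  simp [cutoffDeriv2]
  ring

@[fun_prop]
theorem continuous_cutoff : Continuous cutoff :=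
  continuous_iff_continuousAt.2 fun t => (hasDerivAt_cutoff t).continuousAt

@[fun_prop]
theorem continuous_cutoffDeriv : Continuous cutoffDeriv :=
  continuous_iff_continuousAt.2 fun t => (hasDerivAt_cutoffDeriv t).continuousAt

@[fun_prop]
theorem continuous_cutoffDeriv2 : Continuous cutoffDeriv2 := by
  unfold cutoffDeriv2; fun_prop

theorem cutoff_nonneg (t : ℝ) : 0 ≤ cutoff t := by unfold cutoff; positivity

theorem cutoff_le_one {t : ℝ} (ht : t ∈ Icc (0 : ℝ) 3) : cutoff t ≤ 1 := by
  have h1 : t * (3 - t) ≤ 9 / 4 := by nlinarith [sq_nonneg (t - 3 / 2)]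
  have h0 : 0 ≤ t * (3 - t) := mul_nonneg ht.1 (by linarith [ht.2])
  unfold cutoff
  nlinarith

theorem le_cutoff {t : ℝ} (ht : t ∈ Icc (1 : ℝ) 2) : 40 / 81 ≤ cutoff t := by
  have h1 : 2 ≤ t * (3 - t) := by nlinarith [ht.1, ht.2]
  unfold cutoff
  nlinarith

theorem abs_cutoffDeriv_le {t : ℝ} (ht : t ∈ Icc (0 : ℝ) 3) : |cutoffDeriv t| ≤ 2 := by
  have h0 : 0 ≤ t * (3 - t) := mul_nonneg ht.1 (by linarith [ht.2])
  have h1 : t * (3 - t) ≤ 9 / 4 := by nlinarith [sq_nonneg (t - 3 / 2)]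
  have e : cutoffDeriv t = 20 / 81 * ((t * (3 - t)) * (3 - 2 * t)) := by unfold cutoffDeriv; ring
  rw [e, abs_mul, abs_mul, abs_of_nonneg h0, abs_of_pos (by norm_num : (0 : ℝ) < 20 / 81)]
  have h2 : |3 - 2 * t| ≤ 3 := by rw [abs_le]; constructor <;> linarith [ht.1, ht.2]
  have := mul_le_mul h1 h2 (abs_nonneg _) (by norm_num)
  linarith

theorem abs_cutoffDeriv2_le {t : ℝ} (ht : t ∈ Icc (0 : ℝ) 3) : |cutoffDeriv2 t| ≤ 3 := by
  have h0 : 0 ≤ t * (3 - t) := mul_nonneg ht.1 (by linarith [ht.2])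
  have h1 : t * (3 - t) ≤ 9 / 4 := by nlinarith [sq_nonneg (t - 3 / 2)]
  unfold cutoffDeriv2
  rw [abs_le]
  constructor <;> nlinarith

theorem integral_cutoff : ∫ t in (0 : ℝ)..3, cutoff t = 1 := by
  have h := intervalIntegral.integral_eq_sub_of_hasDerivAt (a := 0) (b := 3)
    (f := fun t : ℝ => 10 / 81 * (t ^ 5 / 5 - 6 * t ^ 4 / 4 + 9 * t ^ 3 / 3)) (f' := cutoff)
    (fun t _ => by
      have h := (((((hasDerivAt_id t).fun_pow 5).div_const 5).sub
        ((((hasDerivAt_id t).fun_pow 4).const_mul 6).div_const 4)).add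
        ((((hasDerivAt_id t).fun_pow 3).const_mul 9).div_const 3)).const_mul (10 / 81)
      refine h.congr_deriv ?_
      simp [cutoff]
      ring) (continuous_cutoff.intervalIntegrable _ _)
  rw [h]; norm_num

theorem intervalIntegrable_of_continuousOn_Icc {F : ℝ → ℝ} {a b : ℝ} (hab : a ≤ b)
    (hF : ContinuousOn F (Icc a b)) : IntervalIntegrable F volume a b :=
  ContinuousOn.intervalIntegrable (by rwa [uIcc_of_le hab])

theorem intervalIntegrable_cutoff_mul {F : ℝ → ℝ} (hF : ContinuousOn F (Icc 0 3)) :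
    IntervalIntegrable (fun t => cutoff t * F t) volume 0 3 :=
  intervalIntegrable_of_continuousOn_Icc (by norm_num) (by fun_prop)

theorem avg_const (c : ℝ) : avg (fun _ => c) = c := by
  simp [avg, integral_cutoff]

theorem avg_add {F G : ℝ → ℝ} (hF : ContinuousOn F (Icc 0 3)) (hG : ContinuousOn G (Icc 0 3)) :
    avg (fun t => F t + G t) = avg F + avg G := by
  unfold avg
  rw [← intervalIntegral.integral_add (intervalIntegrable_cutoff_mul hF)
    (intervalIntegrable_cutoff_mul hG)]
  simp only [mul_add]

theorem avg_sub {F G : ℝ → ℝ} (hF : ContinuousOn F (Icc 0 3)) (hG : ContinuousOn G (Icc 0 3)) :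
    avg (fun t => F t - G t) = avg F - avg G := by
  unfold avg
  rw [← intervalIntegral.integral_sub (intervalIntegrable_cutoff_mul hF)
    (intervalIntegrable_cutoff_mul hG)]
  simp only [mul_sub]

theorem avg_const_mul (c : ℝ) (F : ℝ → ℝ) : avg (fun t => c * F t) = c * avg F := by
  unfold avg
  rw [← intervalIntegral.integral_const_mul]
  simp only [mul_left_comm]

theorem avg_mono {F G : ℝ → ℝ} (hF : ContinuousOn F (Icc 0 3)) (hG : ContinuousOn G (Icc 0 3))
    (h : ∀ t ∈ Icc (0 : ℝ) 3, F t ≤ G t) : avg F ≤ avg G :=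
  intervalIntegral.integral_mono_on (by norm_num) (intervalIntegrable_cutoff_mul hF)
    (intervalIntegrable_cutoff_mul hG) fun t ht =>
      mul_le_mul_of_nonneg_left (h t ht) (cutoff_nonneg t)

theorem abs_avg_le {F : ℝ → ℝ} {M : ℝ} (hF : ContinuousOn F (Icc 0 3))
    (h : ∀ t ∈ Icc (0 : ℝ) 3, |F t| ≤ M) : |avg F| ≤ M := by
  rw [abs_le]
  have h1 := avg_mono hF (continuousOn_const (c := M)) fun t ht => (abs_le.1 (h t ht)).2
  have h2 := avg_mono (continuousOn_const (c := -M)) hF fun t ht => (abs_le.1 (h t ht)).1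
  rw [avg_const] at h1 h2
  exact ⟨h2, h1⟩

theorem avg_nonneg {F : ℝ → ℝ} (h : ∀ t ∈ Icc (0 : ℝ) 3, 0 ≤ F t) : 0 ≤ avg F :=
  intervalIntegral.integral_nonneg (by norm_num) fun t ht => mul_nonneg (cutoff_nonneg t) (h t ht)

theorem avg_le_integral {F : ℝ → ℝ} (hF : ContinuousOn F (Icc 0 3))
    (h : ∀ t ∈ Icc (0 : ℝ) 3, 0 ≤ F t) : avg F ≤ ∫ t in (0 : ℝ)..3, F t :=
  intervalIntegral.integral_mono_on (by norm_num) (intervalIntegrable_cutoff_mul hF)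
    (intervalIntegrable_of_continuousOn_Icc (by norm_num) hF) fun t ht =>
      mul_le_of_le_one_left (h t ht) (cutoff_le_one ht)

theorem integral_le_avg {F : ℝ → ℝ} (hF : ContinuousOn F (Icc 0 3))
    (h : ∀ t ∈ Icc (0 : ℝ) 3, 0 ≤ F t) : ∫ t in (1 : ℝ)..2, F t ≤ 81 / 40 * avg F := by
  have hs : Icc (1 : ℝ) 2 ⊆ Icc 0 3 := Icc_subset_Icc (by norm_num) (by norm_num)
  have i2 : IntervalIntegrable (fun t => cutoff t * F t) volume 1 2 :=
    intervalIntegrable_of_continuousOn_Icc (by norm_num) (by have := hF.mono hs; fun_prop)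
  have h1 : ∫ t in (1 : ℝ)..2, F t ≤ ∫ t in (1 : ℝ)..2, 81 / 40 * (cutoff t * F t) :=
    intervalIntegral.integral_mono_on (by norm_num)
      (intervalIntegrable_of_continuousOn_Icc (by norm_num) (hF.mono hs)) (i2.const_mul _)
      fun t ht => by nlinarith [le_cutoff ht, h t (hs ht)]
  rw [intervalIntegral.integral_const_mul] at h1
  refine h1.trans (mul_le_mul_of_nonneg_left ?_ (by norm_num))
  refine intervalIntegral.integral_mono_interval (by norm_num) (by norm_num) (by norm_num) ?_
    (intervalIntegrable_cutoff_mul hF)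
  filter_upwards [ae_restrict_mem measurableSet_Ioc] with t ht
  exact mul_nonneg (cutoff_nonneg t) (h t (Ioc_subset_Icc_self ht))

theorem avg_sub_avg_sq {F : ℝ → ℝ} (hF : ContinuousOn F (Icc 0 3)) :
    avg (fun t => (F t - avg F) ^ 2) = avg (fun t => F t ^ 2) - avg F ^ 2 := by
  have h : (fun t => (F t - avg F) ^ 2) =
      fun t => (F t ^ 2 - 2 * avg F * F t) + avg F ^ 2 := by funext t; ring
  rw [h, avg_add (by fun_prop) (by fun_prop), avg_sub (by fun_prop) (by fun_prop), avg_const,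
    avg_const_mul]
  ring

theorem avg_sq_le {F : ℝ → ℝ} (hF : ContinuousOn F (Icc 0 3)) :
    avg F ^ 2 ≤ avg (fun t => F t ^ 2) := by
  have h := avg_sub_avg_sq hF
  have h1 : 0 ≤ avg (fun t => (F t - avg F) ^ 2) := avg_nonneg fun t _ => sq_nonneg _
  linarith

/-- The domain of wave maps in logarithmic radial coordinates. -/
abbrev strip : Set (ℝ × ℝ) := Ioi (-1) ×ˢ univ

theorem Icc_subset_Ioi_neg_one : Icc (0 : ℝ) 3 ⊆ Ioi (-1) := fun t ht =>
  lt_of_lt_of_le (by norm_num) ht.1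

namespace SmoothOn

variable {F : ℝ → ℝ → ℝ}

theorem continuousOn_time (h : SmoothOn F strip) (s : ℝ) :
    ContinuousOn (fun t => F t s) (Icc 0 3) :=
  (continuousOn_prod_right h.continuousOn (mem_univ s)).mono Icc_subset_Ioi_neg_one

theorem continuous_space (h : SmoothOn F strip) {t : ℝ} (ht : t ∈ Icc (0 : ℝ) 3) :
    Continuous (F t) :=
  continuousOn_univ.1 (continuousOn_prod_left h.continuousOn (Icc_subset_Ioi_neg_one ht))

theorem continuousOn_swap (h : SmoothOn F strip) :
    ContinuousOn (fun p : ℝ × ℝ => F p.2 p.1) (univ ×ˢ uIcc 0 3) := by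
  rw [uIcc_of_le (by norm_num)]
  exact h.continuousOn.comp (f := fun p : ℝ × ℝ => (p.2, p.1)) (by fun_prop)
    fun p hp => ⟨Icc_subset_Ioi_neg_one hp.2, mem_univ _⟩

theorem hasDerivAt_avg (h : SmoothOn F strip) (s : ℝ) :
    HasDerivAt (fun s => avg fun t => F t s) (avg fun t => pR F t s) s := by
  have h1 := h.continuousOn_swap
  have h2 := h.smoothOn_pR.continuousOn_swap
  refine hasDerivAt_intervalIntegral_of_continuousOn (f := fun s t => cutoff t * F t s)
    (f' := fun s t => cutoff t * pR F t s) isOpen_univ (mem_univ s)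
    ((continuous_cutoff.comp continuous_snd).continuousOn.mul h1)
    ((continuous_cutoff.comp continuous_snd).continuousOn.mul h2)
    fun s _ t ht => (h.hasDerivAt_pR ⟨Icc_subset_Ioi_neg_one ?_, mem_univ _⟩).const_mul _
  rwa [uIcc_of_le (by norm_num)] at ht

theorem continuous_avg (h : SmoothOn F strip) : Continuous fun s => avg fun t => F t s :=
  continuous_iff_continuousAt.2 fun s => (h.hasDerivAt_avg s).continuousAt

theorem continuous_integral_time (h : SmoothOn F strip) :
    Continuous fun s => ∫ t in (0 : ℝ)..3, F t s :=
  continuousOn_univ.1 (continuousOn_intervalIntegral (f := fun s t => F t s) isOpen_univ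
    h.continuousOn_swap)

theorem continuousOn_integral_space (h : SmoothOn F strip) (a b : ℝ) :
    ContinuousOn (fun t => ∫ s in a..b, F t s) (Icc 0 3) :=
  (continuousOn_intervalIntegral isOpen_Ioi
    (h.continuousOn.mono (prod_mono Subset.rfl (subset_univ _)))).mono Icc_subset_Ioi_neg_one

theorem integral_swap (h : SmoothOn F strip) (a b : ℝ) :
    ∫ s in a..b, ∫ t in (0 : ℝ)..3, F t s = ∫ t in (0 : ℝ)..3, ∫ s in a..b, F t s :=
  integral_integral_swap_of_continuousOn (f := fun s t => F t s)
    (h.continuousOn_swap.mono (prod_mono (subset_univ _) Subset.rfl))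

theorem integral_avg_swap (h : SmoothOn F strip) (a b : ℝ) :
    ∫ s in a..b, avg (fun t => F t s) = avg fun t => ∫ s in a..b, F t s := by
  unfold avg
  have h1 := h.continuousOn_swap
  rw [integral_integral_swap_of_continuousOn (f := fun s t => cutoff t * F t s)
    (((continuous_cutoff.comp continuous_snd).continuousOn.mul h1).mono
      (prod_mono (subset_univ _) Subset.rfl))]
  simp only [intervalIntegral.integral_const_mul]

end SmoothOn

/-- A wave map in the logarithmic radial coordinate `s = log r`, whose spatial energy is at
most `E`. -/
structure LogWave (u : ℝ → ℝ → ℝ) (E : ℝ) : Prop where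
  smoothOn : SmoothOn u strip
  eqn : ∀ t s, -1 < t →
    exp s ^ 2 * pT (pT u) t s = pR (pR u) t s - sin (2 * u t s) / 2
  energy_le : ∀ t a b, -1 < t → a ≤ b → ∫ s in a..b, (pR u t s ^ 2 + sin (u t s) ^ 2) ≤ E

/-- Space-time kinetic energy on `[0, 3] × [a, b]`. -/
def kinST (u : ℝ → ℝ → ℝ) (a b : ℝ) : ℝ := ∫ t in (0 : ℝ)..3, ∫ s in a..b, pT u t s ^ 2

theorem SmoothOn.sq {F : ℝ → ℝ → ℝ} {D : Set (ℝ × ℝ)} (h : SmoothOn F D) :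
    SmoothOn (fun t s => F t s ^ 2) D := ⟨h.isOpen, h.contDiffOn.pow 2⟩

theorem SmoothOn.mul {F G : ℝ → ℝ → ℝ} {D : Set (ℝ × ℝ)} (h : SmoothOn F D) (h' : SmoothOn G D) :
    SmoothOn (fun t s => F t s * G t s) D := ⟨h.isOpen, h.contDiffOn.mul h'.contDiffOn⟩

theorem SmoothOn.sin {F : ℝ → ℝ → ℝ} {D : Set (ℝ × ℝ)} (h : SmoothOn F D) :
    SmoothOn (fun t s => Real.sin (F t s)) D := ⟨h.isOpen, h.contDiffOn.sin⟩

theorem SmoothOn.add {F G : ℝ → ℝ → ℝ} {D : Set (ℝ × ℝ)} (h : SmoothOn F D) (h' : SmoothOn G D) :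
    SmoothOn (fun t s => F t s + G t s) D := ⟨h.isOpen, h.contDiffOn.add h'.contDiffOn⟩

theorem SmoothOn.sub {F G : ℝ → ℝ → ℝ} {D : Set (ℝ × ℝ)} (h : SmoothOn F D) (h' : SmoothOn G D) :
    SmoothOn (fun t s => F t s - G t s) D := ⟨h.isOpen, h.contDiffOn.sub h'.contDiffOn⟩

theorem kinST_nonneg (u : ℝ → ℝ → ℝ) {a b : ℝ} (hab : a ≤ b) : 0 ≤ kinST u a b :=
  intervalIntegral.integral_nonneg (by norm_num) fun _ _ =>
    intervalIntegral.integral_nonneg hab fun _ _ => sq_nonneg _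

theorem abs_le_mul_sq_add (x : ℝ) {ω : ℝ} (hω : 0 < ω) : |x| ≤ ω * x ^ 2 + 1 / (4 * ω) := by
  have h : 0 ≤ (2 * ω * |x| - 1) ^ 2 / (4 * ω) := by positivity
  have h' : (2 * ω * |x| - 1) ^ 2 / (4 * ω) = ω * |x| ^ 2 - |x| + 1 / (4 * ω) := by
    field_simp; ring
  rw [sq_abs] at h'
  linarith

namespace LogWave

variable {u : ℝ → ℝ → ℝ} {E : ℝ}

theorem integral_pR_sq_le (W : LogWave u E) {t a b : ℝ} (ht : t ∈ Icc (0 : ℝ) 3) (hab : a ≤ b) :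
    ∫ s in a..b, pR u t s ^ 2 ≤ E := by
  have c1 := W.smoothOn.continuous_space ht
  have c2 := W.smoothOn.smoothOn_pR.continuous_space ht
  refine le_trans (intervalIntegral.integral_mono_on hab ?_ ?_ fun s _ => ?_)
    (W.energy_le t a b (Icc_subset_Ioi_neg_one ht) hab)
  · exact (by fun_prop : Continuous fun s => pR u t s ^ 2).intervalIntegrable _ _
  · exact (by fun_prop : Continuous fun s => pR u t s ^ 2 + sin (u t s) ^ 2).intervalIntegrable _ _
  · linarith [sq_nonneg (sin (u t s))]

theorem abs_sub_le_space (W : LogWave u E) {t a b ω : ℝ} (ht : t ∈ Icc (0 : ℝ) 3) (hab : a ≤ b)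
    (hω : 0 < ω) : |u t b - u t a| ≤ ω * E + (b - a) / (4 * ω) := by
  have c2 := W.smoothOn.smoothOn_pR.continuous_space ht
  have h1 := intervalIntegral.integral_eq_sub_of_hasDerivAt (a := a) (b := b) (f := u t)
    (fun s _ => W.smoothOn.hasDerivAt_pR (t := t) ⟨Icc_subset_Ioi_neg_one ht, mem_univ _⟩)
    (c2.intervalIntegrable _ _)
  rw [← h1]
  have i1 : IntervalIntegrable (fun s => ω * pR u t s ^ 2) volume a b :=
    (by fun_prop : Continuous fun s => ω * pR u t s ^ 2).intervalIntegrable _ _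
  have h2 := intervalIntegral.norm_integral_le_of_norm_le (μ := volume) (f := pR u t) hab
    (Eventually.of_forall fun s _ => abs_le_mul_sq_add (pR u t s) hω)
    (i1.add intervalIntegrable_const)
  rw [intervalIntegral.integral_add i1 intervalIntegrable_const,
    intervalIntegral.integral_const_mul, intervalIntegral.integral_const, smul_eq_mul,
    mul_one_div] at h2
  exact h2.trans (by
    have := mul_le_mul_of_nonneg_left (W.integral_pR_sq_le ht hab) hω.le
    linarith)

theorem abs_sub_initial_le_integral (W : LogWave u E) {t A : ℝ} (s : ℝ) (ht : t ∈ Icc (0 : ℝ) 3)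
    (hA : 0 < A) :
    |u t s - u 0 s| ≤ ∫ τ in (0 : ℝ)..3, (A * pT u τ s ^ 2 + 1 / (4 * A)) := by
  have c := W.smoothOn.smoothOn_pT.continuousOn_time s
  have hs : Icc 0 t ⊆ Icc (0 : ℝ) 3 := Icc_subset_Icc le_rfl ht.2
  have i3 : IntervalIntegrable (fun τ => A * pT u τ s ^ 2 + 1 / (4 * A)) volume 0 3 :=
    intervalIntegrable_of_continuousOn_Icc (by norm_num) (by fun_prop)
  have h1 := intervalIntegral.integral_eq_sub_of_hasDerivAt (a := 0) (b := t)
    (f := fun τ => u τ s) (f' := fun τ => pT u τ s)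
    (fun τ hτ => W.smoothOn.hasDerivAt_pT ⟨Icc_subset_Ioi_neg_one (hs (by
      rwa [uIcc_of_le ht.1] at hτ)), mem_univ _⟩)
    (intervalIntegrable_of_continuousOn_Icc ht.1 (c.mono hs))
  rw [← h1]
  refine (intervalIntegral.norm_integral_le_of_norm_le (μ := volume)
    (f := fun τ => pT u τ s) ht.1 (Eventually.of_forall fun τ _ => abs_le_mul_sq_add (pT u τ s) hA)
    (i3.mono_set (uIcc_subset_uIcc left_mem_uIcc (by
      rw [uIcc_of_le (by norm_num)]
      exact ht)))).trans ?_
  refine intervalIntegral.integral_mono_interval le_rfl ht.1 ht.2 ?_ i3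
  exact Eventually.of_forall fun τ => by
    show 0 ≤ A * pT u τ s ^ 2 + 1 / (4 * A)
    positivity

/-- Small kinetic energy forces the map to be almost constant in time. -/
theorem abs_sub_initial_le (W : LogWave u E) {t s L δ ω A : ℝ} (ht : t ∈ Icc (0 : ℝ) 3)
    (hs : s ∈ Icc (-L) L) (hδ : 0 < δ) (hδ1 : δ ≤ 1) (hω : 0 < ω) (hA : 0 < A) :
    |u t s - u 0 s| ≤
      2 * (ω * E + δ / (4 * ω)) + (A * kinST u (-(L + 1)) (L + 1) / δ + 3 / (4 * A)) := by
  obtain ⟨G, hG⟩ : ∃ G : ℝ → ℝ, G = fun σ => ∫ τ in (0 : ℝ)..3, pT u τ σ ^ 2 := ⟨_, rfl⟩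
  have cG : Continuous G := hG ▸ W.smoothOn.smoothOn_pT.sq.continuous_integral_time
  have hle : s ≤ s + δ := by linarith
  have h1 : ∀ σ ∈ Icc s (s + δ), |u t s - u 0 s| ≤
      A * G σ + (3 / (4 * A) + 2 * (ω * E + δ / (4 * ω))) := by
    intro σ hσ
    have h0 := W.abs_sub_initial_le_integral σ ht hA
    have c := W.smoothOn.smoothOn_pT.continuousOn_time σ
    rw [intervalIntegral.integral_add
      (intervalIntegrable_of_continuousOn_Icc (by norm_num) (by fun_prop))
      intervalIntegrable_const, intervalIntegral.integral_const_mul,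
      intervalIntegral.integral_const, smul_eq_mul] at h0
    have h2 := W.abs_sub_le_space ht hσ.1 hω
    have h3 := W.abs_sub_le_space (left_mem_Icc.2 (by norm_num : (0 : ℝ) ≤ 3)) hσ.1 hω
    have h4 : (σ - s) / (4 * ω) ≤ δ / (4 * ω) := by gcongr; linarith [hσ.2]
    have h5 : |u t s - u 0 s| ≤ |u t σ - u 0 σ| + (|u t σ - u t s| + |u 0 σ - u 0 s|) := by
      have e : u t s - u 0 s = (u t σ - u 0 σ) + (-(u t σ - u t s) + (u 0 σ - u 0 s)) := by ring
      rw [e]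
      refine (abs_add_le _ _).trans (add_le_add_right ((abs_add_le _ _).trans ?_) _)
      rw [abs_neg]
    have e : G σ = ∫ τ in (0 : ℝ)..3, pT u τ σ ^ 2 := by rw [hG]
    rw [← e] at h0
    have e2 : (3 - 0) * (1 / (4 * A)) = 3 / (4 * A) := by ring
    linarith
  have i1 : IntervalIntegrable (fun σ => A * G σ) volume s (s + δ) :=
    (by fun_prop : Continuous fun σ => A * G σ).intervalIntegrable _ _
  have h2 := intervalIntegral.integral_mono_on hle
    (intervalIntegrable_const (c := |u t s - u 0 s|)) (i1.add intervalIntegrable_const) h1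
  rw [intervalIntegral.integral_add i1 intervalIntegrable_const,
    intervalIntegral.integral_const_mul, intervalIntegral.integral_const,
    intervalIntegral.integral_const, smul_eq_mul, smul_eq_mul, add_sub_cancel_left] at h2
  have h3 : ∫ σ in s..s + δ, G σ ≤ kinST u (-(L + 1)) (L + 1) := by
    unfold kinST
    rw [← W.smoothOn.smoothOn_pT.sq.integral_swap, ← hG]
    refine intervalIntegral.integral_mono_interval (by linarith [hs.1]) hle (by linarith [hs.2])
      ?_ (cG.intervalIntegrable _ _)
    exact Eventually.of_forall fun σ => hG ▸
      intervalIntegral.integral_nonneg (by norm_num) fun _ _ => sq_nonneg _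
  have h4 := mul_le_mul_of_nonneg_left h3 hA.le
  have h5 : A * kinST u (-(L + 1)) (L + 1) / δ * δ = A * kinST u (-(L + 1)) (L + 1) := by
    field_simp
  refine le_of_mul_le_mul_left ?_ hδ
  linarith

end LogWave

/-- Time average of a map. -/
def profile (u : ℝ → ℝ → ℝ) (s : ℝ) : ℝ := avg fun t => u t s

/-- Failure of the averaged map to be a harmonic map. -/
def profileError (u : ℝ → ℝ → ℝ) (s : ℝ) : ℝ :=
  profile (pR (pR u)) s - sin (2 * profile u s) / 2

/-- Pohozaev density of the averaged map. -/
def profilePohozaev (u : ℝ → ℝ → ℝ) (s : ℝ) : ℝ := profile (pR u) s ^ 2 - sin (profile u s) ^ 2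

/-- Averaged Pohozaev density. -/
def avgPohozaev (u : ℝ → ℝ → ℝ) (s : ℝ) : ℝ :=
  avg fun t => pR u t s ^ 2 - sin (u t s) ^ 2 + exp s ^ 2 * pT u t s ^ 2

theorem abs_sin_sq_sub_sin_sq_le (x y : ℝ) : |sin x ^ 2 - sin y ^ 2| ≤ 2 * |x - y| := by
  have e : sin x ^ 2 - sin y ^ 2 = (sin x + sin y) * (sin x - sin y) := by ring
  rw [e, abs_mul]
  refine mul_le_mul ?_ (abs_sin_sub_sin_le x y) (abs_nonneg _) (by norm_num)
  refine (abs_add_le _ _).trans ?_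
  linarith [abs_sin_le_one x, abs_sin_le_one y]

/-- A function with small oscillation on a long interval and bounded integral is small. -/
theorem abs_le_add_div_of_oscillation {F H : ℝ → ℝ} {s M δ C : ℝ} (hM : 0 < M) (hH : Continuous H)
    (hosc : ∀ σ ∈ Icc s (s + M), |F σ - F s| ≤ δ) (hFH : ∀ σ ∈ Icc s (s + M), |F σ| ≤ H σ)
    (hC : ∫ σ in s..s + M, H σ ≤ C) : |F s| ≤ δ + C / M := by
  have h := intervalIntegral.integral_mono_on (μ := volume) (by linarith : s ≤ s + M)
    (intervalIntegrable_const (c := |F s| - δ)) (hH.intervalIntegrable _ _) fun σ hσ => by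
      have h1 := abs_sub_abs_le_abs_sub (F s) (F σ)
      rw [abs_sub_comm] at h1
      linarith [hosc σ hσ, hFH σ hσ]
  rw [intervalIntegral.integral_const, smul_eq_mul, add_sub_cancel_left] at h
  have : |F s| - δ ≤ C / M := by rw [le_div_iff₀ hM]; linarith
  linarith

namespace LogWave

variable {u : ℝ → ℝ → ℝ} {E : ℝ}

theorem abs_profile_sub_le (W : LogWave u E) {s ε t : ℝ} (ht : t ∈ Icc (0 : ℝ) 3)
    (hd : ∀ t ∈ Icc (0 : ℝ) 3, |u t s - u 0 s| ≤ ε) : |profile u s - u t s| ≤ 2 * ε := by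
  have c := W.smoothOn.continuousOn_time s
  have h : profile u s - u t s = avg fun τ => u τ s - u t s := by
    rw [avg_sub c continuousOn_const, avg_const]; rfl
  rw [h]
  refine abs_avg_le (by fun_prop) fun τ hτ => ?_
  have h1 := hd τ hτ
  have h2 := hd t ht
  rw [abs_le] at *
  constructor <;> linarith

theorem avg_pT_pT (W : LogWave u E) (s : ℝ) :
    avg (fun t => pT (pT u) t s) = ∫ t in (0 : ℝ)..3, cutoffDeriv2 t * (u t s - u 0 s) := by
  have c := W.smoothOn.continuousOn_time s
  have c2 := W.smoothOn.smoothOn_pT.smoothOn_pT.continuousOn_time s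
  have i2 : IntervalIntegrable (fun t => cutoffDeriv2 t * (u t s - u 0 s)) volume 0 3 :=
    intervalIntegrable_of_continuousOn_Icc (by norm_num) (by fun_prop)
  have h := intervalIntegral.integral_eq_sub_of_hasDerivAt (a := 0) (b := 3)
    (f := fun t => cutoff t * pT u t s - cutoffDeriv t * (u t s - u 0 s))
    (f' := fun t => cutoff t * pT (pT u) t s - cutoffDeriv2 t * (u t s - u 0 s))
    (fun t ht => by
      rw [uIcc_of_le (by norm_num)] at ht
      have hp : (t, s) ∈ strip := ⟨Icc_subset_Ioi_neg_one ht, mem_univ _⟩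
      refine (((hasDerivAt_cutoff t).mul (W.smoothOn.smoothOn_pT.hasDerivAt_pT hp)).sub
        ((hasDerivAt_cutoffDeriv t).mul
          ((W.smoothOn.hasDerivAt_pT hp).sub_const (u 0 s)))).congr_deriv ?_
      ring) ((intervalIntegrable_cutoff_mul c2).sub i2)
  rw [intervalIntegral.integral_sub (intervalIntegrable_cutoff_mul c2) i2] at h
  norm_num [cutoff, cutoffDeriv] at h
  unfold avg cutoff
  linarith

theorem abs_profileError_le (W : LogWave u E) {s ε : ℝ}
    (hd : ∀ t ∈ Icc (0 : ℝ) 3, |u t s - u 0 s| ≤ ε) :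
    |profileError u s| ≤ (2 + 9 * exp s ^ 2) * ε := by
  have c := W.smoothOn.continuousOn_time s
  have c2 := W.smoothOn.smoothOn_pT.smoothOn_pT.continuousOn_time s
  have cs : ContinuousOn (fun t => sin (2 * u t s) / 2 - sin (2 * profile u s) / 2)
      (Icc 0 3) := by fun_prop
  have e : profileError u s = (avg fun t => sin (2 * u t s) / 2 - sin (2 * profile u s) / 2) +
      exp s ^ 2 * avg fun t => pT (pT u) t s := by
    rw [avg_sub (by fun_prop) (by fun_prop), avg_const, ← avg_const_mul]
    have e1 : profile (pR (pR u)) s =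
        avg fun t => sin (2 * u t s) / 2 + exp s ^ 2 * pT (pT u) t s := by
      refine intervalIntegral.integral_congr fun t ht => ?_
      rw [uIcc_of_le (by norm_num)] at ht
      simp only
      rw [W.eqn t s (Icc_subset_Ioi_neg_one ht)]
      ring
    rw [profileError, e1, avg_add (by fun_prop) (by fun_prop)]
    ring
  have h1 : |avg fun t => sin (2 * u t s) / 2 - sin (2 * profile u s) / 2| ≤ 2 * ε := by
    refine abs_avg_le cs fun t ht => ?_
    have h2 := abs_sin_sub_sin_le (2 * u t s) (2 * profile u s)
    have h3 := W.abs_profile_sub_le ht hd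
    rw [abs_sub_comm] at h3
    rw [← mul_sub, abs_mul, abs_two] at h2
    rw [← sub_div, abs_div, abs_two]
    linarith
  have h2 : |avg fun t => pT (pT u) t s| ≤ 9 * ε := by
    rw [W.avg_pT_pT]
    have := intervalIntegral.norm_integral_le_of_norm_le (μ := volume) (a := 0) (b := 3)
      (f := fun t => cutoffDeriv2 t * (u t s - u 0 s)) (g := fun _ => 3 * ε) (by norm_num)
      (Eventually.of_forall fun t ht => by
        rw [norm_mul]
        exact mul_le_mul (abs_cutoffDeriv2_le (Ioc_subset_Icc_self ht))
          (hd t (Ioc_subset_Icc_self ht)) (abs_nonneg _) (by norm_num)) intervalIntegrable_const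
    rw [intervalIntegral.integral_const, smul_eq_mul] at this
    exact this.trans (le_of_eq (by ring))
  rw [e]
  refine (abs_add_le _ _).trans ?_
  rw [abs_mul, abs_of_nonneg (sq_nonneg (exp s))]
  have := mul_le_mul_of_nonneg_left h2 (sq_nonneg (exp s))
  linarith

theorem hasDerivAt_profile (W : LogWave u E) (s : ℝ) :
    HasDerivAt (profile u) (profile (pR u) s) s := W.smoothOn.hasDerivAt_avg s

theorem hasDerivAt_profile_pR (W : LogWave u E) (s : ℝ) :
    HasDerivAt (profile (pR u)) (sin (2 * profile u s) / 2 + profileError u s) s := by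
  refine (W.smoothOn.smoothOn_pR.hasDerivAt_avg s).congr_deriv ?_
  unfold profileError profile
  ring

theorem continuous_profile_pR (W : LogWave u E) : Continuous (profile (pR u)) :=
  W.smoothOn.smoothOn_pR.continuous_avg

theorem profile_pR_sq_le (W : LogWave u E) (s : ℝ) :
    profile (pR u) s ^ 2 ≤ avg fun t => pR u t s ^ 2 :=
  avg_sq_le (W.smoothOn.smoothOn_pR.continuousOn_time s)

theorem integral_profile_pR_sq_le (W : LogWave u E) {a b : ℝ} (hab : a ≤ b) :
    ∫ s in a..b, profile (pR u) s ^ 2 ≤ E := by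
  have h := W.smoothOn.smoothOn_pR.sq
  refine (intervalIntegral.integral_mono_on hab
    ((W.continuous_profile_pR.pow 2).intervalIntegrable _ _)
    (h.continuous_avg.intervalIntegrable _ _) fun s _ => W.profile_pR_sq_le s).trans ?_
  rw [h.integral_avg_swap]
  have := avg_mono (h.continuousOn_integral_space a b) (continuousOn_const (c := E))
    fun t ht => W.integral_pR_sq_le ht hab
  rwa [avg_const] at this

theorem abs_profilePohozaev_le (W : LogWave u E) {s M ε η : ℝ} (hM : 0 < M) (hε : 0 ≤ ε)
    (hf : ∀ σ ∈ Icc s (s + M), |profileError u σ| ≤ ε)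
    (hd : ∀ σ ∈ Icc s (s + M), |profile u σ - u 0 σ| ≤ η) :
    |profilePohozaev u s| ≤ ε * (E + M) + (2 * E + 2 * η * M) / M := by
  have ch := W.continuous_profile_pR
  have c0 := W.smoothOn.continuous_space (left_mem_Icc.2 (by norm_num : (0 : ℝ) ≤ 3))
  have c0' := W.smoothOn.smoothOn_pR.continuous_space (left_mem_Icc.2 (by norm_num : (0 : ℝ) ≤ 3))
  have hsM : s ≤ s + M := by linarith
  refine abs_le_add_div_of_oscillation
    (H := fun σ => profile (pR u) σ ^ 2 + (pR u 0 σ ^ 2 + sin (u 0 σ) ^ 2 + 2 * η)) hM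
    (by fun_prop) (fun σ hσ => ?_) (fun σ hσ => ?_) ?_
  · have hder : ∀ x, HasDerivAt (profilePohozaev u) (2 * (profile (pR u) x * profileError u x)) x :=
      fun x => by
        refine (((W.hasDerivAt_profile_pR x).fun_pow 2).sub
          ((W.hasDerivAt_profile x).sin.fun_pow 2)).congr_deriv ?_
        rw [sin_two_mul]
        push_cast
        ring
    have hg : ∀ x, HasDerivAt (fun y => ε * ((∫ z in s..y, profile (pR u) z ^ 2) + y))
        (ε * (profile (pR u) x ^ 2 + 1)) x := fun x =>
      ((intervalIntegral.integral_hasDerivAt_right ((ch.pow 2).intervalIntegrable _ _)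
        (ch.pow 2).stronglyMeasurable.stronglyMeasurableAtFilter
        (ch.pow 2).continuousAt).add (hasDerivAt_id x)).const_mul ε
    have h := abs_sub_le_of_abs_deriv_le hσ.1 (fun x _ => hder x) (fun x _ => hg x)
      fun x hx => by
        have h1 := hf x ⟨hx.1, hx.2.trans hσ.2⟩
        rw [abs_mul, abs_mul, abs_two]
        have h2 : |profile (pR u) x| * |profileError u x| ≤ |profile (pR u) x| * ε :=
          mul_le_mul_of_nonneg_left h1 (abs_nonneg _)
        have h3 : 0 ≤ ε * (|profile (pR u) x| - 1) ^ 2 := by positivity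
        rw [← sq_abs (profile (pR u) x)]
        linarith
    refine h.trans ?_
    rw [intervalIntegral.integral_same, ← mul_sub]
    refine mul_le_mul_of_nonneg_left ?_ hε
    linarith [W.integral_profile_pR_sq_le hσ.1, hσ.2]
  · have h1 := abs_sin_sq_sub_sin_sq_le (profile u σ) (u 0 σ)
    have h2 := hd σ hσ
    rw [abs_le] at h1
    unfold profilePohozaev
    rw [abs_le]
    constructor <;> linarith [h1.1, h1.2, sq_nonneg (profile (pR u) σ),
      sq_nonneg (pR u 0 σ), sq_nonneg (sin (u 0 σ)), sq_nonneg (sin (profile u σ)),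
      abs_nonneg (profile u σ - u 0 σ)]
  · have i1 : IntervalIntegrable (fun σ => profile (pR u) σ ^ 2) volume s (s + M) :=
      (ch.pow 2).intervalIntegrable _ _
    have i2 : IntervalIntegrable (fun σ => pR u 0 σ ^ 2 + sin (u 0 σ) ^ 2) volume s (s + M) :=
      (by fun_prop : Continuous fun σ => pR u 0 σ ^ 2 + sin (u 0 σ) ^ 2).intervalIntegrable _ _
    rw [intervalIntegral.integral_add i1 (i2.add intervalIntegrable_const),
      intervalIntegral.integral_add i2 intervalIntegrable_const, intervalIntegral.integral_const,
      smul_eq_mul]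
    have h1 := W.integral_profile_pR_sq_le hsM
    have h2 := W.energy_le 0 s (s + M) (by norm_num) hsM
    linarith

theorem hasDerivAt_avgPohozaev (W : LogWave u E) (s : ℝ) :
    HasDerivAt (avgPohozaev u) (2 * exp s ^ 2 * ((avg fun t => pT u t s ^ 2) -
      ∫ t in (0 : ℝ)..3, cutoffDeriv t * (pR u t s * pT u t s))) s := by
  have hD : SmoothOn (fun t s => pR u t s ^ 2 - sin (u t s) ^ 2 + exp s ^ 2 * pT u t s ^ 2)
      strip := by
    refine (W.smoothOn.smoothOn_pR.sq.sub W.smoothOn.sin.sq).add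
      (SmoothOn.mul (F := fun _ s => exp s ^ 2) ⟨W.smoothOn.isOpen, ?_⟩
        W.smoothOn.smoothOn_pT.sq)
    exact (contDiff_snd.exp.pow 2).contDiffOn
  refine (hD.hasDerivAt_avg s).congr_deriv ?_
  have cR := W.smoothOn.smoothOn_pR.continuousOn_time s
  have cT := W.smoothOn.smoothOn_pT.continuousOn_time s
  have cTT := W.smoothOn.smoothOn_pT.smoothOn_pT.continuousOn_time s
  have cTR := W.smoothOn.smoothOn_pT.smoothOn_pR.continuousOn_time s
  have c1 : ContinuousOn (fun t => pR u t s * pT (pT u) t s + pR (pT u) t s * pT u t s)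
      (Icc 0 3) := by fun_prop
  have c2 : ContinuousOn (fun t => cutoffDeriv t * (pR u t s * pT u t s)) (Icc 0 3) := by fun_prop
  have i2 := intervalIntegrable_of_continuousOn_Icc (by norm_num) c2
  have h := intervalIntegral.integral_eq_sub_of_hasDerivAt (a := 0) (b := 3)
    (f := fun t => cutoff t * (pR u t s * pT u t s))
    (f' := fun t => cutoffDeriv t * (pR u t s * pT u t s) +
      cutoff t * (pR u t s * pT (pT u) t s + pR (pT u) t s * pT u t s))
    (fun t ht => by
      rw [uIcc_of_le (by norm_num)] at ht
      have hp : (t, s) ∈ strip := ⟨Icc_subset_Ioi_neg_one ht, mem_univ _⟩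
      refine ((hasDerivAt_cutoff t).mul ((W.smoothOn.smoothOn_pR.hasDerivAt_pT hp).mul
        (W.smoothOn.smoothOn_pT.hasDerivAt_pT hp))).congr_deriv ?_
      rw [W.smoothOn.pT_pR hp]
      simp only [Pi.mul_apply]
      ring) (i2.add (intervalIntegrable_cutoff_mul c1))
  rw [intervalIntegral.integral_add i2 (intervalIntegrable_cutoff_mul c1)] at h
  norm_num [cutoff] at h
  have e : ∀ t ∈ uIcc (0 : ℝ) 3, cutoff t *
      pR (fun t s => pR u t s ^ 2 - sin (u t s) ^ 2 + exp s ^ 2 * pT u t s ^ 2) t s =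
      cutoff t * (2 * exp s ^ 2 *
        (pT u t s ^ 2 + (pR u t s * pT (pT u) t s + pR (pT u) t s * pT u t s))) := by
    intro t ht
    rw [uIcc_of_le (by norm_num)] at ht
    have hp : (t, s) ∈ strip := ⟨Icc_subset_Ioi_neg_one ht, mem_univ _⟩
    have h1 := (((W.smoothOn.smoothOn_pR.hasDerivAt_pR hp).fun_pow 2).sub
      ((W.smoothOn.hasDerivAt_pR hp).sin.fun_pow 2)).add (((hasDerivAt_exp s).fun_pow 2).mul
        ((W.smoothOn.smoothOn_pT.hasDerivAt_pR hp).fun_pow 2))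
    have h2 : pR (fun t s => pR u t s ^ 2 - sin (u t s) ^ 2 + exp s ^ 2 * pT u t s ^ 2) t s = _ :=
      h1.deriv
    rw [h2]
    have h3 := W.eqn t s hp.1
    rw [sin_two_mul] at h3
    push_cast
    congr 1
    have h4 : pR (pR u) t s = exp s ^ 2 * pT (pT u) t s + 2 * sin (u t s) * cos (u t s) / 2 := by
      linarith
    rw [h4]
    ring
  rw [avg, intervalIntegral.integral_congr e]
  change avg _ = _
  rw [avg_const_mul, avg_add (by fun_prop) c1]
  congr 1
  have h' : avg (fun t => pR u t s * pT (pT u) t s + pR (pT u) t s * pT u t s) =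
    -∫ t in (0 : ℝ)..3, cutoffDeriv t * (pR u t s * pT u t s) := by
    unfold avg cutoff
    linarith
  rw [h', ← sub_eq_add_neg]

theorem abs_deriv_avgPohozaev_le (W : LogWave u E) {s R ω : ℝ} (hs : s ≤ R) (hω : 0 < ω) :
    |2 * exp s ^ 2 * ((avg fun t => pT u t s ^ 2) -
      ∫ t in (0 : ℝ)..3, cutoffDeriv t * (pR u t s * pT u t s))| ≤
    2 * exp R ^ 2 * (ω * (∫ t in (0 : ℝ)..3, pR u t s ^ 2) +
      (1 + 1 / ω) * ∫ t in (0 : ℝ)..3, pT u t s ^ 2) := by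
  have cR := W.smoothOn.smoothOn_pR.continuousOn_time s
  have cT := W.smoothOn.smoothOn_pT.continuousOn_time s
  have iR : IntervalIntegrable (fun t => ω * pR u t s ^ 2) volume 0 3 :=
    intervalIntegrable_of_continuousOn_Icc (by norm_num) (by fun_prop)
  have iT : IntervalIntegrable (fun t => 1 / ω * pT u t s ^ 2) volume 0 3 :=
    intervalIntegrable_of_continuousOn_Icc (by norm_num) (by fun_prop)
  have h1 := intervalIntegral.norm_integral_le_of_norm_le (μ := volume) (a := 0) (b := 3)
    (f := fun t => cutoffDeriv t * (pR u t s * pT u t s))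
    (g := fun t => ω * pR u t s ^ 2 + 1 / ω * pT u t s ^ 2) (by norm_num)
    (Eventually.of_forall fun t ht => by
      have h2 := abs_cutoffDeriv_le (Ioc_subset_Icc_self ht)
      have h3 : 0 ≤ (ω * |pR u t s| - |pT u t s|) ^ 2 / ω := by positivity
      have h4 : (ω * |pR u t s| - |pT u t s|) ^ 2 / ω =
          ω * |pR u t s| ^ 2 + 1 / ω * |pT u t s| ^ 2 - 2 * (|pR u t s| * |pT u t s|) := by
        field_simp; ring
      rw [sq_abs, sq_abs] at h4
      rw [norm_eq_abs, abs_mul, abs_mul]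
      have := mul_le_mul_of_nonneg_right h2 (mul_nonneg (abs_nonneg (pR u t s))
        (abs_nonneg (pT u t s)))
      linarith) (iR.add iT)
  rw [intervalIntegral.integral_add iR iT, intervalIntegral.integral_const_mul,
    intervalIntegral.integral_const_mul, norm_eq_abs] at h1
  have h2 : avg (fun t => pT u t s ^ 2) ≤ ∫ t in (0 : ℝ)..3, pT u t s ^ 2 :=
    avg_le_integral (by fun_prop) fun t _ => sq_nonneg _
  have h3 : 0 ≤ avg (fun t => pT u t s ^ 2) := avg_nonneg fun t _ => sq_nonneg _
  rw [abs_mul, abs_of_pos (by positivity : 0 < 2 * exp s ^ 2)]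
  refine mul_le_mul (by gcongr) ?_ (abs_nonneg _) (by positivity)
  rw [abs_le] at h1 ⊢
  constructor <;> linarith

theorem abs_avgPohozaev_le (W : LogWave u E) {s M R ω : ℝ} (hM : 0 < M) (hω : 0 < ω)
    (hs : -R ≤ s) (hR : s + M ≤ R) :
    |avgPohozaev u s| ≤ 2 * exp R ^ 2 * (ω * (3 * E) + (1 + 1 / ω) * kinST u (-R) R) +
      (E + exp R ^ 2 * kinST u (-R) R) / M := by
  have hRs := W.smoothOn.smoothOn_pR.sq
  have hTs := W.smoothOn.smoothOn_pT.sq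
  have hSs := W.smoothOn.sin.sq
  obtain ⟨P, hP⟩ : ∃ P : ℝ → ℝ, P = fun s => ∫ t in (0 : ℝ)..3, pR u t s ^ 2 := ⟨_, rfl⟩
  obtain ⟨K, hK⟩ : ∃ K : ℝ → ℝ, K = fun s => ∫ t in (0 : ℝ)..3, pT u t s ^ 2 := ⟨_, rfl⟩
  obtain ⟨e, he⟩ : ∃ e : ℝ → ℝ, e = fun s => avg fun t => pR u t s ^ 2 + sin (u t s) ^ 2 :=
    ⟨_, rfl⟩
  have cP : Continuous P := hP ▸ hRs.continuous_integral_time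
  have cK : Continuous K := hK ▸ hTs.continuous_integral_time
  have ce : Continuous e := he ▸ (hRs.add hSs).continuous_avg
  have hIP : ∀ b, s ≤ b → ∫ σ in s..b, P σ ≤ 3 * E := fun b hb => by
    rw [hP, hRs.integral_swap]
    have h := intervalIntegral.integral_mono_on (μ := volume) (by norm_num : (0 : ℝ) ≤ 3)
      (intervalIntegrable_of_continuousOn_Icc (by norm_num) (hRs.continuousOn_integral_space s b))
      (intervalIntegrable_const (c := E)) fun t ht => W.integral_pR_sq_le ht hb
    rw [intervalIntegral.integral_const, smul_eq_mul] at h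
    linarith
  have hIK : ∀ b, s ≤ b → b ≤ R → ∫ σ in s..b, K σ ≤ kinST u (-R) R := fun b hb hbR => by
    unfold kinST
    rw [← hTs.integral_swap, ← hK]
    refine intervalIntegral.integral_mono_interval hs hb hbR ?_ (cK.intervalIntegrable _ _)
    exact Eventually.of_forall fun σ => hK ▸
      intervalIntegral.integral_nonneg (by norm_num) fun _ _ => sq_nonneg _
  have hIe : ∫ σ in s..s + M, e σ ≤ E := by
    rw [he, (hRs.add hSs).integral_avg_swap]
    have h := avg_mono ((hRs.add hSs).continuousOn_integral_space s (s + M))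
      (continuousOn_const (c := E)) fun t ht =>
        W.energy_le t s (s + M) (Icc_subset_Ioi_neg_one ht) (by linarith)
    rwa [avg_const] at h
  refine abs_le_add_div_of_oscillation (H := fun σ => e σ + exp R ^ 2 * K σ) hM (by fun_prop)
    (fun σ hσ => ?_) (fun σ hσ => ?_) ?_
  · have cg : Continuous fun x => 2 * exp R ^ 2 * (ω * P x + (1 + 1 / ω) * K x) := by fun_prop
    have h := abs_sub_le_of_abs_deriv_le (g := fun y => ∫ x in s..y,
        2 * exp R ^ 2 * (ω * P x + (1 + 1 / ω) * K x)) hσ.1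
      (fun x _ => W.hasDerivAt_avgPohozaev x)
      (fun x _ => intervalIntegral.integral_hasDerivAt_right (cg.intervalIntegrable _ _)
        cg.stronglyMeasurable.stronglyMeasurableAtFilter cg.continuousAt) fun x hx => by
          rw [hP, hK]
          exact W.abs_deriv_avgPohozaev_le (by linarith [hx.2, hσ.2]) hω
    refine h.trans ?_
    rw [intervalIntegral.integral_same, sub_zero, intervalIntegral.integral_const_mul,
      intervalIntegral.integral_add ((cP.const_mul ω).intervalIntegrable _ _)
        ((cK.const_mul _).intervalIntegrable _ _), intervalIntegral.integral_const_mul,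
      intervalIntegral.integral_const_mul]
    have h1 := hIP σ hσ.1
    have h2 := hIK σ hσ.1 (by linarith [hσ.2])
    gcongr
  · have cR := W.smoothOn.smoothOn_pR.continuousOn_time σ
    have cT := W.smoothOn.smoothOn_pT.continuousOn_time σ
    have c0 := W.smoothOn.continuousOn_time σ
    have c1 : ContinuousOn (fun t => pR u t σ ^ 2 + sin (u t σ) ^ 2) (Icc 0 3) := by fun_prop
    have c2 : ContinuousOn (fun t => exp R ^ 2 * pT u t σ ^ 2) (Icc 0 3) := by fun_prop
    have c3 : ContinuousOn (fun t => pR u t σ ^ 2 - sin (u t σ) ^ 2 + exp σ ^ 2 * pT u t σ ^ 2)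
      (Icc 0 3) := by fun_prop
    have hexp : exp σ ^ 2 ≤ exp R ^ 2 := by gcongr; linarith [hσ.2]
    have h1 : avg (fun t => pR u t σ ^ 2 + sin (u t σ) ^ 2 + exp R ^ 2 * pT u t σ ^ 2) ≤
        e σ + exp R ^ 2 * K σ := by
      rw [avg_add c1 c2, avg_const_mul, he, hK]
      gcongr
      exact avg_le_integral (by fun_prop) fun t _ => sq_nonneg _
    have hT : ∀ t, exp σ ^ 2 * pT u t σ ^ 2 ≤ exp R ^ 2 * pT u t σ ^ 2 := fun t =>
      mul_le_mul_of_nonneg_right hexp (sq_nonneg _)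
    have h2 : avgPohozaev u σ ≤ _ := avg_mono c3 (c1.add c2) fun t _ => by
      simp only [Pi.add_apply]
      linarith [hT t, sq_nonneg (sin (u t σ))]
    have h3 : avg (fun t => (-1) * (pR u t σ ^ 2 + sin (u t σ) ^ 2 + exp R ^ 2 * pT u t σ ^ 2)) ≤
        avgPohozaev u σ := avg_mono (by fun_prop) c3 fun t _ => by
      have : 0 ≤ exp σ ^ 2 * pT u t σ ^ 2 := by positivity
      linarith [hT t, sq_nonneg (pR u t σ), sq_nonneg (sin (u t σ))]
    rw [avg_const_mul] at h3
    rw [abs_le]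
    constructor
    · linarith
    · exact h2.trans h1
  · rw [intervalIntegral.integral_add (ce.intervalIntegrable _ _)
      ((cK.const_mul _).intervalIntegrable _ _), intervalIntegral.integral_const_mul]
    have := hIK (s + M) (by linarith) hR
    gcongr

/-- The averaged map is close to the map in the averaged `H¹` sense. -/
theorem integral_pR_sub_profile_sq_le (W : LogWave u E) {s ε : ℝ}
    (hd : ∀ t ∈ Icc (0 : ℝ) 3, |u t s - u 0 s| ≤ ε) :
    ∫ t in (1 : ℝ)..2, (pR u t s - profile (pR u) s) ^ 2 ≤
      81 / 40 * (|avgPohozaev u s| + |profilePohozaev u s| + 4 * ε) := by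
  have cR := W.smoothOn.smoothOn_pR.continuousOn_time s
  have cT := W.smoothOn.smoothOn_pT.continuousOn_time s
  have c0 := W.smoothOn.continuousOn_time s
  refine (integral_le_avg (by fun_prop) fun t _ => sq_nonneg _).trans
    (mul_le_mul_of_nonneg_left ?_ (by norm_num))
  have h : avg (fun t => (pR u t s - profile (pR u) s) ^ 2) = _ := avg_sub_avg_sq cR
  rw [h]
  have c1 : ContinuousOn (fun t => pR u t s ^ 2 - sin (u t s) ^ 2) (Icc 0 3) := by fun_prop
  have c2 : ContinuousOn (fun t => exp s ^ 2 * pT u t s ^ 2) (Icc 0 3) := by fun_prop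
  have h1 : avgPohozaev u s = avg (fun t => pR u t s ^ 2) - avg (fun t => sin (u t s) ^ 2) +
      exp s ^ 2 * avg (fun t => pT u t s ^ 2) := by
    unfold avgPohozaev
    rw [avg_add c1 c2, avg_sub (by fun_prop) (by fun_prop), avg_const_mul]
  have h2 : 0 ≤ exp s ^ 2 * avg (fun t => pT u t s ^ 2) :=
    mul_nonneg (sq_nonneg _) (avg_nonneg fun t _ => sq_nonneg _)
  have h3 : |avg (fun t => sin (u t s) ^ 2 - sin (profile u s) ^ 2)| ≤ 4 * ε :=
    abs_avg_le (by fun_prop) fun t ht => by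
      have h4 := abs_sin_sq_sub_sin_sq_le (u t s) (profile u s)
      have h5 := W.abs_profile_sub_le ht hd
      rw [abs_sub_comm] at h5
      linarith
  rw [avg_sub (by fun_prop) (by fun_prop), avg_const] at h3
  have h4 : profilePohozaev u s = avg (fun t => pR u t s) ^ 2 - sin (profile u s) ^ 2 := rfl
  have h5 := le_abs_self (avgPohozaev u s)
  have h6 := neg_abs_le (profilePohozaev u s)
  have h7 := (abs_le.1 h3).2
  linarith

end LogWave

/-- The harmonic map `Q` in the logarithmic radial coordinate. -/
def logQ (s : ℝ) : ℝ := Q (exp s)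

theorem sin_Q (r : ℝ) : sin (Q r) = 2 * r / (1 + r ^ 2) := by
  have h : 0 < 1 + r ^ 2 := by positivity
  rw [Q, sin_two_mul, sin_arctan, cos_arctan]
  field_simp
  rw [sq_sqrt h.le]

theorem hasDerivAt_Q (r : ℝ) : HasDerivAt Q (2 / (1 + r ^ 2)) r :=
  ((hasDerivAt_arctan r).const_mul 2).congr_deriv (by ring)

theorem hasDerivAt_logQ (s : ℝ) : HasDerivAt logQ (sin (logQ s)) s := by
  refine ((hasDerivAt_Q (exp s)).comp s (hasDerivAt_exp s)).congr_deriv ?_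
  rw [logQ, sin_Q]
  ring

theorem logQ_zero : logQ 0 = π / 2 := by
  rw [logQ, exp_zero, Q, arctan_one]; ring

/-- Squared distance in phase space between `(h, h')` and the trajectory of `logQ`. -/
def logQDistSq (h h' : ℝ → ℝ) (s : ℝ) : ℝ := (h s - logQ s) ^ 2 + (h' s - sin (logQ s)) ^ 2

theorem hasDerivAt_logQDistSq {h h' f : ℝ → ℝ} {s : ℝ} (hh : HasDerivAt h (h' s) s)
    (hh' : HasDerivAt h' (sin (2 * h s) / 2 + f s) s) :
    HasDerivAt (logQDistSq h h') (2 * ((h s - logQ s) * (h' s - sin (logQ s))) +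
      2 * ((h' s - sin (logQ s)) * ((sin (2 * h s) - sin (2 * logQ s)) / 2 + f s))) s := by
  have hq := hasDerivAt_logQ s
  refine (((hh.sub hq).fun_pow 2).add ((hh'.sub hq.sin).fun_pow 2)).congr_deriv ?_
  rw [sin_two_mul (logQ s)]
  simp only [Pi.sub_apply]
  push_cast
  ring

theorem abs_deriv_logQDistSq_le (h h' : ℝ → ℝ) (f : ℝ → ℝ) {s ε : ℝ} (hf : |f s| ≤ ε) :
    |2 * ((h s - logQ s) * (h' s - sin (logQ s))) +
      2 * ((h' s - sin (logQ s)) * ((sin (2 * h s) - sin (2 * logQ s)) / 2 + f s))| ≤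
    3 * (logQDistSq h h' s + ε ^ 2) := by
  unfold logQDistSq
  generalize hA : h s - logQ s = A
  generalize hB : h' s - sin (logQ s) = B
  generalize hS : (sin (2 * h s) - sin (2 * logQ s)) / 2 = S
  have h1 : |S| ≤ |A| := by
    have := abs_sin_sub_sin_le (2 * h s) (2 * logQ s)
    rw [← mul_sub, abs_mul, abs_two, hA] at this
    rw [← hS, abs_div, abs_two]
    linarith
  have h2 : |2 * (A * B) + 2 * (B * (S + f s))| ≤ 2 * (|A| * |B|) + 2 * (|B| * (|A| + ε)) := by
    refine (abs_add_le _ _).trans ?_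
    rw [abs_mul, abs_mul, abs_mul, abs_mul, abs_two]
    have : |S + f s| ≤ |A| + ε := (abs_add_le _ _).trans (add_le_add h1 hf)
    gcongr
  rw [← sq_abs A, ← sq_abs B]
  nlinarith [sq_nonneg (|A| - |B|), sq_nonneg (|B| - ε), sq_nonneg ε, sq_nonneg (|A|)]

/-- Gronwall estimate for perturbations of the harmonic map equation. -/
theorem logQDistSq_le {h h' f : ℝ → ℝ} {L ε s : ℝ} (hh : ∀ s, HasDerivAt h (h' s) s)
    (hh' : ∀ s, HasDerivAt h' (sin (2 * h s) / 2 + f s) s) (hf : ∀ s ∈ Icc (-L) L, |f s| ≤ ε)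
    (hs : s ∈ Icc (-L) L) : logQDistSq h h' s ≤ exp (3 * L) * (logQDistSq h h' 0 + ε ^ 2) := by
  have hY := fun x => hasDerivAt_logQDistSq (hh x) (hh' x)
  have hY0 : 0 ≤ logQDistSq h h' 0 + ε ^ 2 := by unfold logQDistSq; positivity
  have hε : 0 ≤ ε ^ 2 := sq_nonneg ε
  have hexp : ∀ c x : ℝ, HasDerivAt (fun y => exp (c * y)) (exp (c * x) * c) x := fun c x =>
    (((hasDerivAt_id x).const_mul c).congr_deriv (mul_one c)).exp
  have key : ∀ c : ℝ, exp (-c * s) * exp (c * s) = 1 := fun c => by rw [← exp_add]; simp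
  rcases le_total 0 s with h0 | h0
  · have hm : AntitoneOn (fun y => exp (-3 * y) * (logQDistSq h h' y + ε ^ 2)) (Icc 0 s) :=
      antitoneOn_of_hasDerivAt (convex_Icc 0 s)
        (fun x _ => (hexp (-3) x).mul ((hY x).add_const (ε ^ 2))) fun x hx => by
          have h1 := (abs_le.1 (abs_deriv_logQDistSq_le h h' f
            (hf x ⟨by linarith [hs.1, hx.1, hs.2, hx.2], hx.2.trans hs.2⟩))).2
          have h2 := mul_le_mul_of_nonneg_left h1 (exp_pos (-3 * x)).le
          linarith
    have h1 := hm (left_mem_Icc.2 h0) (right_mem_Icc.2 h0) h0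
    simp only [mul_zero, exp_zero, one_mul] at h1
    have h2 := mul_le_mul_of_nonneg_left h1 (exp_pos (3 * s)).le
    rw [← mul_assoc, mul_comm (exp (3 * s)), key 3, one_mul] at h2
    have h3 : exp (3 * s) ≤ exp (3 * L) := by gcongr; exact hs.2
    have h4 := mul_le_mul_of_nonneg_right h3 hY0
    linarith
  · have hm : MonotoneOn (fun y => exp (3 * y) * (logQDistSq h h' y + ε ^ 2)) (Icc s 0) :=
      monotoneOn_of_hasDerivAt (convex_Icc s 0)
        (fun x _ => (hexp 3 x).mul ((hY x).add_const (ε ^ 2))) fun x hx => by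
          have h1 := (abs_le.1 (abs_deriv_logQDistSq_le h h' f
            (hf x ⟨hs.1.trans hx.1, by linarith [hs.1, hx.1, hs.2, hx.2]⟩))).1
          have h2 := mul_le_mul_of_nonneg_left h1 (exp_pos (3 * x)).le
          linarith
    have h1 := hm (left_mem_Icc.2 h0) (right_mem_Icc.2 h0) h0
    simp only [mul_zero, exp_zero, one_mul] at h1
    have h2 := mul_le_mul_of_nonneg_left h1 (exp_pos (-3 * s)).le
    rw [← mul_assoc, key 3, one_mul] at h2
    have h3 : exp (-3 * s) ≤ exp (3 * L) := by
      rw [exp_le_exp]; linarith [hs.1]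
    have h4 := mul_le_mul_of_nonneg_right h3 hY0
    linarith

/-- The sign of the slope is determined by being below the equator on the left. -/
theorem neg_half_lt_of_le {h h' h'' : ℝ → ℝ} {ε : ℝ} (hε : ε < 1 / 32)
    (hh : ∀ s, HasDerivAt h (h' s) s) (hh' : ∀ s, HasDerivAt h' (h'' s) s)
    (hb : ∀ s ∈ Icc (-1 : ℝ) 1, |h'' s| ≤ 1) (h0 : π / 2 - ε ≤ h 0)
    (hl : h (-(1 / 4)) ≤ π / 2 + ε) : -(1 / 2) < h' 0 := by
  by_contra! hc
  have h1 : ∀ s ∈ Icc (-(1 / 4) : ℝ) 0, h' s ≤ -(1 / 4) := fun s hs => by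
    have := abs_sub_le_of_abs_deriv_le (g := id) (g' := fun _ => 1) hs.2 (fun x _ => hh' x)
      (fun x _ => hasDerivAt_id x)
      (fun x hx => hb x ⟨by linarith [hx.1, hs.1], by linarith [hx.2]⟩)
    have := (abs_le.1 this).1
    simp only [id] at this
    linarith [hs.1]
  have hm : AntitoneOn (fun s => h s + 1 / 4 * s) (Icc (-(1 / 4)) 0) :=
    antitoneOn_of_hasDerivAt (convex_Icc _ _)
      (fun x _ => (hh x).add ((hasDerivAt_id x).const_mul (1 / 4))) fun x hx => by
        linarith [h1 x hx]
  have := hm (left_mem_Icc.2 (by norm_num)) (right_mem_Icc.2 (by norm_num)) (by norm_num)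
  simp only at this
  linarith

/-- Squared distance between a map and the harmonic map `logQ`, including the kinetic density. -/
def bubbleDist (u : ℝ → ℝ → ℝ) (t s : ℝ) : ℝ :=
  (pR u t s - sin (logQ s)) ^ 2 + (u t s - logQ s) ^ 2 + pT u t s ^ 2

theorem smoothOn_of_contDiff {q : ℝ → ℝ} (hq : ContDiff ℝ (⊤ : ℕ∞) q) :
    SmoothOn (fun _ s => q s) strip :=
  ⟨isOpen_Ioi.prod isOpen_univ, (hq.comp contDiff_snd).contDiffOn⟩

theorem contDiff_logQ : ContDiff ℝ (⊤ : ℕ∞) logQ :=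
  contDiff_const.mul (contDiff_exp.arctan)

theorem LogWave.smoothOn_bubbleDist {v : ℝ → ℝ → ℝ} {E : ℝ} (W : LogWave v E) :
    SmoothOn (bubbleDist v) strip :=
  (((W.smoothOn.smoothOn_pR.sub (smoothOn_of_contDiff contDiff_logQ).sin).sq).add
    (W.smoothOn.sub (smoothOn_of_contDiff contDiff_logQ)).sq).add W.smoothOn.smoothOn_pT.sq

theorem LogWave.integral_bubbleDist_le {v : ℝ → ℝ → ℝ} {E : ℝ} (W : LogWave v E) {s ε : ℝ}
    (hε : 0 ≤ ε) (hε1 : ε ≤ 1) (hd : ∀ t ∈ Icc (0 : ℝ) 3, |v t s - v 0 s| ≤ ε)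
    (hg : |profilePohozaev v s| ≤ ε) (hG : |avgPohozaev v s| ≤ ε)
    (hq : |logQDistSq (profile v) (profile (pR v)) s| ≤ ε) :
    ∫ t in (1 : ℝ)..2, bubbleDist v t s ≤ 40 * ε + ∫ t in (0 : ℝ)..3, pT v t s ^ 2 := by
  have hs : Icc (1 : ℝ) 2 ⊆ Icc 0 3 := Icc_subset_Icc (by norm_num) (by norm_num)
  have cR := W.smoothOn.smoothOn_pR.continuousOn_time s
  have cT := W.smoothOn.smoothOn_pT.continuousOn_time s
  have cB := W.smoothOn_bubbleDist.continuousOn_time s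
  have hp : ∀ t ∈ Icc (1 : ℝ) 2, bubbleDist v t s ≤
      2 * (pR v t s - profile (pR v) s) ^ 2 + (pT v t s ^ 2 + 10 * ε) := fun t ht => by
    have h1 := W.abs_profile_sub_le (hs ht) hd
    have h2 := pow_le_pow_left₀ (abs_nonneg _) h1 2
    rw [sq_abs] at h2
    have h3 := (abs_le.1 hq).2
    unfold logQDistSq at h3
    unfold bubbleDist
    nlinarith [sq_nonneg ((pR v t s - profile (pR v) s) - (profile (pR v) s - sin (logQ s))),
      sq_nonneg ((profile v s - v t s) + (profile v s - logQ s))]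
  have ii : ∀ F : ℝ → ℝ, ContinuousOn F (Icc 0 3) → IntervalIntegrable F volume 1 2 := fun F hF =>
    intervalIntegrable_of_continuousOn_Icc (by norm_num) (hF.mono hs)
  have i1 := ii (fun t => 2 * (pR v t s - profile (pR v) s) ^ 2) (by fun_prop)
  have i2 := ii (fun t => pT v t s ^ 2) (by fun_prop)
  refine (intervalIntegral.integral_mono_on (by norm_num) (ii _ cB)
    (i1.add (i2.add intervalIntegrable_const)) hp).trans ?_
  rw [intervalIntegral.integral_add i1 (i2.add intervalIntegrable_const),
    intervalIntegral.integral_add i2 intervalIntegrable_const,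
    intervalIntegral.integral_const_mul, intervalIntegral.integral_const, smul_eq_mul]
  have h1 := W.integral_pR_sub_profile_sq_le hd
  have h2 : ∫ t in (1 : ℝ)..2, pT v t s ^ 2 ≤ ∫ t in (0 : ℝ)..3, pT v t s ^ 2 :=
    intervalIntegral.integral_mono_interval (by norm_num) (by norm_num) (by norm_num)
      (Eventually.of_forall fun t => sq_nonneg _)
      (intervalIntegrable_of_continuousOn_Icc (by norm_num) (by fun_prop))
  linarith

/-- Locally uniform convergence to zero on the line. -/
def LocUnifZero (F : ℕ → ℝ → ℝ) : Prop :=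
  ∀ L ε : ℝ, 0 < ε → ∀ᶠ n in atTop, ∀ s ∈ Icc (-L) L, |F n s| ≤ ε

/-- A sequence of wave maps of bounded energy whose kinetic energy tends to zero, normalized to
cross the equator at the origin. -/
structure BubblingSeq (u : ℕ → ℝ → ℝ → ℝ) (E : ℝ) : Prop where
  logWave : ∀ n, LogWave (u n) E
  kinST_tendsto : ∀ R, 0 < R → Tendsto (fun n => kinST (u n) (-R) R) atTop (nhds 0)
  center : ∀ n, u n 0 0 = π / 2
  le_left : ∀ n s, s < 0 → u n 0 s ≤ π / 2

namespace BubblingSeq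

variable {u : ℕ → ℝ → ℝ → ℝ} {E : ℝ}

theorem energy_nonneg (B : BubblingSeq u E) : 0 ≤ E := by
  simpa using (B.logWave 0).energy_le 0 0 0 (by norm_num) le_rfl

theorem eventually_abs_sub_initial_le (B : BubblingSeq u E) (L : ℝ) {ε : ℝ} (hε : 0 < ε) :
    ∀ᶠ n in atTop, ∀ s ∈ Icc (-L) L, ∀ t ∈ Icc (0 : ℝ) 3, |u n t s - u n 0 s| ≤ ε := by
  rcases lt_or_ge L 0 with hL | hL
  · exact Eventually.of_forall fun n s hs => absurd (hs.1.trans hs.2) (by linarith)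
  have hE := B.energy_nonneg
  obtain ⟨ω, hω⟩ : ∃ ω, ω = ε / (8 * (E + 1)) := ⟨_, rfl⟩
  have hω0 : 0 < ω := by rw [hω]; positivity
  have hωE : ω * E ≤ ε / 8 := by
    rw [hω, div_mul_eq_mul_div, div_le_iff₀ (by positivity)]; nlinarith
  obtain ⟨δ, hδ⟩ : ∃ δ, δ = min 1 (ε * ω / 2) := ⟨_, rfl⟩
  have hδ0 : 0 < δ := by rw [hδ]; positivity
  have hδω : δ / (4 * ω) ≤ ε / 8 := by
    rw [div_le_iff₀ (by positivity)]
    have : δ ≤ ε * ω / 2 := hδ ▸ min_le_right _ _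
    linarith
  have hK := ((B.kinST_tendsto (L + 1) (by linarith)).const_mul (3 / ε)).div_const δ
  rw [mul_zero, zero_div] at hK
  filter_upwards [hK.eventually_lt_const (show 0 < ε / 4 by positivity)] with n hn s hs t ht
  have h := (B.logWave n).abs_sub_initial_le ht hs hδ0 (hδ ▸ min_le_left _ _) hω0
    (show 0 < 3 / ε by positivity)
  have e : 3 / (4 * (3 / ε)) = ε / 4 := by field_simp
  linarith

theorem locUnifZero_profileError (B : BubblingSeq u E) :
    LocUnifZero fun n => profileError (u n) := by
  intro L ε hε
  filter_upwards [B.eventually_abs_sub_initial_le L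
    (show 0 < ε / (2 + 9 * exp L ^ 2) by positivity)] with n hn s hs
  refine ((B.logWave n).abs_profileError_le (hn s hs)).trans ?_
  have : exp s ^ 2 ≤ exp L ^ 2 := by gcongr; exact hs.2
  rw [mul_div_assoc', div_le_iff₀ (by positivity), mul_comm]
  gcongr

theorem locUnifZero_profilePohozaev (B : BubblingSeq u E) :
    LocUnifZero fun n => profilePohozaev (u n) := by
  intro L ε hε
  have hE := B.energy_nonneg
  obtain ⟨M, hM⟩ : ∃ M, M = 8 * (E + 1) / ε := ⟨_, rfl⟩
  have hM0 : 0 < M := by rw [hM]; positivity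
  have hME : 2 * E / M ≤ ε / 4 := by
    rw [div_le_iff₀ hM0, hM]; field_simp; linarith
  filter_upwards [B.eventually_abs_sub_initial_le (L + M) (show 0 < ε / 16 by positivity),
    B.locUnifZero_profileError (L + M) (ε / (4 * (E + M))) (by positivity)] with n hn hf s hs
  have hsub : Icc s (s + M) ⊆ Icc (-(L + M)) (L + M) :=
    Icc_subset_Icc (by linarith [hs.1]) (by linarith [hs.2])
  have h := (B.logWave n).abs_profilePohozaev_le hM0 (by positivity)
    (fun σ hσ => hf σ (hsub hσ)) fun σ hσ =>
      (B.logWave n).abs_profile_sub_le (left_mem_Icc.2 (by norm_num)) (hn σ (hsub hσ))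
  have e1 : ε / (4 * (E + M)) * (E + M) = ε / 4 := by field_simp
  have e2 : (2 * E + 2 * (2 * (ε / 16)) * M) / M = 2 * E / M + ε / 4 := by field_simp; ring
  linarith

theorem locUnifZero_avgPohozaev (B : BubblingSeq u E) :
    LocUnifZero fun n => avgPohozaev (u n) := by
  intro L ε hε
  rcases lt_or_ge L 0 with hL | hL
  · exact Eventually.of_forall fun n s hs => absurd (hs.1.trans hs.2) (by linarith)
  have hE := B.energy_nonneg
  obtain ⟨M, hM⟩ : ∃ M, M = 4 * (E + 1) / ε := ⟨_, rfl⟩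
  have hM0 : 0 < M := by rw [hM]; positivity
  have hME : E / M ≤ ε / 4 := by
    rw [div_le_iff₀ hM0, hM]; field_simp; linarith
  obtain ⟨ω, hω⟩ : ∃ ω, ω = ε / (24 * exp (L + M) ^ 2 * (E + 1)) := ⟨_, rfl⟩
  have hω0 : 0 < ω := by rw [hω]; positivity
  have hωE : 2 * exp (L + M) ^ 2 * (ω * (3 * E)) ≤ ε / 4 := by
    rw [hω]
    field_simp
    linarith
  have hK := (B.kinST_tendsto (L + M) (by linarith)).const_mul
    (2 * exp (L + M) ^ 2 * (1 + 1 / ω) + exp (L + M) ^ 2 / M)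
  rw [mul_zero] at hK
  filter_upwards [hK.eventually_lt_const (show 0 < ε / 2 by positivity)] with n hn s hs
  have h := (B.logWave n).abs_avgPohozaev_le hM0 hω0 (show -(L + M) ≤ s by linarith [hs.1])
    (by linarith [hs.2])
  rw [add_div, mul_add] at h
  have e : exp (L + M) ^ 2 * kinST (u n) (-(L + M)) (L + M) / M =
    exp (L + M) ^ 2 / M * kinST (u n) (-(L + M)) (L + M) := by ring
  rw [e] at h
  linarith

theorem eventually_abs_center_sub_le (B : BubblingSeq u E) {ε : ℝ} (hε : 0 < ε) :
    ∀ᶠ n in atTop, |profile (u n) 0 - π / 2| ≤ ε ∧ |profile (pR (u n)) 0 - 1| ≤ ε := by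
  obtain ⟨δ, hδ⟩ : ∃ δ, δ = min (1 / 64) (ε / 8) := ⟨_, rfl⟩
  have hδ0 : 0 < δ := by rw [hδ]; positivity
  have hδ1 : δ ≤ 1 / 64 := hδ ▸ min_le_left _ _
  have hδε : δ ≤ ε / 8 := hδ ▸ min_le_right _ _
  filter_upwards [B.eventually_abs_sub_initial_le 1 (show 0 < δ / 2 by positivity),
    B.locUnifZero_profileError 1 (1 / 2) (by norm_num),
    B.locUnifZero_profilePohozaev 1 δ hδ0] with n hn hf hg
  have W := B.logWave n
  have h0 : (0 : ℝ) ∈ Icc (0 : ℝ) 3 := left_mem_Icc.2 (by norm_num)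
  have h1 : (0 : ℝ) ∈ Icc (-1 : ℝ) 1 := by constructor <;> norm_num
  have a1 := W.abs_profile_sub_le h0 (hn 0 h1)
  have a2 := W.abs_profile_sub_le h0 (hn (-(1 / 4)) (by constructor <;> norm_num))
  have a3 := B.le_left n (-(1 / 4)) (by norm_num)
  rw [B.center n] at a1
  have a4 := neg_half_lt_of_le (ε := δ) (by linarith) W.hasDerivAt_profile
    W.hasDerivAt_profile_pR (fun s hs => by
      have h2 := hf s hs
      have h3 := abs_sin_le_one (2 * profile (u n) s)
      refine (abs_add_le _ _).trans ?_
      rw [abs_div, abs_two]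
      linarith) (by linarith [(abs_le.1 a1).1]) (by linarith [(abs_le.1 a2).2])
  refine ⟨by linarith, ?_⟩
  have a5 := hg 0 h1
  unfold profilePohozaev at a5
  have a6 := abs_sin_sq_sub_sin_sq_le (profile (u n) 0) (π / 2)
  rw [sin_pi_div_two] at a6
  have e : profile (pR (u n)) 0 ^ 2 - 1 =
      (profile (pR (u n)) 0 - 1) * (profile (pR (u n)) 0 + 1) := by ring
  have hp : 1 / 2 < profile (pR (u n)) 0 + 1 := by linarith
  have a7 : |profile (pR (u n)) 0 - 1| * (profile (pR (u n)) 0 + 1) ≤ ε * (1 / 2) := by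
    have h2 : |profile (pR (u n)) 0 ^ 2 - 1| =
        |profile (pR (u n)) 0 - 1| * (profile (pR (u n)) 0 + 1) := by
      rw [e, abs_mul, abs_of_pos (show 0 < profile (pR (u n)) 0 + 1 by linarith)]
    rw [← h2]
    rw [abs_le] at a5 a6 ⊢
    constructor <;> linarith [a5.1, a5.2, a6.1, a6.2]
  by_contra! hc
  nlinarith [abs_nonneg (profile (pR (u n)) 0 - 1)]

theorem locUnifZero_logQDistSq (B : BubblingSeq u E) :
    LocUnifZero fun n => logQDistSq (profile (u n)) (profile (pR (u n))) := by
  intro L ε hε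
  obtain ⟨δ, hδ⟩ : ∃ δ, δ = min 1 (ε / (3 * exp (3 * L))) := ⟨_, rfl⟩
  have hδ0 : 0 < δ := by rw [hδ]; positivity
  have hδε : exp (3 * L) * (3 * δ) ≤ ε := by
    have : δ ≤ ε / (3 * exp (3 * L)) := hδ ▸ min_le_right _ _
    rw [le_div_iff₀ (by positivity)] at this
    linarith
  have hδ2 : δ ^ 2 ≤ δ := by
    have : δ ≤ 1 := hδ ▸ min_le_left _ _
    nlinarith
  filter_upwards [B.eventually_abs_center_sub_le hδ0, B.locUnifZero_profileError L δ hδ0]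
    with n h0 hf s hs
  have W := B.logWave n
  have h := logQDistSq_le W.hasDerivAt_profile W.hasDerivAt_profile_pR hf hs
  have h1 : logQDistSq (profile (u n)) (profile (pR (u n))) 0 ≤ 2 * δ := by
    unfold logQDistSq
    rw [logQ_zero, sin_pi_div_two, ← sq_abs, ← sq_abs (_ - 1)]
    have h2 := pow_le_pow_left₀ (abs_nonneg _) h0.1 2
    have h3 := pow_le_pow_left₀ (abs_nonneg _) h0.2 2
    linarith
  rw [abs_of_nonneg (by unfold logQDistSq; positivity)]
  refine h.trans (le_trans ?_ hδε)
  gcongr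
  linarith

/-- Local strong convergence to the harmonic map. -/
theorem tendsto_integral_bubbleDist (B : BubblingSeq u E) {L : ℝ} (hL : 0 < L) :
    Tendsto (fun n => ∫ t in (1 : ℝ)..2, ∫ s in -L..L, bubbleDist (u n) t s) atTop (nhds 0) := by
  have hLL : -L ≤ L := by linarith
  refine tendsto_order.2 ⟨fun a ha => Eventually.of_forall fun n => ha.trans_le ?_, fun a ha => ?_⟩
  · exact intervalIntegral.integral_nonneg (by norm_num) fun t _ =>
      intervalIntegral.integral_nonneg hLL fun s _ => by unfold bubbleDist; positivity
  obtain ⟨ε, hε⟩ : ∃ ε, ε = min 1 (a / (4 * (40 * L))) := ⟨_, rfl⟩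
  have hε0 : 0 < ε := by rw [hε]; positivity
  have hεa : 2 * L * (40 * ε) ≤ a / 2 := by
    have : ε ≤ a / (4 * (40 * L)) := hε ▸ min_le_right _ _
    rw [le_div_iff₀ (by positivity)] at this
    linarith
  filter_upwards [B.eventually_abs_sub_initial_le L hε0, B.locUnifZero_profilePohozaev L ε hε0,
    B.locUnifZero_avgPohozaev L ε hε0, B.locUnifZero_logQDistSq L ε hε0,
    (B.kinST_tendsto L hL).eventually_lt_const (show 0 < a / 2 by positivity)] with n h1 h2 h3 h4 h5
  have W := B.logWave n
  have cK := W.smoothOn.smoothOn_pT.sq.continuous_integral_time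
  have hsw := W.smoothOn_bubbleDist.continuousOn_swap
  have hsub : uIcc (1 : ℝ) 2 ⊆ uIcc 0 3 := by
    rw [uIcc_of_le (by norm_num), uIcc_of_le (by norm_num)]
    exact Icc_subset_Icc (by norm_num) (by norm_num)
  have hswap := integral_integral_swap_of_continuousOn (f := fun s t => bubbleDist (u n) t s)
    (a := -L) (b := L) (hsw.mono (prod_mono (subset_univ _) hsub))
  have hc : Continuous fun s => ∫ t in (1 : ℝ)..2, bubbleDist (u n) t s :=
    continuousOn_univ.1 (continuousOn_intervalIntegral (f := fun s t => bubbleDist (u n) t s)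
      isOpen_univ (hsw.mono (prod_mono Subset.rfl hsub)))
  rw [← hswap]
  have h := intervalIntegral.integral_mono_on (μ := volume) hLL (hc.intervalIntegrable _ _)
    (intervalIntegrable_const.add (cK.intervalIntegrable _ _)) fun s hs =>
      W.integral_bubbleDist_le hε0.le (hε ▸ min_le_left _ _) (h1 s hs) (h2 s hs) (h3 s hs)
        (h4 s hs)
  rw [intervalIntegral.integral_add intervalIntegrable_const (cK.intervalIntegrable _ _),
    intervalIntegral.integral_const, smul_eq_mul,
    W.smoothOn.smoothOn_pT.sq.integral_swap] at h
  unfold kinST at h5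
  linarith

end BubblingSeq

/-- The map `ψ` in rescaled time and logarithmic radius, based at time `t₀` with scale `l`. -/
def logRescale (ψ : ℝ → ℝ → ℝ) (t₀ l τ s : ℝ) : ℝ := ψ (t₀ + l * τ) (l * exp s)

theorem rescale_mem_quadrant {t₀ l τ : ℝ} (hl : 0 < l) (hlt : l < t₀) (hτ : -1 < τ) (s : ℝ) :
    (t₀ + l * τ, l * exp s) ∈ quadrant :=
  ⟨show 0 < t₀ + l * τ by nlinarith, show 0 < l * exp s by positivity⟩

namespace SmoothOn

variable {F : ℝ → ℝ → ℝ} {t₀ l : ℝ}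

theorem hasDerivAt_logRescale_time (h : SmoothOn F quadrant) (hl : 0 < l) (hlt : l < t₀) {τ : ℝ}
    (hτ : -1 < τ) (s : ℝ) :
    HasDerivAt (fun τ => logRescale F t₀ l τ s) (l * logRescale (pT F) t₀ l τ s) τ := by
  have h1 : HasDerivAt (fun τ => t₀ + l * τ) l τ := by
    simpa using ((hasDerivAt_id τ).const_mul l).const_add t₀
  refine (h.hasDerivAt_comp (a := fun τ => t₀ + l * τ) (b := fun _ => l * exp s)
    (rescale_mem_quadrant hl hlt hτ s) h1 (hasDerivAt_const τ _)).congr_deriv ?_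
  simp only [logRescale]
  ring

theorem hasDerivAt_logRescale_space (h : SmoothOn F quadrant) (hl : 0 < l) (hlt : l < t₀) {τ : ℝ}
    (hτ : -1 < τ) (s : ℝ) :
    HasDerivAt (fun s => logRescale F t₀ l τ s) (l * exp s * logRescale (pR F) t₀ l τ s) s := by
  refine (h.hasDerivAt_comp (a := fun _ => t₀ + l * τ) (b := fun s => l * exp s)
    (rescale_mem_quadrant hl hlt hτ s) (hasDerivAt_const s _)
    ((hasDerivAt_exp s).const_mul l)).congr_deriv ?_
  simp only [logRescale]
  ring

theorem pT_logRescale (h : SmoothOn F quadrant) (hl : 0 < l) (hlt : l < t₀) {τ : ℝ}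
    (hτ : -1 < τ) (s : ℝ) :
    pT (logRescale F t₀ l) τ s = l * logRescale (pT F) t₀ l τ s :=
  (h.hasDerivAt_logRescale_time hl hlt hτ s).deriv

theorem pR_logRescale (h : SmoothOn F quadrant) (hl : 0 < l) (hlt : l < t₀) {τ : ℝ}
    (hτ : -1 < τ) (s : ℝ) :
    pR (logRescale F t₀ l) τ s = l * exp s * logRescale (pR F) t₀ l τ s :=
  (h.hasDerivAt_logRescale_space hl hlt hτ s).deriv

theorem pT_pT_logRescale (h : SmoothOn F quadrant) (hl : 0 < l) (hlt : l < t₀) {τ : ℝ}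
    (hτ : -1 < τ) (s : ℝ) :
    pT (pT (logRescale F t₀ l)) τ s = l ^ 2 * logRescale (pT (pT F)) t₀ l τ s := by
  have e : (fun τ => pT (logRescale F t₀ l) τ s) =ᶠ[nhds τ]
      fun τ => l * logRescale (pT F) t₀ l τ s := by
    filter_upwards [Ioi_mem_nhds hτ] with x hx using h.pT_logRescale hl hlt hx s
  refine (((h.smoothOn_pT.hasDerivAt_logRescale_time hl hlt hτ s).const_mul l).congr_of_eventuallyEq
    e).deriv.trans ?_
  ring

theorem pR_pR_logRescale (h : SmoothOn F quadrant) (hl : 0 < l) (hlt : l < t₀) {τ : ℝ}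
    (hτ : -1 < τ) (s : ℝ) :
    pR (pR (logRescale F t₀ l)) τ s = l * exp s * logRescale (pR F) t₀ l τ s +
      (l * exp s) ^ 2 * logRescale (pR (pR F)) t₀ l τ s := by
  have e : (fun s => pR (logRescale F t₀ l) τ s) =
      fun s => l * exp s * logRescale (pR F) t₀ l τ s :=
    funext fun s => h.pR_logRescale hl hlt hτ s
  unfold pR at e ⊢
  rw [e]
  refine (((hasDerivAt_exp s).const_mul l).mul
    (h.smoothOn_pR.hasDerivAt_logRescale_space hl hlt hτ s)).deriv.trans ?_
  unfold pR
  ring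

theorem smoothOn_logRescale (h : SmoothOn F quadrant) (hl : 0 < l) (hlt : l < t₀) :
    SmoothOn (logRescale F t₀ l) strip := by
  refine ⟨isOpen_Ioi.prod isOpen_univ, ?_⟩
  refine h.contDiffOn.comp (g := fun p : ℝ × ℝ => F p.1 p.2)
    (f := fun p : ℝ × ℝ => (t₀ + l * p.1, l * exp p.2)) ?_ fun p hp =>
      rescale_mem_quadrant hl hlt hp.1 p.2
  exact ((contDiff_const.add (contDiff_const.mul contDiff_fst)).prodMk
    (contDiff_const.mul contDiff_snd.exp)).contDiffOn

end SmoothOn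

/-- Change to the logarithmic radius. -/
theorem integral_comp_mul_exp {g : ℝ → ℝ} (hg : ContinuousOn g (Ioi 0)) {l : ℝ} (hl : 0 < l)
    (a b : ℝ) :
    ∫ s in a..b, g (l * exp s) * (l * exp s) = ∫ r in l * exp a..l * exp b, g r :=
  intervalIntegral.integral_comp_mul_deriv' (f := fun s => l * exp s)
    (fun s _ => (hasDerivAt_exp s).const_mul l) (by fun_prop)
    (hg.mono (by
      rintro _ ⟨s, -, rfl⟩
      exact show 0 < l * exp s by positivity))

namespace WaveMapEnergyLE

variable {ψ : ℝ → ℝ → ℝ} {E t₀ l : ℝ}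

theorem logWave_logRescale (W : WaveMapEnergyLE ψ E) (hl : 0 < l) (hlt : l < t₀) :
    LogWave (logRescale ψ t₀ l) E := by
  have hu := W.smoothOn.smoothOn_logRescale hl hlt
  refine ⟨hu, fun τ s hτ => ?_, fun τ a b hτ hab => ?_⟩
  · rw [W.smoothOn.pT_pT_logRescale hl hlt hτ, W.smoothOn.pR_pR_logRescale hl hlt hτ]
    have hm := rescale_mem_quadrant hl hlt hτ s
    have h := W.eqn _ _ hm.1 hm.2
    have hs := exp_pos s
    simp only [logRescale]
    rw [h]
    field_simp
    ring
  · have hτ' : 0 < t₀ + l * τ := (rescale_mem_quadrant hl hlt hτ 0).1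
    have hc : ContinuousOn (fun r => eDen ψ (t₀ + l * τ) r) (Ioi 0) :=
      W.continuousOn_eDen.comp (f := fun r => (t₀ + l * τ, r)) (by fun_prop)
        fun r hr => ⟨hτ', hr⟩
    have hce : Continuous fun s => eDen ψ (t₀ + l * τ) (l * exp s) * (l * exp s) :=
      (hc.comp_continuous (f := fun s => l * exp s) (by fun_prop) fun s =>
        show 0 < l * exp s by positivity).mul (by fun_prop)
    have hcs : ∀ {G : ℝ → ℝ → ℝ}, SmoothOn G strip → Continuous fun s => G τ s := fun h =>
      h.continuousOn.comp_continuous (f := fun s => (τ, s)) (by fun_prop)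
        fun s => ⟨hτ, mem_univ _⟩
    refine (intervalIntegral.integral_mono_on hab ?_ (hce.intervalIntegrable _ _) ?_).trans
      ((integral_comp_mul_exp hc hl a b).le.trans
        (W.energy_le _ _ _ hτ' (by positivity) (by gcongr)))
    · exact (((hcs hu.smoothOn_pR).pow 2).add
        ((continuous_sin.comp (hcs hu)).pow 2)).intervalIntegrable _ _
    · intro s _
      rw [W.smoothOn.pR_logRescale hl hlt hτ]
      simp only [logRescale, eDen]
      have hs : 0 < l * exp s := by positivity
      have e : ∀ x y z r : ℝ, 0 < r → (x ^ 2 + y ^ 2 + z ^ 2 / r ^ 2) * r * r =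
          r ^ 2 * x ^ 2 + ((r * y) ^ 2 + z ^ 2) := by
        intro x y z r hr
        field_simp
        ring
      rw [e _ _ _ _ hs]
      have : 0 ≤ (l * exp s) ^ 2 * pT ψ (t₀ + l * τ) (l * exp s) ^ 2 := by positivity
      linarith

theorem kinST_logRescale_le (W : WaveMapEnergyLE ψ E) (hl : 0 < l) (hlt : l < t₀) {R b : ℝ}
    (hR : 0 < R) (hb : l * exp R ≤ b) :
    kinST (logRescale ψ t₀ l) (-R) R ≤
      exp R ^ 2 * (l⁻¹ * ∫ t in t₀..t₀ + l * 3, kin ψ (l * exp (-R)) b t) := by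
  have hu := W.smoothOn.smoothOn_logRescale hl hlt
  have hRR : -R ≤ R := by linarith
  have hl0 : 0 < l * exp (-R) := by positivity
  have hb0 : 0 < b := lt_of_lt_of_le (by positivity) hb
  have hck : ContinuousOn (fun τ => kin ψ (l * exp (-R)) b (t₀ + l * τ)) (Icc 0 3) :=
    (W.continuousOn_kin hl0 hb0).comp (f := fun τ => t₀ + l * τ) (by fun_prop)
      fun τ hτ => (rescale_mem_quadrant hl hlt (Icc_subset_Ioi_neg_one hτ) 0).1
  have e := intervalIntegral.integral_comp_add_mul (a := 0) (b := 3)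
    (fun t => kin ψ (l * exp (-R)) b t) hl.ne' t₀
  rw [mul_zero, add_zero, smul_eq_mul] at e
  rw [← e, ← intervalIntegral.integral_const_mul]
  refine intervalIntegral.integral_mono_on (by norm_num)
    (intervalIntegrable_of_continuousOn_Icc (by norm_num)
      (hu.smoothOn_pT.sq.continuousOn_integral_space _ _))
    (intervalIntegrable_of_continuousOn_Icc (by norm_num) (hck.const_mul _)) fun τ hτ => ?_
  have hτ1 := Icc_subset_Ioi_neg_one hτ
  have hτ' : 0 < t₀ + l * τ := (rescale_mem_quadrant hl hlt hτ1 0).1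
  have hc : ContinuousOn (fun r => pT ψ (t₀ + l * τ) r ^ 2 * r) (Ioi 0) :=
    ((W.smoothOn.smoothOn_pT.continuousOn.comp (f := fun r => (t₀ + l * τ, r)) (by fun_prop)
      fun r hr => ⟨hτ', hr⟩).pow 2).mul continuousOn_id
  have hce : Continuous fun s =>
      exp R ^ 2 * (pT ψ (t₀ + l * τ) (l * exp s) ^ 2 * (l * exp s) * (l * exp s)) :=
    continuous_const.mul ((hc.comp_continuous (f := fun s => l * exp s) (by fun_prop) fun s =>
      show 0 < l * exp s by positivity).mul (by fun_prop))
  refine le_trans ?_ (mul_le_mul_of_nonneg_left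
    (W.kin_mono hτ' hl0 le_rfl (by gcongr) hb) (by positivity))
  unfold kin
  rw [← integral_comp_mul_exp hc hl, ← intervalIntegral.integral_const_mul]
  refine intervalIntegral.integral_mono_on hRR
    ((hu.smoothOn_pT.sq.continuous_space hτ).intervalIntegrable _ _)
    (hce.intervalIntegrable _ _) fun s hs => ?_
  rw [W.smoothOn.pT_logRescale hl hlt hτ1]
  simp only [logRescale]
  have h1 : 1 ≤ exp R * exp s := by
    rw [← exp_add]
    exact one_le_exp (by linarith [hs.1])
  have h2 : 1 ≤ (exp R * exp s) ^ 2 := one_le_pow₀ h1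
  calc (l * pT ψ (t₀ + l * τ) (l * exp s)) ^ 2
      = 1 * (l * pT ψ (t₀ + l * τ) (l * exp s)) ^ 2 := (one_mul _).symm
    _ ≤ (exp R * exp s) ^ 2 * (l * pT ψ (t₀ + l * τ) (l * exp s)) ^ 2 := by gcongr
    _ = _ := by ring

/-- The squared distance of the rescaled map to `Q`, in the radial variable. -/
theorem integral_dist_Q_le (W : WaveMapEnergyLE ψ E) (hl : 0 < l) (hlt : l < t₀) {τ L r₁ r₂ : ℝ}
    (hτ : τ ∈ Icc (0 : ℝ) 3) (hL : 0 < L) (h1 : exp (-L) ≤ r₁) (h2 : r₂ ≤ exp L) :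
    ∫ r in Ioc r₁ r₂, ((l * pR ψ (t₀ + l * τ) (l * r) - deriv Q r) ^ 2 +
        (ψ (t₀ + l * τ) (l * r) - Q r) ^ 2 + (l * pT ψ (t₀ + l * τ) (l * r)) ^ 2) * r ≤
      exp L ^ 2 * ∫ s in -L..L, bubbleDist (logRescale ψ t₀ l) τ s := by
  have hτ1 := Icc_subset_Ioi_neg_one hτ
  have hcb := (W.logWave_logRescale hl hlt).smoothOn_bubbleDist.continuous_space hτ
  have hL1 : 1 ≤ exp L ^ 2 := one_le_pow₀ (one_le_exp hL.le)
  have hg : ContinuousOn (fun r => bubbleDist (logRescale ψ t₀ l) τ (log r) / r) (Ioi 0) :=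
    (hcb.comp_continuousOn (continuousOn_log.mono fun r hr => ne_of_gt hr)).div
      continuousOn_id fun r hr => ne_of_gt hr
  have e := integral_comp_mul_exp hg one_pos (-L) L
  simp only [one_mul, log_exp, div_mul_cancel₀ _ (exp_ne_zero _)] at e
  have hLL : exp (-L) ≤ exp L := by gcongr; linarith
  have hint : IntegrableOn (fun r => exp L ^ 2 *
      (bubbleDist (logRescale ψ t₀ l) τ (log r) / r)) (Ioc (exp (-L)) (exp L)) :=
    (((hg.const_mul _).mono fun r hr => lt_of_lt_of_le (exp_pos _) hr.1).integrableOn_Icc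
      (μ := volume)).mono_set Ioc_subset_Icc_self
  have hnn : ∀ r ∈ Ioc (exp (-L)) (exp L), 0 ≤ exp L ^ 2 *
      (bubbleDist (logRescale ψ t₀ l) τ (log r) / r) := fun r hr => by
    have : 0 < r := (exp_pos _).trans hr.1
    unfold bubbleDist
    positivity
  have hsub : Ioc r₁ r₂ ⊆ Ioc (exp (-L)) (exp L) := Ioc_subset_Ioc h1 h2
  rw [e, ← intervalIntegral.integral_const_mul, intervalIntegral.integral_of_le hLL]
  refine le_trans ?_ (setIntegral_mono_set hint
    ((ae_restrict_mem measurableSet_Ioc).mono hnn) hsub.eventuallyLE)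
  refine integral_mono_of_nonneg
    ((ae_restrict_mem measurableSet_Ioc).mono fun r hr => ?_) (hint.mono_set hsub)
    ((ae_restrict_mem measurableSet_Ioc).mono fun r hr => ?_)
  · have : 0 < r := (exp_pos _).trans (hsub hr).1
    simp only [Pi.zero_apply]
    positivity
  · have hr0 : 0 < r := (exp_pos _).trans (hsub hr).1
    obtain ⟨s, rfl⟩ : ∃ s, r = exp s := ⟨log r, (exp_log hr0).symm⟩
    have hsL : exp s ^ 2 ≤ exp L ^ 2 := by
      have := (hsub hr).2
      gcongr
    simp only [log_exp, bubbleDist, W.smoothOn.pT_logRescale hl hlt hτ1,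
      W.smoothOn.pR_logRescale hl hlt hτ1, (hasDerivAt_Q _).deriv]
    simp only [logRescale, logQ, sin_Q]
    have e1 : ∀ x y z w : ℝ, ((x - w / (1 + exp s ^ 2)) ^ 2 + y ^ 2 + z ^ 2) * exp s =
        ((exp s * x - w * exp s / (1 + exp s ^ 2)) ^ 2 + exp s ^ 2 * y ^ 2 + exp s ^ 2 * z ^ 2) /
          exp s := by
      intro x y z w
      field_simp
    rw [e1, ← mul_div_assoc]
    gcongr
    rw [mul_add, mul_add]
    gcongr
    rw [show exp s * (l * pR ψ (t₀ + l * τ) (l * exp s)) =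
      l * exp s * pR ψ (t₀ + l * τ) (l * exp s) by ring]
    exact le_mul_of_one_le_left (sq_nonneg _) hL1

end WaveMapEnergyLE

/-- A global wave map of positive degree bubbles off a harmonic map along rescalings. -/
theorem WaveMapEnergyLE.exists_bubble {ψ : ℝ → ℝ → ℝ} {E : ℝ} (W : WaveMapEnergyLE ψ E) {k : ℤ}
    (hk : 1 ≤ k) (h0 : ∀ t, 0 < t → Tendsto (ψ t) (nhdsWithin 0 (Ioi 0)) (nhds 0))
    (hlim : ∀ t, 0 < t → Tendsto (ψ t) atTop (nhds (k * π))) :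
    ∃ tn lamn : ℕ → ℝ, Tendsto tn atTop atTop ∧ (∀ n, 0 < lamn n) ∧
      Tendsto (fun n => lamn n / tn n) atTop (nhds 0) ∧
      ∀ r₁ r₂ : ℝ, 0 < r₁ → r₁ < r₂ →
        Tendsto (fun n => ∫ t in Ioc (0 : ℝ) 1, ∫ r in Ioc r₁ r₂,
          ((lamn n * pR ψ (tn n + lamn n * t) (lamn n * r) - deriv Q r) ^ 2 +
            (ψ (tn n + lamn n * t) (lamn n * r) - Q r) ^ 2 +
            (lamn n * pT ψ (tn n + lamn n * t) (lamn n * r)) ^ 2) * r) atTop (nhds 0) := by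
  have hη (n : ℕ) : (0 : ℝ) < 1 / ((n : ℝ) + 2) := by positivity
  choose t l hTt ht1 hl hlt hc hleft hkin using fun n : ℕ =>
    W.exists_concentration hk h0 hlim (hη n) n
  have hη0 : Tendsto (fun n : ℕ => 1 / ((n : ℝ) + 2)) atTop (nhds 0) :=
    (tendsto_const_nhds (x := (1 : ℝ))).div_atTop
      (tendsto_atTop_add_const_right _ _ tendsto_natCast_atTop_atTop)
  have hlt' n : l n < t n := by
    have h1 : 1 / ((n : ℝ) + 2) < 1 := by
      rw [div_lt_one (by positivity)]
      linarith [n.cast_nonneg (α := ℝ)]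
    nlinarith [hlt n, ht1 n]
  have B : BubblingSeq (fun n => logRescale ψ (t n) (l n)) E := by
    refine ⟨fun n => W.logWave_logRescale (hl n) (hlt' n), fun R hR => ?_, fun n => ?_,
      fun n s hs => ?_⟩
    · have h3 := hη0.const_mul (exp R ^ 2 * 3)
      rw [mul_zero] at h3
      refine squeeze_zero' (Eventually.of_forall fun n => kinST_nonneg _ (by linarith)) ?_ h3
      filter_upwards [hη0.eventually_lt_const (show (0 : ℝ) < 1 / (9 * exp R) by positivity)]
        with n hn
      have ht0 : 0 < t n := by linarith [ht1 n]
      have hR1 : 1 ≤ exp R := one_le_exp hR.le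
      have h4 : l n * exp R ≤ t n / 9 := by
        have : l n ≤ 1 / (9 * exp R) * t n := (hlt n).trans (by gcongr)
        calc l n * exp R ≤ 1 / (9 * exp R) * t n * exp R := by gcongr
          _ = t n / 9 := by field_simp
      have h5 : l n ≤ t n / 9 := le_trans (by nlinarith [hl n]) h4
      have h6 : exp (-R) ≤ 1 := exp_le_one_iff.2 (by linarith)
      have h7 : l n * exp (-R) ≤ t n / 9 := le_trans (by nlinarith [hl n]) h5
      refine (W.kinST_logRescale_le (hl n) (hlt' n) hR
        (show l n * exp R ≤ t n / 3 by linarith)).trans ?_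
      have h8 := hkin n (l n * 3) (l n * exp (-R)) (by linarith [hl n]) (by linarith)
        (mul_pos (hl n) (exp_pos _)) (by linarith)
      have hln := hl n
      calc _ ≤ exp R ^ 2 * ((l n)⁻¹ * (1 / ((n : ℝ) + 2) * (l n * 3))) := by gcongr
        _ = _ := by field_simp
    · simp [logRescale, hc n]
    · have : l n * exp s < l n := mul_lt_of_lt_one_right (hl n) (exp_lt_one_iff.2 hs)
      have h := hleft n (l n * exp s) (mul_pos (hl n) (exp_pos s)) this
      simpa [logRescale] using h.le
  have htop : Tendsto t atTop atTop := tendsto_atTop_mono hTt tendsto_natCast_atTop_atTop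
  refine ⟨fun n => t n + l n, l, tendsto_atTop_mono (fun n => by linarith [hl n]) htop, hl,
    squeeze_zero (fun n => ?_) (fun n => ?_) hη0, fun r₁ r₂ hr₁ hr => ?_⟩
  · have := hl n
    have := ht1 n
    positivity
  · rw [div_le_iff₀ (by linarith [hl n, ht1 n])]
    exact (hlt n).trans (mul_le_mul_of_nonneg_left (by linarith [hl n]) (hη n).le)
  obtain ⟨L, hLdef⟩ : ∃ L, L = max 1 (max (-log r₁) (log r₂)) := ⟨_, rfl⟩
  have hL : 0 < L := lt_of_lt_of_le one_pos (hLdef ▸ le_max_left _ _)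
  have hL1 : exp (-L) ≤ r₁ := by
    have : -log r₁ ≤ L := hLdef ▸ (le_max_left _ _).trans (le_max_right _ _)
    rw [← le_log_iff_exp_le hr₁]
    linarith
  have hL2 : r₂ ≤ exp L := by
    have : log r₂ ≤ L := hLdef ▸ (le_max_right _ _).trans (le_max_right _ _)
    rwa [← log_le_iff_le_exp (hr₁.trans hr)]
  have h3 := (B.tendsto_integral_bubbleDist hL).const_mul (exp L ^ 2)
  rw [mul_zero] at h3
  have hnn (n : ℕ) (τ : ℝ) : 0 ≤ ∫ r in Ioc r₁ r₂,
      ((l n * pR ψ (t n + l n + l n * τ) (l n * r) - deriv Q r) ^ 2 +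
        (ψ (t n + l n + l n * τ) (l n * r) - Q r) ^ 2 +
        (l n * pT ψ (t n + l n + l n * τ) (l n * r)) ^ 2) * r :=
    setIntegral_nonneg measurableSet_Ioc fun r hr => by
      have : 0 < r := hr₁.trans hr.1
      positivity
  refine squeeze_zero (fun n => setIntegral_nonneg measurableSet_Ioc fun τ _ => hnn n τ)
    (fun n => ?_) h3
  have hcB : ContinuousOn (fun τ =>
      ∫ s in -L..L, bubbleDist (logRescale ψ (t n) (l n)) τ s) (Icc 0 3) :=
    (B.logWave n).smoothOn_bubbleDist.continuousOn_integral_space _ _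
  have e := intervalIntegral.integral_comp_add_left (a := 0) (b := 1)
    (fun τ => ∫ s in -L..L, bubbleDist (logRescale ψ (t n) (l n)) τ s) 1
  rw [add_zero, one_add_one_eq_two] at e
  rw [← e, ← intervalIntegral.integral_const_mul,
    intervalIntegral.integral_of_le zero_le_one]
  refine integral_mono_of_nonneg (Eventually.of_forall fun τ => hnn n τ) ?_
    ((ae_restrict_mem measurableSet_Ioc).mono fun τ hτ => ?_)
  · refine (ContinuousOn.integrableOn_Icc (μ := volume) ?_).mono_set Ioc_subset_Icc_self
    refine (hcB.comp (f := fun τ => 1 + τ) (by fun_prop) fun τ hτ => ?_).const_mul _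
    exact ⟨by linarith [hτ.1], by linarith [hτ.2]⟩
  · have h := W.integral_dist_Q_le (hl n) (hlt' n) (τ := 1 + τ)
      ⟨by linarith [hτ.1], by linarith [hτ.2]⟩ hL hL1 hL2
    rw [show t n + l n * (1 + τ) = t n + l n + l n * τ by ring] at h
    exact h

theorem pT_neg (ψ : ℝ → ℝ → ℝ) : (pT fun t r => -ψ t r) = fun t r => -pT ψ t r := by
  ext t r
  exact deriv.fun_neg

theorem pR_neg (ψ : ℝ → ℝ → ℝ) : (pR fun t r => -ψ t r) = fun t r => -pR ψ t r := by
  ext t r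
  exact deriv.fun_neg

theorem WaveMapEnergyLE.neg {ψ : ℝ → ℝ → ℝ} {E : ℝ} (W : WaveMapEnergyLE ψ E) :
    WaveMapEnergyLE (fun t r => -ψ t r) E := by
  refine ⟨⟨W.smoothOn.isOpen, W.smoothOn.contDiffOn.neg⟩, fun t r ht hr => ?_,
    fun t a b ht ha hab => ?_⟩
  · simp only [pT_neg, pR_neg, mul_neg, sin_neg]
    rw [W.eqn t r ht hr]
    ring
  · refine le_trans (le_of_eq ?_) (W.energy_le t a b ht ha hab)
    simp only [eDen, pT_neg, pR_neg, sin_neg, neg_sq]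

theorem IsWaveMap.waveMapEnergyLE {ψ : ℝ → ℝ → ℝ} (h : IsWaveMap ψ) (hE : FiniteEnergy ψ)
    (hc : EnergyConserved ψ) : WaveMapEnergyLE ψ (totE ψ 0) := by
  refine ⟨⟨isOpen_Ioi.prod isOpen_Ioi, h.1.mono (prod_mono Ioi_subset_Ici_self subset_rfl)⟩,
    fun t r ht hr => ?_, fun t a b ht ha hab => ?_⟩
  · have e := h.2 t r ht.le hr
    change pT (pT ψ) t r - pR (pR ψ) t r - 1 / r * pR ψ t r + sin (2 * ψ t r) / (2 * r ^ 2) = 0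
      at e
    rw [one_div_mul_eq_div] at e
    linarith
  · rw [← hc t ht.le, intervalIntegral.integral_of_le hab]
    exact setIntegral_mono_set (hE t ht.le)
      ((ae_restrict_mem measurableSet_Ioi).mono fun r hr => eDen_nonneg ψ t (le_of_lt hr))
      (Ioc_subset_Ioi_self.trans (Ioi_subset_Ioi ha.le)).eventuallyLE

/-- extraction of a harmonic map at `t = +∞` for global wave maps of nonzero degree
(Struwe-type bubbling). -/
theorem stmt6_harmonic_map_extraction
    (ψ : ℝ → ℝ → ℝ) (k : ℤ)
    (hwm : IsWaveMap ψ) (hfe : FiniteEnergy ψ) (hcons : EnergyConserved ψ)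
    (hk : k ≠ 0)
    (hbc0 : ∀ t : ℝ, 0 ≤ t → Filter.Tendsto (ψ t) (nhdsWithin 0 (Set.Ioi 0)) (nhds 0))
    (hbcinf : ∀ t : ℝ, 0 ≤ t → Filter.Tendsto (ψ t) Filter.atTop (nhds (k * Real.pi))) :
    ∃ tn lamn : ℕ → ℝ, ∃ lam0 κ : ℝ,
      Filter.Tendsto tn Filter.atTop Filter.atTop ∧
      (∀ n, 0 < lamn n) ∧
      Filter.Tendsto (fun n => lamn n / tn n) Filter.atTop (nhds 0) ∧
      0 < lam0 ∧ (κ = 1 ∨ κ = -1) ∧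
      ∀ r₁ r₂ : ℝ, 0 < r₁ → r₁ < r₂ →
        Filter.Tendsto
          (fun n => ∫ t in Set.Ioc (0:ℝ) 1, ∫ r in Set.Ioc r₁ r₂,
            ((lamn n * pR ψ (tn n + lamn n * t) (lamn n * r)
                - κ * ((1 / lam0) * deriv Q (r / lam0))) ^ 2
              + (ψ (tn n + lamn n * t) (lamn n * r) - κ * Q (r / lam0)) ^ 2
              + (lamn n * pT ψ (tn n + lamn n * t) (lamn n * r)) ^ 2) * r)
          Filter.atTop (nhds 0) := by
  have W := hwm.waveMapEnergyLE hfe hcons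
  rcases lt_or_gt_of_ne hk with hneg | hpos
  · obtain ⟨tn, lamn, h1, h2, h3, h4⟩ := W.neg.exists_bubble (k := -k) (by lia)
      (fun t ht => by simpa using (hbc0 t ht.le).neg)
      (fun t ht => by simpa using (hbcinf t ht.le).neg)
    refine ⟨tn, lamn, 1, -1, h1, h2, h3, one_pos, Or.inr rfl, fun r₁ r₂ hr₁ hr => ?_⟩
    refine (h4 r₁ r₂ hr₁ hr).congr fun n => ?_
    simp only [pT_neg, pR_neg, div_one]
    congr! 4
    ring
  · obtain ⟨tn, lamn, h1, h2, h3, h4⟩ := W.exists_bubble (k := k) hpos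
      (fun t ht => hbc0 t ht.le) (fun t ht => hbcinf t ht.le)
    refine ⟨tn, lamn, 1, 1, h1, h2, h3, one_pos, Or.inl rfl, fun r₁ r₂ hr₁ hr => ?_⟩
    simpa using h4 r₁ r₂ hr₁ hr
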